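/- arXiv:2308.10853 — 2 statements merged into one kernel-verified Lean document; each statement's English description precedes it below -/
import Mathlib

section
/- Let q be an odd prime power, d ≥ 3, and let Q be a non-degenerate quadratic form on F_q^d, with associated distance φ(x,y) = Q(x−y). Let f, g : F_q^d × F_q^d → ℝ be nonnegative functions and define F(x) = Σ_y f(x,y), G(z) = Σ_w g(z,w), F′(y) = Σ_x f(x,y), G′(w) = Σ_z g(z,w). Write ‖f‖₁ = Σ_{x,y} f(x,y), ‖f‖₂ = (Σ_{x,y} f(x,y)²)^{1/2}, and similarly for g, and ‖F‖₂ = (Σ_x F(x)²)^{1/2}, etc. Then for every t ∈ F_q \ {0}: | Σ_{(x,y,z,w): φ(x,z) = t and φ(w,y) = t} f(x,y) g(z,w) − q^{−2} ‖f‖₁ ‖g‖₁ | ≤ 3 q^{−(d+2)/2} ‖f‖₁ ‖g‖₁ + 4 q^{d−1} ‖f‖₂ ‖g‖₂ + 4 q^{(d−3)/2} ( ‖F‖₂ ‖G‖₂ + ‖F′‖₂ ‖G′‖₂ ). -/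
open Finset

namespace Stepanov
open Polynomial

variable {k : Type} [Field k]

/-- uniqueness of base `X^M` expansions -/
lemma eval_X_pow_eq_zero (M : ℕ) (P : k[X][X]) (hP : ∀ j, (P.coeff j).natDegree < M)
    (h0 : P.eval (X ^ M) = 0) : P = 0 := by
  ext j i
  simp only [coeff_zero]
  by_cases hi : i < M
  · have h := congrArg (fun R => R.coeff (j * M + i)) h0
    simp only [eval_eq_sum_range, ← pow_mul, finsetSum_coeff, coeff_mul_X_pow', coeff_zero] at h
    rw [Finset.sum_eq_single j] at h
    · rw [if_pos (by nlinarith)] at h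
      rw [mul_comm M j] at h
      simpa using h
    · intro l _ hl
      rcases lt_or_gt_of_ne hl with hl | hl
      · rw [if_pos (by nlinarith)]
        apply coeff_eq_zero_of_natDegree_lt
        refine lt_of_lt_of_le (hP l) ?_
        have : (l + 1) * M ≤ j * M := Nat.mul_le_mul_right _ hl
        have h2 : (l + 1) * M = M * l + M := by ring
        omega
      · rw [if_neg]
        have : (j + 1) * M ≤ l * M := Nat.mul_le_mul_right _ hl
        have h2 : (j + 1) * M = j * M + M := by ring
        rw [mul_comm M l]
        omega
    · intro hj
      have : P.coeff j = 0 := coeff_eq_zero_of_natDegree_lt (by simpa using hj)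
      simp [this]
  · exact coeff_eq_zero_of_natDegree_lt (lt_of_lt_of_le (hP j) (not_lt.mp hi))

lemma parity (f : k[X]) (hf : f.Separable) (hdeg : 0 < f.natDegree) (Ft : k[X]) (hFt : Ft ≠ 0)
    (U V : k[X][X]) (h : C f * U ^ 2 = Ft.map C * V ^ 2) : U = 0 ∧ V = 0 := by
  have hf0 : f ≠ 0 := by rintro rfl; simp at hdeg
  have hM0 : (Ft.map C : k[X][X]) ≠ 0 := by
    rwa [Ne, Polynomial.map_eq_zero_iff C_injective]
  have hCf : (C f : k[X][X]) ≠ 0 := by simpa using hf0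
  by_cases hU : U = 0
  · refine ⟨hU, ?_⟩
    subst hU
    have : Ft.map C * V ^ 2 = 0 := by rw [← h]; simp
    rcases mul_eq_zero.mp this with h1 | h1
    · exact absurd h1 hM0
    · exact pow_eq_zero_iff (two_ne_zero) |>.mp h1
  · exfalso
    have hV : V ≠ 0 := by
      rintro rfl
      have : C f * U ^ 2 = 0 := by rw [h]; simp
      rcases mul_eq_zero.mp this with h1 | h1
      · exact hCf h1
      · exact hU (pow_eq_zero_iff (two_ne_zero) |>.mp h1)
    obtain ⟨π, hπ, g, hg⟩ := WfDvdMonoid.exists_irreducible_factor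
      (not_isUnit_of_natDegree_pos f hdeg) hf0
    have hπg : ¬ π ∣ g := by
      rintro ⟨g', rfl⟩
      have hsq : Squarefree f := hf.squarefree
      exact hπ.not_isUnit (hsq π ⟨g', by rw [hg]; ring⟩)
    have hp : Prime (C π : k[X][X]) := prime_C_iff.mpr hπ.prime
    have hg1 : ¬ (C π : k[X][X]) ∣ C g := by
      intro hd
      rw [C_dvd_iff_dvd_coeff] at hd
      have := hd 0
      rw [coeff_C_zero] at this
      exact hπg this
    have hF1 : ¬ (C π : k[X][X]) ∣ Ft.map C := by
      intro hd
      rw [C_dvd_iff_dvd_coeff] at hd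
      obtain ⟨n, hn⟩ : ∃ n, Ft.coeff n ≠ 0 := by
        by_contra hcon
        push Not at hcon
        exact hFt (by ext n; simpa using hcon n)
      have := hd n
      rw [coeff_map] at this
      exact hπ.not_isUnit (isUnit_of_dvd_unit this (by simpa using hn))
    have e1 := congrArg (emultiplicity (C π : k[X][X])) h
    have fU : FiniteMultiplicity (C π : k[X][X]) U := FiniteMultiplicity.of_prime_left hp hU
    have fV : FiniteMultiplicity (C π : k[X][X]) V := FiniteMultiplicity.of_prime_left hp hV
    have fpi : FiniteMultiplicity (C π : k[X][X]) (C π) := FiniteMultiplicity.of_prime_left hp hp.ne_zero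
    rw [emultiplicity_mul hp, emultiplicity_mul hp, emultiplicity_pow hp, emultiplicity_pow hp, hg,
      C_mul, emultiplicity_mul hp, emultiplicity_eq_zero.mpr hg1, emultiplicity_eq_zero.mpr hF1,
      fpi.emultiplicity_self, fU.emultiplicity_eq_multiplicity,
      fV.emultiplicity_eq_multiplicity] at e1
    norm_cast at e1
    omega

lemma D_mul {P Q : k[X][X]} {a b : ℕ} (hP : ∀ j, (P.coeff j).natDegree ≤ a)
    (hQ : ∀ j, (Q.coeff j).natDegree ≤ b) (j : ℕ) : ((P * Q).coeff j).natDegree ≤ a + b := by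
  rw [coeff_mul]
  apply natDegree_sum_le_of_forall_le
  intro i _
  exact natDegree_mul_le.trans (add_le_add (hP _) (hQ _))

/-- the bivariate polynomial attached to a coefficient table -/
noncomputable def tab (J L : ℕ) (b : Fin J × Fin L → k) : k[X][X] :=
  ∑ i, monomial (i.1 : ℕ) (monomial (i.2 : ℕ) (b i))

lemma tab_coeff (J L : ℕ) (b : Fin J × Fin L → k) (i : Fin J × Fin L) :
    ((tab J L b).coeff i.1).coeff i.2 = b i := by
  simp only [tab, finsetSum_coeff, coeff_monomial]
  rw [Finset.sum_eq_single i]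
  · simp
  · intro l _ hl
    by_cases h1 : (l.1 : ℕ) = i.1
    · by_cases h2 : (l.2 : ℕ) = i.2
      · exact absurd (Prod.ext (Fin.ext h1) (Fin.ext h2)) hl
      · simp [h1, coeff_monomial, h2]
    · simp [h1]
  · simp

lemma tab_natDegree (J L : ℕ) (b : Fin J × Fin L → k) (j : ℕ) :
    ((tab J L b).coeff j).natDegree ≤ L - 1 := by
  simp only [tab, finsetSum_coeff, coeff_monomial]
  apply natDegree_sum_le_of_forall_le
  intro i _
  split_ifs
  · exact (natDegree_monomial_le _).trans (by omega)
  · simp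

lemma stepanov [Fintype k] [DecidableEq k] (p s h r : ℕ) [Fact p.Prime] [CharP k p]
    (hM : p ^ s = 2 * h + 1) (hcard : Fintype.card k = (2 * h + 1) ^ 2) (hr : 0 < r)
    (hrh : r ^ 2 ≤ h) (f : k[X]) (hsep : f.Separable) (hdeg : f.natDegree = 2 * r) :
    #{x : k | f.eval x ^ (2 * h ^ 2 + 2 * h) = 1} ≤ 2 * h ^ 2 + 2 * h + 4 * r * h := by
  classical
  set M := 2 * h + 1 with hMdef
  have hrh' : r ≤ h := by nlinarith
  obtain ⟨L, hL⟩ : ∃ L, L = h - r + 1 := ⟨_, rfl⟩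
  obtain ⟨J, hJ⟩ : ∃ J, J = h + r + 1 := ⟨_, rfl⟩
  obtain ⟨u, hu⟩ : ∃ u, h = r + u := ⟨h - r, by omega⟩
  let Φ : ((Fin J × Fin L → k) × (Fin J × Fin L → k)) →ₗ[k] k[X] :=
    { toFun := fun bc => ∑ i : Fin J × Fin L, X ^ ((i.1 : ℕ) + i.2 * M) * (C (bc.1 i) * f ^ h + C (bc.2 i))
      map_add' := by
        intro x y
        rw [← Finset.sum_add_distrib]
        refine Finset.sum_congr rfl fun i _ => ?_
        simp only [Prod.fst_add, Prod.snd_add, Pi.add_apply, C_add]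
        ring
      map_smul' := by
        intro c x
        rw [RingHom.id_apply, smul_eq_C_mul, Finset.mul_sum]
        refine Finset.sum_congr rfl fun i _ => ?_
        simp only [Prod.smul_fst, Prod.smul_snd, Pi.smul_apply, smul_eq_mul, C_mul]
        ring }
  have hΦ : ∀ bc, Φ bc ∈ degreeLT k (2 * h ^ 2 + 2 * h + 1) := by
    intro bc
    show (∑ i : Fin J × Fin L, X ^ ((i.1 : ℕ) + i.2 * M) * (C (bc.1 i) * f ^ h + C (bc.2 i))) ∈ _
    apply Submodule.sum_mem
    rintro ⟨i, l⟩ _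
    rw [mem_degreeLT]
    refine lt_of_le_of_lt degree_le_natDegree ?_
    norm_cast
    have h1 : (C (bc.1 (i, l)) * f ^ h + C (bc.2 (i, l))).natDegree ≤ h * (2 * r) := by
      refine (natDegree_add_le _ _).trans (max_le ?_ (by simp))
      refine (natDegree_C_mul_le _ _).trans ?_
      exact natDegree_pow_le.trans (by rw [hdeg])
    refine lt_of_le_of_lt (natDegree_mul_le.trans (add_le_add (natDegree_X_pow_le _) h1)) ?_
    have hi : (i : ℕ) ≤ h + r := by omega
    have hl : (l : ℕ) ≤ u := by omega
    have : (l : ℕ) * M ≤ u * M := Nat.mul_le_mul_right _ hl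
    rw [hMdef] at this ⊢
    subst hu
    simp only
    nlinarith
  obtain ⟨bc, hbc, hbc0⟩ : ∃ bc, Φ bc = 0 ∧ bc ≠ 0 := by
    let Φ' := Φ.codRestrict _ hΦ
    have hlt : Module.finrank k (degreeLT k (2 * h ^ 2 + 2 * h + 1)) <
        Module.finrank k ((Fin J × Fin L → k) × (Fin J × Fin L → k)) := by
      rw [(degreeLTEquiv k _).finrank_eq]
      simp only [Module.finrank_prod, Module.finrank_fintype_fun_eq_card, Fintype.card_fin,
        Fintype.card_prod]
      rw [hL, hJ]
      subst hu
      have : r + u - r = u := by omega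
      rw [this]
      nlinarith
    have : FiniteDimensional k (degreeLT k (2 * h ^ 2 + 2 * h + 1)) :=
      (degreeLTEquiv k _).symm.finiteDimensional
    have hk := LinearMap.ker_ne_bot_of_finrank_lt (f := Φ') hlt
    obtain ⟨bc, h1, h2⟩ := (Submodule.ne_bot_iff _).mp hk
    refine ⟨bc, ?_, h2⟩
    have := LinearMap.mem_ker.mp h1
    exact congrArg Subtype.val this
  obtain ⟨b, c⟩ := bc
  set U := tab J L (fun i => b i ^ M) with hU
  set V := tab J L (fun i => c i ^ M) with hV
  set B := U.eval (X ^ M) + f ^ h * V.eval (X ^ M) with hB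
  have hpowM : ∀ x : k, (x ^ M) ^ M = x := by
    intro x
    rw [← pow_mul, ← sq, ← hcard, FiniteField.pow_card]
  have hBne : B ≠ 0 := by
    intro hB0
    have e1 : U.eval (X ^ M) = - (f ^ h * V.eval (X ^ M)) := by
      rw [hB] at hB0; linear_combination hB0
    have e2 : ((f.map (iterateFrobenius k p s)).map C : k[X][X]).eval (X ^ M) = f ^ M := by
      rw [← hM, ← map_iterateFrobenius_expand p f s, map_expand, expand_eq_comp_X_pow, comp, eval_map]
    have e3 : C f * U ^ 2 - (f.map (iterateFrobenius k p s)).map C * V ^ 2 = 0 := by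
      apply eval_X_pow_eq_zero M
      · intro j
        have d1 : ((C f * U ^ 2).coeff j).natDegree ≤ 2 * r + ((L - 1) + (L - 1)) := by
          rw [sq]
          refine D_mul ?_ (D_mul (tab_natDegree J L _) (tab_natDegree J L _)) j
          intro j
          rw [coeff_C]
          split_ifs
          · rw [hdeg]
          · simp
        have d2 : (((f.map (iterateFrobenius k p s)).map C * V ^ 2).coeff j).natDegree ≤
            0 + ((L - 1) + (L - 1)) := by
          rw [sq]
          refine D_mul ?_ (D_mul (tab_natDegree J L _) (tab_natDegree J L _)) j
          intro j
          rw [coeff_map]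
          simp
        rw [coeff_sub]
        refine lt_of_le_of_lt (natDegree_sub_le_of_le d1 d2) ?_
        rw [max_lt_iff]
        omega
      · rw [eval_sub, eval_mul, eval_mul, e2, eval_C, eval_pow, eval_pow, e1, hMdef]
        ring
    have hf0 : f ≠ 0 := by rintro rfl; simp at hdeg; omega
    obtain ⟨hU0, hV0⟩ := parity f hsep (by omega) (f.map (iterateFrobenius k p s))
      (by rwa [Ne, Polynomial.map_eq_zero]) U V (sub_eq_zero.mp e3)
    apply hbc0
    have hMne : M ≠ 0 := by omega
    ext i
    · have := tab_coeff J L (fun i => b i ^ M) i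
      rw [← hU, hU0] at this
      simpa [hMne] using this.symm
    · have := tab_coeff J L (fun i => c i ^ M) i
      rw [← hV, hV0] at this
      simpa [hMne] using this.symm
  have hBdeg : B.natDegree ≤ 2 * h ^ 2 + 2 * h + 4 * r * h := by
    have ht : ∀ b' : Fin J × Fin L → k, ((tab J L b').eval (X ^ M)).natDegree ≤ (h - r) + (h + r) * M := by
      intro b'
      rw [tab, eval_finsetSum]
      apply natDegree_sum_le_of_forall_le
      rintro ⟨i, l⟩ _
      rw [eval_monomial]
      refine natDegree_mul_le.trans (add_le_add ((natDegree_monomial_le _).trans ?_) ?_)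
      · simp only; omega
      · rw [← pow_mul, mul_comm]
        refine (natDegree_X_pow_le _).trans (Nat.mul_le_mul_right _ ?_)
        simp only; omega
    have h3 : (f ^ h * V.eval (X ^ M)).natDegree ≤ h * (2 * r) + ((h - r) + (h + r) * M) :=
      natDegree_mul_le.trans (add_le_add (natDegree_pow_le.trans (by rw [hdeg])) (ht _))
    refine (natDegree_add_le_of_degree_le ((ht _).trans ?_) h3).trans ?_
    · omega
    · rw [hMdef]
      have : h - r = u := by omega
      rw [this]
      subst hu
      nlinarith
  refine le_trans ?_ hBdeg
  refine le_trans ?_ (card_roots' B)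
  refine le_trans ?_ (Multiset.toFinset_card_le _)
  apply Finset.card_le_card
  intro x hx
  rw [Finset.mem_filter] at hx
  have hx1 := hx.2
  rw [Multiset.mem_toFinset, mem_roots hBne, IsRoot]
  have hadd : ∀ y z : k, (y + z) ^ M = y ^ M + z ^ M := by
    intro y z
    rw [← hM, add_pow_char_pow]
  have hsum : ∀ g : Fin J × Fin L → k, (∑ i, g i) ^ M = ∑ i, g i ^ M := by
    intro g
    rw [← hM]
    exact map_sum (iterateFrobenius k p s) g _
  have hteval : ∀ b' : Fin J × Fin L → k,
      (((tab J L (fun i => b' i ^ M)).eval (X ^ M)).eval x) ^ M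
        = ∑ i : Fin J × Fin L, b' i * x ^ ((i.1 : ℕ) + i.2 * M) := by
    intro b'
    rw [tab, eval_finsetSum, eval_finsetSum, hsum]
    refine Finset.sum_congr rfl fun i _ => ?_
    rw [eval_monomial, eval_mul, eval_monomial, eval_pow, eval_pow, eval_X, mul_pow, mul_pow, hpowM]
    have : ((x ^ M) ^ (i.1 : ℕ)) ^ M = x ^ (i.1 : ℕ) := by
      rw [pow_right_comm, hpowM]
    rw [this, pow_add, pow_mul]
    ring
  have hΦx : (∑ i : Fin J × Fin L, x ^ ((i.1 : ℕ) + i.2 * M) * (b i * f.eval x ^ h + c i)) = 0 := by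
    have := congrArg (eval x) hbc
    simpa [Φ, eval_finsetSum] using this
  have key : f.eval x ^ h * (B.eval x) ^ M = 0 := by
    rw [hB, eval_add, eval_mul, hadd, mul_pow, hteval, hteval, eval_pow]
    have e : f.eval x ^ h * (f.eval x ^ h) ^ M = 1 := by
      rw [← hx1, hMdef]; ring
    rw [mul_add, ← mul_assoc, e, one_mul, Finset.mul_sum, ← Finset.sum_add_distrib, ← hΦx]
    refine Finset.sum_congr rfl fun i _ => ?_
    ring
  rcases mul_eq_zero.mp key with h1 | h1
  · exfalso
    have h2 : f.eval x = 0 := by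
      by_contra hne
      exact pow_ne_zero _ hne h1
    rw [h2, zero_pow (by nlinarith)] at hx1
    exact zero_ne_one hx1
  · by_contra hne
    exact pow_ne_zero _ hne h1

end Stepanov

namespace Kloos
open Polynomial

variable {k : Type} [Field k] [Fintype k] [DecidableEq k]

lemma charsum_bound (p s h r : ℕ) [Fact p.Prime] [CharP k p] (h2 : ringChar k ≠ 2)
    (hM : p ^ s = 2 * h + 1) (hcard : Fintype.card k = (2 * h + 1) ^ 2) (hr : 0 < r)
    (hrh : r ^ 2 ≤ h) (f : k[X]) (hsep : f.Separable) (hdeg : f.natDegree = 2 * r) :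
    |∑ x : k, quadraticChar k (f.eval x)| ≤ 4 * r * (2 * h + 1) := by
  have hc2 : Fintype.card k / 2 = 2 * h ^ 2 + 2 * h := by
    rw [hcard]
    have : (2 * h + 1) ^ 2 = 2 * (2 * h ^ 2 + 2 * h) + 1 := by ring
    omega
  have hpow : ∀ y : k, quadraticChar k y = 1 → y ^ (2 * h ^ 2 + 2 * h) = 1 := by
    intro y hy
    have hy0 : y ≠ 0 := by rintro rfl; simp at hy
    rw [quadraticChar_eq_pow_of_char_ne_two h2 hy0, hc2] at hy
    by_contra hne
    rw [if_neg hne] at hy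
    norm_num at hy
  have b1 : #{x : k | quadraticChar k (f.eval x) = 1} ≤ 2 * h ^ 2 + 2 * h + 4 * r * h := by
    refine le_trans (Finset.card_le_card ?_) (Stepanov.stepanov p s h r hM hcard hr hrh f hsep hdeg)
    intro x hx
    rw [Finset.mem_filter] at hx ⊢
    exact ⟨hx.1, hpow _ hx.2⟩
  obtain ⟨η, hη⟩ := quadraticChar_exists_neg_one h2
  have hη0 : η ≠ 0 := by rintro rfl; simp at hη
  have b2 : #{x : k | quadraticChar k (f.eval x) = -1} ≤ 2 * h ^ 2 + 2 * h + 4 * r * h := by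
    refine le_trans (Finset.card_le_card ?_) (Stepanov.stepanov p s h r hM hcard hr hrh (C η * f) ?_ ?_)
    · intro x hx
      rw [Finset.mem_filter] at hx ⊢
      refine ⟨hx.1, hpow _ ?_⟩
      rw [eval_mul, eval_C, map_mul, hη, hx.2]; norm_num
    · obtain ⟨u, v, huv⟩ := hsep
      have i1 : C η⁻¹ * C η = (1 : k[X]) := by rw [← C_mul, inv_mul_cancel₀ hη0, C_1]
      refine ⟨C η⁻¹ * u, C η⁻¹ * v, ?_⟩
      rw [derivative_C_mul]
      linear_combination huv + (u * f + v * derivative f) * i1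
    · rw [natDegree_C_mul hη0, hdeg]
  have hf0 : f ≠ 0 := by rintro rfl; simp at hdeg; omega
  have b0 : #{x : k | quadraticChar k (f.eval x) = 0} ≤ 2 * r := by
    rw [← hdeg]
    refine le_trans (le_trans (Finset.card_le_card ?_) (Multiset.toFinset_card_le f.roots)) (card_roots' f)
    intro x hx
    rw [Finset.mem_filter, quadraticChar_eq_zero_iff] at hx
    rw [Multiset.mem_toFinset, mem_roots hf0]
    exact hx.2
  have tri : ∀ y : k, quadraticChar k y = 0 ∨ quadraticChar k y = 1 ∨ quadraticChar k y = -1 := by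
    intro y
    exact quadraticChar_isQuadratic k y
  have e1 : ∑ x : k, quadraticChar k (f.eval x) =
      (#{x : k | quadraticChar k (f.eval x) = 1} : ℤ) - #{x : k | quadraticChar k (f.eval x) = -1} := by
    rw [Finset.card_filter, Finset.card_filter]
    push_cast
    rw [← Finset.sum_sub_distrib]
    refine Finset.sum_congr rfl fun x _ => ?_
    rcases tri (f.eval x) with h | h | h <;> rw [h] <;> norm_num
  have e2 : (Fintype.card k : ℤ) =
      (#{x : k | quadraticChar k (f.eval x) = 1} : ℤ) + #{x : k | quadraticChar k (f.eval x) = -1}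
       + #{x : k | quadraticChar k (f.eval x) = 0} := by
    rw [Finset.card_filter, Finset.card_filter, Finset.card_filter, ← Finset.card_univ, Finset.card_eq_sum_ones]
    push_cast
    rw [← Finset.sum_add_distrib, ← Finset.sum_add_distrib]
    refine Finset.sum_congr rfl fun x _ => ?_
    rcases tri (f.eval x) with h | h | h <;> rw [h] <;> norm_num
  rw [e1]
  rw [hcard] at e2
  push_cast at e2
  zify at b1 b2 b0
  rw [abs_le]
  constructor <;> nlinarith

/-- the Kloosterman sum -/
noncomputable def Kl (ψ : AddChar k ℂ) (a : k) : ℂ := ∑ x : k, if x = 0 then 0 else ψ (x + a / x)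

lemma two_ne (h2 : ringChar k ≠ 2) : (2 : k) ≠ 0 := Ring.two_ne_zero h2

lemma sum_sq (h2 : ringChar k ≠ 2) (H : k → ℂ) :
    ∑ v, H (v ^ 2) = ∑ w, ((quadraticChar k w : ℂ) + 1) * H w := by
  rw [← Finset.sum_fiberwise (s := univ) (g := fun v : k => v ^ 2)]
  refine Finset.sum_congr rfl fun w _ => ?_
  have hc := quadraticChar_card_sqrts h2 w
  have hc' : ((quadraticChar k w : ℂ) + 1) = (#{x : k | x ^ 2 = w} : ℂ) := by
    have : ({x : k | x ^ 2 = w} : Set k).toFinset = ({x : k | x ^ 2 = w} : Finset k) := by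
      ext; simp
    rw [this] at hc
    exact_mod_cast hc.symm
  rw [hc', ← nsmul_eq_mul, ← Finset.sum_const]
  refine Finset.sum_congr rfl fun v hv => ?_
  rw [(Finset.mem_filter.mp hv).2]

lemma sum_sq_twist (h2 : ringChar k ≠ 2) (η : k) (hη : quadraticChar k η = -1) (H : k → ℂ) :
    ∑ v, H (v ^ 2) + ∑ v, H (η * v ^ 2) = 2 * ∑ w, H w := by
  have hη0 : η ≠ 0 := by rintro rfl; simp at hη
  have e : ∑ w, ((quadraticChar k w : ℂ) + 1) * H (η * w) = ∑ w, (-(quadraticChar k w : ℂ) + 1) * H w := by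
    refine Fintype.sum_equiv (Equiv.mulLeft₀ η hη0) _ _ fun w => ?_
    simp only [Equiv.mulLeft₀_apply, map_mul, hη]
    push_cast; ring
  rw [sum_sq h2 H, sum_sq h2 (fun w => H (η * w)), e, ← Finset.sum_add_distrib, Finset.mul_sum]
  refine Finset.sum_congr rfl fun w _ => ?_
  ring

lemma Kl_eq (h2 : ringChar k ≠ 2) (ψ : AddChar k ℂ) (hψ : ψ ≠ 1) (a : k) (ha : a ≠ 0) :
    Kl ψ a = ∑ s, (quadraticChar k (s ^ 2 - 4 * a) : ℂ) * ψ s := by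
  have t2 := two_ne h2
  have e1 : ∑ s, (quadraticChar k (s ^ 2 - 4 * a) : ℂ) * ψ s =
      ∑ s, ((quadraticChar k (s ^ 2 - 4 * a) : ℂ) + 1) * ψ s := by
    simp only [add_mul, one_mul, Finset.sum_add_distrib]
    rw [AddChar.sum_eq_zero_of_ne_one hψ, add_zero]
  have e0 : Kl ψ a = ∑ x ∈ ({x : k | ¬ x = 0} : Finset k), ψ (x + a / x) := by
    rw [Kl, Finset.sum_filter]
    refine Finset.sum_congr rfl fun x _ => ?_
    by_cases h : x = 0 <;> simp [h]
  rw [e1, e0, ← Finset.sum_fiberwise (s := _) (g := fun x : k => x + a / x)]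
  refine Finset.sum_congr rfl fun s _ => ?_
  have hc := quadraticChar_card_sqrts h2 (s ^ 2 - 4 * a)
  have hc' : ((quadraticChar k (s ^ 2 - 4 * a) : ℂ) + 1) = (#{x : k | x ^ 2 = s ^ 2 - 4 * a} : ℂ) := by
    have : ({x : k | x ^ 2 = s ^ 2 - 4 * a} : Set k).toFinset = ({x : k | x ^ 2 = s ^ 2 - 4 * a} : Finset k) := by
      ext; simp
    rw [this] at hc
    exact_mod_cast hc.symm
  have hcard : #{x : k | x ^ 2 = s ^ 2 - 4 * a} = #{x ∈ ({x : k | ¬ x = 0} : Finset k) | x + a / x = s} := by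
    symm
    refine Finset.card_bij (fun x _ => 2 * x - s) ?_ ?_ ?_
    · intro x hx
      simp only [Finset.mem_filter, Finset.mem_univ, true_and] at hx ⊢
      obtain ⟨hx0, hx⟩ := hx
      field_simp at hx
      linear_combination 4 * hx
    · intro x _ y _ hxy
      have : 2 * (x - y) = 0 := by linear_combination hxy
      rcases mul_eq_zero.mp this with h | h
      · exact absurd h t2
      · exact sub_eq_zero.mp h
    · intro v hv
      simp only [Finset.mem_filter, Finset.mem_univ, true_and] at hv
      have hx0 : (s + v) / 2 ≠ 0 := by
        intro h0
        have hs : s + v = 0 := by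
          rcases div_eq_zero_iff.mp h0 with h | h
          · exact h
          · exact absurd h t2
        have : (2 * 2) * a = 0 := by linear_combination (s - v) * hs + hv
        rcases mul_eq_zero.mp this with h | h
        · exact (mul_ne_zero t2 t2) h
        · exact ha h
      refine ⟨(s + v) / 2, ?_, ?_⟩
      · simp only [Finset.mem_filter, Finset.mem_univ, true_and]
        refine ⟨hx0, ?_⟩
        have hsv : s + v ≠ 0 := by intro h; apply hx0; rw [h]; simp
        field_simp
        linear_combination hv
      · field_simp; ring
  rw [hc', hcard, ← nsmul_eq_mul, ← Finset.sum_const]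
  refine Finset.sum_congr rfl fun x hx => ?_
  rw [(Finset.mem_filter.mp hx).2]

lemma Kl_bound (p s h t : ℕ) [Fact p.Prime] [CharP k p] (h2 : ringChar k ≠ 2) (ht : 0 < t)
    (hM : p ^ s = 2 * h + 1) (hcard : Fintype.card k = (2 * h + 1) ^ 2)
    (hrh : (p ^ t) ^ 2 ≤ h) (ψ : AddChar k ℂ) (hψ : ψ ≠ 1) (hinv : ∀ y, ψ (y ^ (p ^ t)) = ψ y)
    (a : k) (ha : a ≠ 0) : ‖Kl ψ a‖ ≤ 4 * (p : ℝ) ^ t * (2 * h + 1) := by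
  have t2 := two_ne h2
  have hp1 : 1 < p ^ t := Nat.one_lt_pow ht.ne' (Fact.out : p.Prime).one_lt
  set r := p ^ t with hr
  have hrk : (r : k) = 0 := by rw [hr]; push_cast; rw [CharP.cast_eq_zero, zero_pow ht.ne']
  have key : ∀ e : k, |∑ y : k, quadraticChar k ((y ^ r - y + e) ^ 2 - 4 * a)| ≤ 4 * r * (2 * h + 1) := by
    intro e
    set g : k[X] := X ^ r - X + C e with hg
    set f : k[X] := g ^ 2 - C (4 * a) with hf
    have hgd : g.natDegree = r := by
      rw [hg]
      have : (X ^ r - X + C e : k[X]) = X ^ r - (X - C e) := by ring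
      rw [this, natDegree_sub_eq_left_of_natDegree_lt] <;> simp [hp1]
    have hfd : f.natDegree = 2 * r := by
      rw [hf, natDegree_sub_C, natDegree_pow, hgd]
    have hgder : derivative g = -1 := by
      rw [hg, derivative_add, derivative_sub, derivative_X_pow, hrk]; simp
    have hfder : derivative f = - (2 * g) := by
      rw [hf, derivative_sub, derivative_C, sub_zero, sq, derivative_mul, hgder]; ring
    have hsep : f.Separable := by
      refine ⟨- C ((4 * a)⁻¹), - C ((4 * a)⁻¹ / 2) * g, ?_⟩
      rw [hfder, hf]
      have h4a : (4 * a : k) ≠ 0 := by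
        have : (4 : k) = 2 * 2 := by norm_num
        rw [this]; exact mul_ne_zero (mul_ne_zero t2 t2) ha
      have i1 : C ((4 * a)⁻¹) * C (4 * a) = (1 : k[X]) := by
        rw [← C_mul, inv_mul_cancel₀ h4a, C_1]
      have i2 : (C ((4 * a)⁻¹ / 2)) * 2 = (C ((4 * a)⁻¹) : k[X]) := by
        have : (2 : k[X]) = C 2 := rfl
        rw [this, ← C_mul, div_mul_cancel₀ _ t2]
      linear_combination i1 + g ^ 2 * i2
    have := charsum_bound p s h r h2 hM hcard (by omega) hrh f hsep hfd
    simpa [hf, hg] using this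
  have e1 : (Fintype.card k : ℂ) * Kl ψ a =
      ∑ e, ψ e * ((∑ y : k, quadraticChar k ((y ^ r - y + e) ^ 2 - 4 * a) : ℤ) : ℂ) := by
    push_cast
    simp only [Finset.mul_sum]
    rw [Finset.sum_comm]
    have : ∀ y : k, ∑ e, ψ e * (quadraticChar k ((y ^ r - y + e) ^ 2 - 4 * a) : ℂ) = Kl ψ a := by
      intro y
      rw [Kl_eq h2 ψ hψ a ha]
      refine Fintype.sum_equiv (Equiv.addLeft (y ^ r - y)) _ _ fun e => ?_
      simp only [Equiv.coe_addLeft]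
      have : ψ (y ^ r - y + e) = ψ e := by
        rw [AddChar.map_add_eq_mul, AddChar.map_sub_eq_div, hinv, div_self (AddChar.val_isUnit ψ y).ne_zero, one_mul]
      rw [this]; ring
    rw [Finset.sum_congr rfl fun y _ => this y, Finset.sum_const, Finset.card_univ, nsmul_eq_mul]
  have hcpos : (0 : ℝ) < Fintype.card k := by exact_mod_cast Fintype.card_pos
  have e2 : (Fintype.card k : ℝ) * ‖Kl ψ a‖ ≤ Fintype.card k * (4 * (p : ℝ) ^ t * (2 * h + 1)) := by
    have h1 : (Fintype.card k : ℝ) * ‖Kl ψ a‖ = ‖(Fintype.card k : ℂ) * Kl ψ a‖ := by simp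
    rw [h1, e1]
    refine (norm_sum_le _ _).trans ?_
    rw [← nsmul_eq_mul, ← Finset.card_univ, ← Finset.sum_const]
    refine Finset.sum_le_sum fun e _ => ?_
    rw [norm_mul, AddChar.norm_apply, one_mul, Complex.norm_intCast]
    have := key e
    rw [hr] at this
    exact_mod_cast this
  exact le_of_mul_le_mul_left e2 hcpos

end Kloos

namespace Kloos

section
variable {k : Type} [Field k] [Fintype k] [DecidableEq k]

lemma Kl_sq (h2 : ringChar k ≠ 2) (ψ : AddChar k ℂ) (a : k) :
    Kl ψ a ^ 2 = ∑ u : k, ∑ v : k, if u ^ 2 - v ^ 2 = 0 then 0 else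
      ψ (2 * u + a * (2 * u) / (u ^ 2 - v ^ 2)) := by
  have t2 := two_ne h2
  rw [sq, Kl, Finset.sum_mul_sum, ← Fintype.sum_prod_type', ← Fintype.sum_prod_type']
  symm
  refine Fintype.sum_bijective (fun uv : k × k => (uv.1 + uv.2, uv.1 - uv.2)) ?_ _ _ ?_
  · apply (Finite.injective_iff_bijective).mp
    rintro ⟨u, v⟩ ⟨u', v'⟩ h
    simp only [Prod.mk.injEq] at h
    obtain ⟨h1, h3⟩ := h
    have e1 : 2 * (u - u') = 0 := by linear_combination h1 + h3
    have e2 : 2 * (v - v') = 0 := by linear_combination h1 - h3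
    have e1 := sub_eq_zero.mp ((mul_eq_zero.mp e1).resolve_left t2)
    have e2 := sub_eq_zero.mp ((mul_eq_zero.mp e2).resolve_left t2)
    rw [e1, e2]
  · rintro ⟨u, v⟩
    simp only
    have hfac : u ^ 2 - v ^ 2 = (u + v) * (u - v) := by ring
    rw [hfac]
    by_cases h1 : u + v = 0
    · simp [h1]
    by_cases h3 : u - v = 0
    · simp [h3]
    rw [if_neg (mul_ne_zero h1 h3), if_neg h1, if_neg h3, ← AddChar.map_add_eq_mul]
    congr 1
    field_simp
    ring

lemma sum_main (h2 : ringChar k ≠ 2) (ψ : AddChar k ℂ) (hψ : ψ ≠ 1) (a : k) (ha : a ≠ 0) :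
    ∑ u : k, ∑ w : k, (if u ^ 2 - w = 0 then 0 else
      ψ (2 * u + a * (2 * u) / (u ^ 2 - w))) = Fintype.card k := by
  have t2 := two_ne h2
  have e1 : ∀ u : k, ∑ w : k, (if u ^ 2 - w = 0 then 0 else ψ (2 * u + a * (2 * u) / (u ^ 2 - w)))
      = ∑ N : k, if N = 0 then 0 else ψ (u * (2 * (1 + a / N))) := by
    intro u
    refine Fintype.sum_equiv (Equiv.subLeft (u ^ 2)) _ _ fun w => ?_
    simp only [Equiv.subLeft_apply]
    split_ifs with h
    · rfl
    · congr 1; field_simp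
  rw [Finset.sum_congr rfl fun u _ => e1 u, Finset.sum_comm]
  have hprim : ψ.IsPrimitive := AddChar.IsPrimitive.of_ne_one hψ
  rw [Finset.sum_eq_single (-a)]
  · simp [ha]
  · intro N _ hN
    by_cases hN0 : N = 0
    · simp [hN0]
    simp only [hN0, if_false]
    rw [AddChar.sum_mulShift _ hprim, if_neg]
    · simp
    · refine mul_ne_zero t2 ?_
      intro h
      apply hN
      field_simp at h
      linear_combination h
  · simp

end

lemma double {k : Type} [Field k] [Fintype k] [DecidableEq k] (p t : ℕ) [Fact p.Prime] [CharP k p]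
    (hp2 : p ≠ 2) (ψ : AddChar k ℂ) (hψ : ψ ≠ 1) (hinv : ∀ y, ψ (y ^ (p ^ t)) = ψ y) (a : k)
    (ha : a ≠ 0) :
    ∃ (k' : Type) (_ : Field k') (_ : Fintype k') (_ : DecidableEq k') (_ : CharP k' p)
      (ψ' : AddChar k' ℂ) (a' : k'), ψ' ≠ 1 ∧ a' ≠ 0 ∧ (∀ y, ψ' (y ^ (p ^ t)) = ψ' y) ∧
      Fintype.card k' = Fintype.card k ^ 2 ∧ Kl ψ' a' = 2 * Fintype.card k - Kl ψ a ^ 2 := by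
  have h2 : ringChar k ≠ 2 := by rw [ringChar.eq k p]; exact hp2
  have t2 := two_ne h2
  obtain ⟨η, hη⟩ := quadraticChar_exists_neg_one h2
  have hns := quadraticChar_neg_one_iff_not_isSquare.mp hη
  have : Fact (∀ r : k, r ^ 2 ≠ η + 0 * r) := ⟨by
    intro r hr
    exact hns ⟨r, by rw [← sq, hr]; ring⟩⟩
  let K := QuadraticAlgebra k η 0
  letI : Fintype K := Fintype.ofEquiv _ (QuadraticAlgebra.equivProd η 0).symm
  letI : DecidableEq K := Classical.decEq K
  have : CharP K p := charP_of_injective_algebraMap (algebraMap k K).injective p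
  let ψ' : AddChar K ℂ := ψ.compAddMonoidHom (QuadraticAlgebra.trace (R := k) (a := η) (b := 0)).toAddMonoidHom
  have hψ' : ∀ z : K, ψ' z = ψ (2 * z.re) := by
    intro z
    show ψ (QuadraticAlgebra.trace z) = _
    rw [QuadraticAlgebra.trace_def]; simp
  refine ⟨K, inferInstance, inferInstance, inferInstance, inferInstance, ψ', algebraMap k K a, ?_, ?_, ?_, ?_, ?_⟩
  · obtain ⟨x, hx⟩ := (AddChar.ne_one_iff).mp hψ
    rw [AddChar.ne_one_iff]
    refine ⟨algebraMap k K (x / 2), ?_⟩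
    rw [hψ', QuadraticAlgebra.algebraMap_re, mul_div_cancel₀ _ t2]
    exact hx
  · simpa using ha
  · intro z
    have htr : QuadraticAlgebra.trace (z ^ (p ^ t)) = (QuadraticAlgebra.trace z) ^ (p ^ t) := by
      apply (algebraMap k K).injective
      have e1 := QuadraticAlgebra.algebraMap_trace_eq_add_star (z ^ (p ^ t))
      have e2 := QuadraticAlgebra.algebraMap_trace_eq_add_star z
      refine e1.trans ?_
      rw [RingHom.map_pow]
      refine Eq.trans ?_ (congrArg (fun y : K => y ^ (p ^ t)) e2).symm
      have e3 : (z + star z) ^ (p ^ t) = z ^ (p ^ t) + (star z) ^ (p ^ t) := add_pow_char_pow (R := K) z (star z) p t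
      refine Eq.trans ?_ e3.symm
      rw [star_pow]
    show ψ (QuadraticAlgebra.trace (z ^ (p ^ t))) = ψ (QuadraticAlgebra.trace z)
    rw [htr, hinv]
  · rw [Fintype.card_congr (QuadraticAlgebra.equivProd η 0), Fintype.card_prod, sq]
  · have e1 : Kl ψ' (algebraMap k K a) = ∑ u : k, ∑ v : k, if u ^ 2 - η * v ^ 2 = 0 then 0 else
      ψ (2 * u + a * (2 * u) / (u ^ 2 - η * v ^ 2)) := by
      rw [Kl, ← Fintype.sum_prod_type']
      refine Fintype.sum_equiv (QuadraticAlgebra.equivProd η 0) _ _ fun z => ?_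
      have hn : QuadraticAlgebra.norm z = z.re ^ 2 - η * z.im ^ 2 := by
        rw [QuadraticAlgebra.norm_def]; ring
      have hz : z = 0 ↔ z.re ^ 2 - η * z.im ^ 2 = 0 := by
        rw [← hn]; exact QuadraticAlgebra.norm_eq_zero_iff_eq_zero.symm
      have hzz : QuadraticAlgebra.equivProd η 0 z = (z.re, z.im) := rfl
      rw [hzz]
      by_cases h0 : z = 0
      · rw [if_pos h0, if_pos (hz.mp h0)]
      · rw [if_neg h0, if_neg (fun h => h0 (hz.mpr h)), hψ']
        have hinvz : (algebraMap k K a / z).re = a * z.re / (z.re ^ 2 - η * z.im ^ 2) := by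
          have : algebraMap k K a / z = algebraMap k K a * ((QuadraticAlgebra.norm z)⁻¹ • star z) := rfl
          rw [this, hn, QuadraticAlgebra.re_mul]
          have r1 : (algebraMap k K a).re = a := rfl
          have r2 : (algebraMap k K a).im = 0 := rfl
          rw [r1, r2, QuadraticAlgebra.re_smul, QuadraticAlgebra.re_star]
          simp only [smul_eq_mul]
          ring
        rw [QuadraticAlgebra.re_add, hinvz]
        congr 1
        ring
    have e2 : Kl ψ' (algebraMap k K a) + Kl ψ a ^ 2 = 2 * Fintype.card k := by
      rw [e1, Kl_sq h2, ← sum_main h2 ψ hψ a ha, add_comm, ← Finset.sum_add_distrib, Finset.mul_sum]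
      refine Finset.sum_congr rfl fun u _ => ?_
      exact sum_sq_twist h2 η hη (fun w => if u ^ 2 - w = 0 then 0 else
        ψ (2 * u + a * (2 * u) / (u ^ 2 - w)))
    linear_combination e2

/-- The Weil bound for Kloosterman sums -/
theorem weil {k : Type} [Field k] [Fintype k] [DecidableEq k] (h2 : ringChar k ≠ 2)
    (ψ : AddChar k ℂ) (hψ : ψ ≠ 1) (a : k) (ha : a ≠ 0) :
    ‖Kl ψ a‖ ≤ 2 * Real.sqrt (Fintype.card k) := by
  obtain ⟨p, hp⟩ := CharP.exists k
  obtain ⟨⟨t, ht⟩, hpp, hcard⟩ := FiniteField.card k p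
  have : Fact p.Prime := ⟨hpp⟩
  simp only [PNat.mk_coe] at hcard
  have hp2 : p ≠ 2 := by rw [← ringChar.eq k p]; exact h2
  by_contra hlt
  push Not at hlt
  set q := p ^ t with hq
  have hq1 : 1 < q := Nat.one_lt_pow ht.ne' hpp.one_lt
  have hqodd : Odd q := (hpp.odd_of_ne_two hp2).pow
  have hsq : 0 < Real.sqrt (Fintype.card k) := Real.sqrt_pos.mpr (by exact_mod_cast Fintype.card_pos)
  obtain ⟨ε, hε, hK⟩ : ∃ ε : ℝ, 0 < ε ∧ (2 + ε) * Real.sqrt (Fintype.card k) ≤ ‖Kl ψ a‖ := by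
    refine ⟨‖Kl ψ a‖ / Real.sqrt (Fintype.card k) - 2, ?_, ?_⟩
    · rw [sub_pos, lt_div_iff₀ hsq]; exact hlt
    · have : (2 + (‖Kl ψ a‖ / Real.sqrt (Fintype.card k) - 2)) * Real.sqrt (Fintype.card k) = ‖Kl ψ a‖ := by
        field_simp; ring
      exact this.le
  have tower : ∀ n : ℕ, ∃ (k' : Type) (_ : Field k') (_ : Fintype k') (_ : DecidableEq k') (_ : CharP k' p)
      (ψ' : AddChar k' ℂ) (a' : k'), ψ' ≠ 1 ∧ a' ≠ 0 ∧ (∀ y, ψ' (y ^ (p ^ t)) = ψ' y) ∧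
      Fintype.card k' = q ^ (2 ^ n) ∧
      (2 + 4 ^ n * ε) * Real.sqrt (Fintype.card k') ≤ ‖Kl ψ' a'‖ := by
    intro n
    induction n with
    | zero =>
      refine ⟨k, inferInstance, inferInstance, inferInstance, hp, ψ, a, hψ, ha, ?_, ?_, ?_⟩
      · intro y
        rw [← hq, ← hcard, FiniteField.pow_card]
      · simpa using hcard
      · simpa using hK
    | succ n ih =>
      obtain ⟨k', _, _, _, _, ψ', a', h1, h3, h4, h5, h6⟩ := ih
      obtain ⟨K, i1, i2, i3, i4, φ, b, g1, g2, g3, g4, g5⟩ := double p t hp2 ψ' h1 h4 a' h3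
      refine ⟨K, i1, i2, i3, i4, φ, b, g1, g2, g3, ?_, ?_⟩
      · rw [g4, h5, ← pow_mul, pow_succ]
      · rw [g5, g4]
        push_cast
        set c : ℝ := ((Fintype.card k' : ℕ) : ℝ) with hc
        have hc0 : 0 ≤ c := by positivity
        rw [Real.sqrt_sq hc0]
        have hs : Real.sqrt c ^ 2 = c := Real.sq_sqrt hc0
        have n1 : ‖Kl ψ' a'‖ ^ 2 - 2 * c ≤ ‖(2 * (Fintype.card k' : ℂ) - Kl ψ' a' ^ 2)‖ := by
          have := norm_sub_norm_le (Kl ψ' a' ^ 2) (2 * (Fintype.card k' : ℂ))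
          rw [norm_sub_rev] at this
          refine le_trans (le_of_eq ?_) this
          rw [norm_pow, norm_mul]
          simp [hc]
        refine le_trans ?_ n1
        have n2 : ((2 + 4 ^ n * ε) * Real.sqrt c) ^ 2 ≤ ‖Kl ψ' a'‖ ^ 2 := by
          apply pow_le_pow_left₀ _ h6
          positivity
        rw [mul_pow, hs] at n2
        have : 0 ≤ (4 ^ n * ε) ^ 2 * c := by positivity
        rw [pow_succ]
        nlinarith
  obtain ⟨n, hn⟩ : ∃ n : ℕ, 4 * (q : ℝ) < 4 ^ n * ε := by
    obtain ⟨n, hn⟩ := pow_unbounded_of_one_lt (4 * (q : ℝ) / ε) (by norm_num : (1 : ℝ) < 4)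
    exact ⟨n, by rwa [div_lt_iff₀ hε] at hn⟩
  obtain ⟨k', _, _, _, _, ψ', a', h1, h3, h4, h5, h6⟩ := tower (n + 3)
  have hodd : Odd (q ^ (2 ^ (n + 2))) := hqodd.pow
  obtain ⟨h, hh⟩ := hodd
  have hcard' : Fintype.card k' = (2 * h + 1) ^ 2 := by
    rw [h5, ← hh, ← pow_mul q (2 ^ (n + 2)) 2, ← pow_succ]
  have hh4 : q ^ 2 ≤ h := by
    have : q ^ 4 ≤ q ^ (2 ^ (n + 2)) := by
      apply Nat.pow_le_pow_right (by omega)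
      calc 4 = 2 ^ 2 := by norm_num
        _ ≤ 2 ^ (n + 2) := Nat.pow_le_pow_right (by norm_num) (by omega)
    have h3q : 3 ≤ q := by
      obtain ⟨m, hm⟩ := hqodd
      omega
    rw [hh] at this
    have h9 : 9 ≤ q ^ 2 := by nlinarith
    nlinarith
  have hb := Kl_bound p (t * 2 ^ (n + 2)) h t
    (by rw [ringChar.eq k' p]; exact hp2) ht (by rw [← hh, pow_mul]) hcard' hh4 ψ' h1 h4 a' h3
  have hs' : Real.sqrt (Fintype.card k') = 2 * h + 1 := by
    rw [hcard']; push_cast; exact Real.sqrt_sq (by positivity)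
  rw [hs'] at h6
  have hq' : (q : ℝ) = (p : ℝ) ^ t := by rw [hq]; push_cast; rfl
  rw [hq'] at hn
  have hpos : (0 : ℝ) < 2 * h + 1 := by positivity
  have h7 := le_of_mul_le_mul_right (h6.trans hb) hpos
  have h8 : (4 : ℝ) ^ n * ε ≤ 4 ^ (n + 3) * ε := by
    apply mul_le_mul_of_nonneg_right _ hε.le
    exact pow_le_pow_right₀ (by norm_num) (by omega)
  linarith

end Kloos

namespace Kloos

section
variable {k : Type} [Field k] [Fintype k] [DecidableEq k]

/-- complex valued quadratic character -/
noncomputable def chi (x : k) : ℂ := (quadraticChar k x : ℂ)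

lemma chi_mul (x y : k) : chi (x * y) = chi x * chi y := by rw [chi, map_mul]; push_cast; rfl

lemma chi_zero : chi (0 : k) = 0 := by simp [chi]

lemma chi_sq {x : k} (hx : x ≠ 0) : chi x * chi x = 1 := by
  have := quadraticChar_sq_one hx
  rw [sq] at this
  rw [chi]
  exact_mod_cast this

lemma chi_norm {x : k} (hx : x ≠ 0) : ‖chi x‖ = 1 := by
  have h := congrArg norm (chi_sq hx)
  rw [norm_mul, norm_one] at h
  nlinarith [norm_nonneg (chi x)]

/-- quadratic Gauss sum -/
noncomputable def gs (ψ : AddChar k ℂ) : ℂ := ∑ w : k, chi w * ψ w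

lemma chi_sum (h2 : ringChar k ≠ 2) : ∑ w : k, chi w = 0 := by
  have := quadraticChar_sum_zero h2
  simp only [chi]
  exact_mod_cast this

lemma gs_twist (h2 : ringChar k ≠ 2) (ψ : AddChar k ℂ) (b : k) :
    ∑ w : k, chi w * ψ (b * w) = chi b * gs ψ := by
  by_cases hb : b = 0
  · simp [hb, chi_zero, chi_sum h2]
  · rw [gs, Finset.mul_sum]
    refine Fintype.sum_equiv (Equiv.mulLeft₀ b hb) _ _ fun w => ?_
    simp only [Equiv.mulLeft₀_apply]
    rw [chi_mul, ← mul_assoc, ← mul_assoc, chi_sq hb, one_mul]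

lemma gauss_one (h2 : ringChar k ≠ 2) (ψ : AddChar k ℂ) (hψ : ψ ≠ 1) (b : k) (hb : b ≠ 0) :
    ∑ x : k, ψ (b * x ^ 2) = chi b * gs ψ := by
  rw [sum_sq h2 (fun w => ψ (b * w)), ← gs_twist h2]
  simp only [add_mul, one_mul, Finset.sum_add_distrib]
  have : ∑ w : k, ψ (b * w) = 0 := by
    have := AddChar.sum_mulShift b (AddChar.IsPrimitive.of_ne_one hψ)
    simpa [hb, mul_comm] using this
  rw [this, add_zero]
  rfl

lemma gs_norm (h2 : ringChar k ≠ 2) (ψ : AddChar k ℂ) (hψ : ψ ≠ 1) :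
    ‖gs ψ‖ = Real.sqrt (Fintype.card k) := by
  have e : gs ψ = gaussSum ((quadraticChar k).ringHomComp (Int.castRingHom ℂ)) ψ := by
    simp [gs, gaussSum, chi]
  have hq : MulChar.IsQuadratic ((quadraticChar k).ringHomComp (Int.castRingHom ℂ)) :=
    (quadraticChar_isQuadratic k).comp _
  have hne : ((quadraticChar k).ringHomComp (Int.castRingHom ℂ)) ≠ 1 :=
    (MulChar.ringHomComp_ne_one_iff (Int.cast_injective (α := ℂ))).mpr (quadraticChar_ne_one h2)
  have h := gaussSum_sq hne hq (AddChar.IsPrimitive.of_ne_one hψ)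
  rw [← e] at h
  have h' := congrArg norm h
  have hc : ‖((quadraticChar k).ringHomComp (Int.castRingHom ℂ)) (-1)‖ = 1 := by
    have := chi_norm (k := k) (x := -1) (by simp)
    simpa [chi] using this
  rw [norm_pow, norm_mul, hc, one_mul, Complex.norm_natCast] at h'
  rw [← h', Real.sqrt_sq (norm_nonneg _)]

/-- Salie sum -/
noncomputable def Sal (ψ : AddChar k ℂ) (a : k) : ℂ := ∑ s : k, chi s * ψ (s + a / s)

lemma Sal_bound (h2 : ringChar k ≠ 2) (ψ : AddChar k ℂ) (hψ : ψ ≠ 1) (a : k) (ha : a ≠ 0) :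
    ‖Sal ψ a‖ ≤ 2 * Real.sqrt (Fintype.card k) := by
  have t2 := two_ne h2
  have hprim := AddChar.IsPrimitive.of_ne_one hψ
  by_cases hs : IsSquare a
  · obtain ⟨b, rfl⟩ := hs
    have hb : b ≠ 0 := by rintro rfl; simp at ha
    have key : chi (-1 : k) * gs ψ * Sal ψ (b * b) =
        Fintype.card k * (ψ (2 * b) + ψ (-(2 * b))) := by
      have e1 : ∀ s : k, chi (-1 : k) * gs ψ * (chi s * ψ (s + b * b / s)) =
          (∑ x : k, ψ (-(2 * b * x)) * ψ (s * (1 - x ^ 2)))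
            - if s = 0 then ∑ x : k, ψ (-(2 * b * x)) else 0 := by
        intro s
        by_cases h0 : s = 0
        · simp [h0, chi_zero]
        · rw [if_neg h0, sub_zero]
          have := gauss_one h2 ψ hψ (-1 * s) (mul_ne_zero (by simp) h0)
          rw [chi_mul] at this
          calc chi (-1 : k) * gs ψ * (chi s * ψ (s + b * b / s))
              = (chi (-1 : k) * chi s * gs ψ) * ψ (s + b * b / s) := by ring
            _ = _ := by
              rw [← this, Finset.sum_mul]
              symm
              refine Fintype.sum_equiv (Equiv.addRight (b / s)) _ _ fun x => ?_
              simp only [Equiv.coe_addRight]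
              rw [← AddChar.map_add_eq_mul, ← AddChar.map_add_eq_mul]
              congr 1
              field_simp
              ring
      have z : ∑ x : k, ψ (-(2 * b * x)) = 0 := by
        have := AddChar.sum_mulShift (-(2 * b)) hprim
        rw [if_neg (by simp [t2, hb])] at this
        refine Eq.trans ?_ (this.trans Nat.cast_zero)
        exact Finset.sum_congr rfl fun x _ => by congr 1; ring
      rw [Sal, Finset.mul_sum, Finset.sum_congr rfl fun s _ => e1 s, z]
      simp only [ite_self, sub_zero]
      rw [Finset.sum_comm]
      simp only [← Finset.mul_sum]
      have e3 : ∀ x : k, ∑ s : k, ψ (s * (1 - x ^ 2)) =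
          (if x = 1 then (Fintype.card k : ℂ) else 0) + if x = -1 then (Fintype.card k : ℂ) else 0 := by
        intro x
        rw [AddChar.sum_mulShift _ hprim]
        have hne : (1 : k) ≠ -1 := by
          intro h
          apply t2
          linear_combination h
        by_cases h1 : x = 1
        · subst h1
          simp [hne]
        by_cases h3 : x = -1
        · subst h3
          simp [hne.symm]
        rw [if_neg h1, if_neg h3, if_neg]
        · simp
        · intro h
          have : (x - 1) * (x + 1) = 0 := by linear_combination -h
          rcases mul_eq_zero.mp this with h | h
          · exact h1 (by linear_combination h)
          · exact h3 (by linear_combination h)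
      rw [Finset.sum_congr rfl fun x _ => by rw [e3 x]]
      simp only [mul_add, Finset.sum_add_distrib, mul_ite, mul_zero, Finset.sum_ite_eq', Finset.mem_univ, if_true]
      simp only [mul_one, mul_neg, neg_neg]
      ring
    have hn := congrArg norm key
    rw [norm_mul, norm_mul, norm_mul, chi_norm (by simp), one_mul, gs_norm h2 ψ hψ,
      Complex.norm_natCast] at hn
    have h3 : ‖ψ (2 * b) + ψ (-(2 * b))‖ ≤ 2 := by
      refine (norm_add_le _ _).trans ?_
      rw [AddChar.norm_apply, AddChar.norm_apply]; norm_num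
    have hpos : 0 < Real.sqrt (Fintype.card k) :=
      Real.sqrt_pos.mpr (by exact_mod_cast Fintype.card_pos)
    have hsq : Real.sqrt (Fintype.card k) * Real.sqrt (Fintype.card k) = Fintype.card k :=
      Real.mul_self_sqrt (by positivity)
    refine le_of_mul_le_mul_left ?_ hpos
    rw [hn]
    calc (Fintype.card k : ℝ) * ‖ψ (2 * b) + ψ (-(2 * b))‖ ≤ Fintype.card k * 2 := by gcongr
      _ = _ := by linear_combination -2 * hsq
  · have hm : chi a = -1 := by
      rw [chi, quadraticChar_neg_one_iff_not_isSquare.mpr hs]; simp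
    have : Sal ψ a = - Sal ψ a := by
      conv_rhs => rw [Sal]
      rw [Sal, ← Finset.sum_neg_distrib]
      have hbij : Function.Bijective (fun s : k => a / s) := by
        apply Function.Involutive.bijective
        intro s
        simp only
        field_simp
      refine Fintype.sum_bijective _ hbij _ _ fun s => ?_
      by_cases h0 : s = 0
      · simp [h0, chi_zero]
      have e1 : chi (a / s) = - chi s := by
        have : chi (a / s) * chi s = -1 := by rw [← chi_mul, div_mul_cancel₀ _ h0, hm]
        linear_combination chi s * this - chi (a / s) * chi_sq h0
      rw [e1]
      have : a / s + a / (a / s) = s + a / s := by field_simp; ring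
      rw [this]; ring
    have : Sal ψ a = 0 := by linear_combination (1 / 2 : ℂ) * this
    rw [this, norm_zero]; positivity

/-- twisted Kloosterman sum -/
noncomputable def tw (ψ : AddChar k ℂ) (d : ℕ) (t m : k) : ℂ :=
  ∑ s : k, if s = 0 then 0 else chi s ^ d * ψ (-(s * t) - m / s)

lemma tw_eq (ψ : AddChar k ℂ) (d : ℕ) (t m : k) (ht : t ≠ 0) :
    tw ψ d t m = chi (-t⁻¹) ^ d * ∑ s : k, if s = 0 then 0 else chi s ^ d * ψ (s + t * m / s) := by
  rw [tw, Finset.mul_sum]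
  symm
  have hn : -t⁻¹ ≠ 0 := by simpa using ht
  refine Fintype.sum_equiv (Equiv.mulLeft₀ (-t⁻¹) hn) _ _ fun s => ?_
  simp only [Equiv.mulLeft₀_apply]
  by_cases h0 : s = 0
  · simp [h0]
  rw [if_neg h0, if_neg (mul_ne_zero hn h0), chi_mul, mul_pow, mul_assoc]
  congr 3
  field_simp
  ring

lemma chi_pow {s : k} (h0 : s ≠ 0) (d : ℕ) : chi s ^ d = if Even d then 1 else chi s := by
  split_ifs with h
  · obtain ⟨m, rfl⟩ := h
    rw [pow_add, ← mul_pow, chi_sq h0, one_pow]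
  · obtain ⟨m, rfl⟩ := Nat.not_even_iff_odd.mp h
    rw [pow_succ, two_mul, pow_add, ← mul_pow, chi_sq h0, one_pow, one_mul]

lemma tw_norm (ψ : AddChar k ℂ) (d : ℕ) (t m : k) (ht : t ≠ 0) :
    ‖tw ψ d t m‖ = if Even d then ‖Kl ψ (t * m)‖ else ‖Sal ψ (t * m)‖ := by
  have hn : -t⁻¹ ≠ 0 := by simpa using ht
  rw [tw_eq _ _ _ _ ht, norm_mul, norm_pow, chi_norm hn, one_pow, one_mul]
  split_ifs with h
  · rw [Kl]; congr 1
    refine Finset.sum_congr rfl fun s _ => ?_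
    by_cases h0 : s = 0
    · simp [h0]
    · rw [if_neg h0, if_neg h0, chi_pow h0, if_pos h, one_mul]
  · rw [Sal]; congr 1
    refine Finset.sum_congr rfl fun s _ => ?_
    by_cases h0 : s = 0
    · simp [h0, chi_zero]
    · rw [if_neg h0, chi_pow h0, if_neg h]

lemma one_le_sqrt_card : 1 ≤ Real.sqrt (Fintype.card k) := by
  rw [Real.one_le_sqrt]; exact_mod_cast Fintype.card_pos

lemma tw_bound_zero (h2 : ringChar k ≠ 2) (ψ : AddChar k ℂ) (hψ : ψ ≠ 1) (d : ℕ) (t : k)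
    (ht : t ≠ 0) : ‖tw ψ d t 0‖ ≤ Real.sqrt (Fintype.card k) := by
  rw [tw_norm _ _ _ _ ht, mul_zero]
  split_ifs with h
  · have : Kl ψ 0 = -1 := by
      have e : ∑ x : k, ψ x = 0 := AddChar.sum_eq_zero_of_ne_one hψ
      have : Kl ψ 0 = ∑ x : k, (ψ x - if x = 0 then 1 else 0) := by
        rw [Kl]
        refine Finset.sum_congr rfl fun s _ => ?_
        by_cases h0 : s = 0 <;> simp [h0]
      rw [this, Finset.sum_sub_distrib, e]; simp
    rw [this, norm_neg, norm_one]; exact one_le_sqrt_card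
  · have : Sal ψ 0 = gs ψ := by simp [Sal, gs]
    rw [this, gs_norm h2 ψ hψ]

lemma tw_bound (h2 : ringChar k ≠ 2) (ψ : AddChar k ℂ) (hψ : ψ ≠ 1) (d : ℕ) (t m : k)
    (ht : t ≠ 0) : ‖tw ψ d t m‖ ≤ 2 * Real.sqrt (Fintype.card k) := by
  by_cases hm : m = 0
  · rw [hm]
    refine (tw_bound_zero h2 ψ hψ d t ht).trans ?_
    linarith [Real.sqrt_nonneg (Fintype.card k)]
  rw [tw_norm _ _ _ _ ht]
  split_ifs with h
  · exact weil h2 ψ hψ _ (mul_ne_zero ht hm)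
  · exact Sal_bound h2 ψ hψ _ (mul_ne_zero ht hm)

end
end Kloos

namespace Kloos

section conv
variable {V : Type} [AddCommGroup V] [Fintype V] [DecidableEq V]

lemma parseval (e : V → AddChar V ℂ)
    (he : ∀ x, ∑ c, e c x = if x = 0 then (Fintype.card V : ℂ) else 0) (h : V → ℂ) :
    ∑ c, ‖∑ x, h x * e c x‖ ^ 2 = Fintype.card V * ∑ x, ‖h x‖ ^ 2 := by
  have key : ∑ c, (∑ x, h x * e c x) * (starRingEnd ℂ) (∑ x, h x * e c x) =
      Fintype.card V * ∑ x, h x * (starRingEnd ℂ) (h x) := by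
    have e1 : ∀ c, (∑ x, h x * e c x) * (starRingEnd ℂ) (∑ x, h x * e c x) =
        ∑ x, ∑ y, (h x * (starRingEnd ℂ) (h y)) * e c (x - y) := by
      intro c
      rw [map_sum, Finset.sum_mul_sum]
      refine Finset.sum_congr rfl fun x _ => Finset.sum_congr rfl fun y _ => ?_
      rw [map_mul, sub_eq_add_neg, AddChar.map_add_eq_mul, AddChar.map_neg_eq_conj]
      ring
    rw [Finset.sum_congr rfl fun c _ => e1 c, Finset.sum_comm, Finset.mul_sum]
    refine Finset.sum_congr rfl fun x _ => ?_
    rw [Finset.sum_comm]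
    simp only [← Finset.mul_sum, he, sub_eq_zero]
    simp
    ring
  simp only [Complex.mul_conj, Complex.normSq_eq_norm_sq] at key
  exact_mod_cast key

lemma conv_bound (e : V → AddChar V ℂ)
    (he : ∀ x, ∑ c, e c x = if x = 0 then (Fintype.card V : ℂ) else 0) (b : V → ℝ) (κ : ℝ)
    (hb : ∀ c, ‖∑ x, (b x : ℂ) * e c x‖ ≤ κ) (v : V → ℝ) :
    ∑ x, (∑ z, b (x - z) * v z) ^ 2 ≤ κ ^ 2 * ∑ z, v z ^ 2 := by
  have hκ : 0 ≤ κ := (norm_nonneg _).trans (hb 0)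
  have p1 := parseval e he (fun x => ((∑ z, b (x - z) * v z : ℝ) : ℂ))
  have p2 := parseval e he (fun x => (v x : ℂ))
  have hc : ∀ c, ∑ x, ((∑ z, b (x - z) * v z : ℝ) : ℂ) * e c x =
      (∑ x, (b x : ℂ) * e c x) * ∑ x, (v x : ℂ) * e c x := by
    intro c
    rw [Finset.mul_sum]
    push_cast
    simp only [Finset.sum_mul]
    rw [Finset.sum_comm]
    refine Finset.sum_congr rfl fun z _ => ?_
    refine Fintype.sum_equiv (Equiv.subRight z) _ _ fun x => ?_
    simp only [Equiv.subRight_apply]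
    have : e c x = e c (x - z) * e c z := by rw [← AddChar.map_add_eq_mul, sub_add_cancel]
    rw [this]; ring
  have hN : (0 : ℝ) < Fintype.card V := by exact_mod_cast Fintype.card_pos
  simp only [hc, Complex.norm_real, Real.norm_eq_abs, sq_abs] at p1 p2
  refine le_of_mul_le_mul_left ?_ hN
  rw [← p1, mul_left_comm, ← p2, Finset.mul_sum]
  refine Finset.sum_le_sum fun c _ => ?_
  rw [norm_mul, mul_pow]
  gcongr
  exact hb c

lemma cs {ι : Type} [Fintype ι] (u v : ι → ℝ) :
    |∑ i, u i * v i| ≤ Real.sqrt (∑ i, u i ^ 2) * Real.sqrt (∑ i, v i ^ 2) := by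
  rw [← Real.sqrt_mul (Finset.sum_nonneg fun i _ => sq_nonneg _)]
  exact Real.abs_le_sqrt (Finset.sum_mul_sq_le_sq_mul_sq _ _ _)

/-- abstract assembly -/
lemma assembly (b : V → ℝ) (κ μ : ℝ) (hκ : 0 ≤ κ) (hμ : 0 ≤ μ)
    (hB : ∀ v : V → ℝ, ∑ x, (∑ z, b (x - z) * v z) ^ 2 ≤ κ ^ 2 * ∑ z, v z ^ 2)
    (f g : V × V → ℝ) :
    |(∑ x, ∑ y, ∑ z, ∑ w, (μ + b (x - z)) * (μ + b (w - y)) * (f (x, y) * g (z, w))) -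
        μ ^ 2 * (∑ x, ∑ y, f (x, y)) * (∑ z, ∑ w, g (z, w))| ≤
      κ ^ 2 * Real.sqrt (∑ x, ∑ y, f (x, y) ^ 2) * Real.sqrt (∑ z, ∑ w, g (z, w) ^ 2) +
      μ * κ * (Real.sqrt (∑ x, (∑ y, f (x, y)) ^ 2) *
              Real.sqrt (∑ z, (∑ w, g (z, w)) ^ 2) +
            Real.sqrt (∑ y, (∑ x, f (x, y)) ^ 2) *
              Real.sqrt (∑ w, (∑ z, g (z, w)) ^ 2)) := by
  have hB' : ∀ v : V → ℝ, Real.sqrt (∑ x, (∑ z, b (x - z) * v z) ^ 2) ≤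
      κ * Real.sqrt (∑ z, v z ^ 2) := by
    intro v
    refine (Real.sqrt_le_sqrt (hB v)).trans ?_
    rw [Real.sqrt_mul (sq_nonneg _), Real.sqrt_sq hκ]
  have bil : ∀ u v : V → ℝ, |∑ x, u x * ∑ z, b (x - z) * v z| ≤
      κ * (Real.sqrt (∑ x, u x ^ 2) * Real.sqrt (∑ z, v z ^ 2)) := by
    intro u v
    refine (cs _ _).trans ?_
    rw [mul_left_comm]
    exact mul_le_mul_of_nonneg_left (hB' v) (Real.sqrt_nonneg _)
  set T1 := ∑ x, (∑ y, f (x, y)) * ∑ z, b (x - z) * ∑ w, g (z, w) with hT1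
  set T2 := ∑ w, (∑ z, g (z, w)) * ∑ y, b (w - y) * ∑ x, f (x, y) with hT2
  set T3 := ∑ p : V × V, (∑ z, b (p.1 - z) * g (z, p.2)) * ∑ y, b (p.2 - y) * f (p.1, y) with hT3
  have e0 : (∑ x, ∑ y, ∑ z, ∑ w, (μ + b (x - z)) * (μ + b (w - y)) * (f (x, y) * g (z, w))) =
      (∑ x, ∑ y, ∑ z, ∑ w, μ ^ 2 * (f (x, y) * g (z, w))) +
      (∑ x, ∑ y, ∑ z, ∑ w, μ * (b (x - z) * (f (x, y) * g (z, w)))) +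
      (∑ x, ∑ y, ∑ z, ∑ w, μ * (b (w - y) * (f (x, y) * g (z, w)))) +
      (∑ x, ∑ y, ∑ z, ∑ w, b (x - z) * (b (w - y) * (f (x, y) * g (z, w)))) := by
    simp only [← Finset.sum_add_distrib]
    refine Finset.sum_congr rfl fun x _ => Finset.sum_congr rfl fun y _ =>
      Finset.sum_congr rfl fun z _ => Finset.sum_congr rfl fun w _ => ?_
    ring
  have e1 : (∑ x, ∑ y, ∑ z, ∑ w, μ ^ 2 * (f (x, y) * g (z, w))) =
      μ ^ 2 * (∑ x, ∑ y, f (x, y)) * (∑ z, ∑ w, g (z, w)) := by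
    simp only [← Finset.mul_sum, ← Finset.sum_mul]; ring
  have e2 : (∑ x, ∑ y, ∑ z, ∑ w, μ * (b (x - z) * (f (x, y) * g (z, w)))) = μ * T1 := by
    simp only [← Finset.mul_sum]
    rw [hT1]; congr 1
    refine Finset.sum_congr rfl fun x _ => ?_
    rw [Finset.sum_mul]
    refine Finset.sum_congr rfl fun y _ => ?_
    rw [Finset.mul_sum]
    refine Finset.sum_congr rfl fun z _ => ?_
    ring
  have e3 : (∑ x, ∑ y, ∑ z, ∑ w, μ * (b (w - y) * (f (x, y) * g (z, w)))) = μ * T2 := by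
    simp only [← Finset.mul_sum]
    rw [hT2]; congr 1
    simp only [Finset.mul_sum, Finset.sum_mul]
    rw [Finset.sum_comm]
    calc _ = ∑ y, ∑ x, ∑ w, ∑ z, b (w - y) * (f (x, y) * g (z, w)) :=
          Finset.sum_congr rfl fun y _ => Finset.sum_congr rfl fun x _ => Finset.sum_comm
      _ = ∑ y, ∑ w, ∑ x, ∑ z, b (w - y) * (f (x, y) * g (z, w)) :=
          Finset.sum_congr rfl fun y _ => Finset.sum_comm
      _ = ∑ w, ∑ y, ∑ x, ∑ z, b (w - y) * (f (x, y) * g (z, w)) := Finset.sum_comm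
      _ = _ := by
        refine Finset.sum_congr rfl fun w _ => Finset.sum_congr rfl fun y _ =>
          Finset.sum_congr rfl fun x _ => Finset.sum_congr rfl fun z _ => ?_
        ring
  have e4 : (∑ x, ∑ y, ∑ z, ∑ w, b (x - z) * (b (w - y) * (f (x, y) * g (z, w)))) = T3 := by
    rw [hT3, Fintype.sum_prod_type]
    refine Finset.sum_congr rfl fun x _ => ?_
    simp only [Finset.sum_mul_sum]
    calc _ = ∑ y, ∑ w, ∑ z, b (x - z) * (b (w - y) * (f (x, y) * g (z, w))) :=
          Finset.sum_congr rfl fun y _ => Finset.sum_comm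
      _ = ∑ w, ∑ y, ∑ z, b (x - z) * (b (w - y) * (f (x, y) * g (z, w))) := Finset.sum_comm
      _ = ∑ w, ∑ z, ∑ y, b (x - z) * (b (w - y) * (f (x, y) * g (z, w))) :=
          Finset.sum_congr rfl fun y _ => Finset.sum_comm
      _ = _ := by
        refine Finset.sum_congr rfl fun w _ => Finset.sum_congr rfl fun z _ =>
          Finset.sum_congr rfl fun y _ => ?_
        ring
  have b1 : |T1| ≤ _ := bil _ _
  have b2 : |T2| ≤ _ := bil _ _
  have b3 : |T3| ≤ κ ^ 2 * Real.sqrt (∑ x, ∑ y, f (x, y) ^ 2) *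
      Real.sqrt (∑ z, ∑ w, g (z, w) ^ 2) := by
    refine (cs _ _).trans ?_
    have s1 : Real.sqrt (∑ p : V × V, (∑ z, b (p.1 - z) * g (z, p.2)) ^ 2) ≤
        κ * Real.sqrt (∑ z, ∑ w, g (z, w) ^ 2) := by
      rw [← Real.sqrt_sq hκ, ← Real.sqrt_mul (sq_nonneg _)]
      apply Real.sqrt_le_sqrt
      rw [Fintype.sum_prod_type_right, Finset.sum_comm (s := univ) (t := univ) (f := fun z w => g (z, w) ^ 2),
        Finset.mul_sum]
      exact Finset.sum_le_sum fun w _ => hB (fun z => g (z, w))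
    have s2 : Real.sqrt (∑ p : V × V, (∑ y, b (p.2 - y) * f (p.1, y)) ^ 2) ≤
        κ * Real.sqrt (∑ x, ∑ y, f (x, y) ^ 2) := by
      rw [← Real.sqrt_sq hκ, ← Real.sqrt_mul (sq_nonneg _)]
      apply Real.sqrt_le_sqrt
      rw [Fintype.sum_prod_type, Finset.mul_sum]
      exact Finset.sum_le_sum fun w _ => hB (fun y => f (w, y))
    refine (mul_le_mul s1 s2 (Real.sqrt_nonneg _) (by positivity)).trans (le_of_eq ?_)
    ring
  rw [e0, e1, e2, e3, e4]
  have : μ ^ 2 * (∑ x, ∑ y, f (x, y)) * (∑ z, ∑ w, g (z, w)) + μ * T1 + μ * T2 + T3 -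
      μ ^ 2 * (∑ x, ∑ y, f (x, y)) * (∑ z, ∑ w, g (z, w)) = T3 + μ * T1 + μ * T2 := by ring
  rw [this]
  refine (abs_add_three _ _ _).trans ?_
  rw [abs_mul, abs_mul, abs_of_nonneg hμ]
  have := mul_le_mul_of_nonneg_left b1 hμ
  have := mul_le_mul_of_nonneg_left b2 hμ
  nlinarith

end conv

section quad
variable {k : Type} [Field k] [Fintype k] [DecidableEq k]

lemma addchar_sum {ι : Type} (s : Finset ι) (ψ : AddChar k ℂ) (u : ι → k) :
    ψ (∑ i ∈ s, u i) = ∏ i ∈ s, ψ (u i) := by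
  classical
  induction s using Finset.induction_on with
  | empty => simp
  | insert i s hi ih => rw [Finset.sum_insert hi, Finset.prod_insert hi, AddChar.map_add_eq_mul, ih]

lemma quad_gauss (h2 : ringChar k ≠ 2) (ψ : AddChar k ℂ) (hψ : ψ ≠ 1) {d : ℕ}
    (Q : QuadraticForm k (Fin d → k))
    (hQ : ∀ x, (∀ y, QuadraticMap.polar (⇑Q) x y = 0) → x = 0) :
    ∃ A : ℂ, ‖A‖ = Real.sqrt (Fintype.card k) ^ d ∧
      ∀ s : k, s ≠ 0 → ∑ x, ψ (s * Q x) = chi s ^ d * A := by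
  have t2 := two_ne h2
  letI : Invertible (2 : k) := invertibleOfNonzero t2
  have hsep : (QuadraticMap.associated (R := k) Q).SeparatingLeft := by
    intro x hx
    apply hQ
    intro y
    have h := hx y
    have h3 := QuadraticMap.two_nsmul_associated k Q
    have h4 := congrArg (fun B => B x y) h3
    simp only [QuadraticMap.polarBilin_apply_apply] at h4
    rw [← h4]
    show (2 • (QuadraticMap.associated (R := k) Q) x y) = 0
    rw [h, smul_zero]
  obtain ⟨w, ⟨e⟩⟩ := QuadraticForm.equivalent_weightedSumSquares_units_of_nondegenerate' Q hsep
  have hfr : Module.finrank k (Fin d → k) = d := by simp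
  refine ⟨∏ i, (chi (w i : k) * gs ψ), ?_, ?_⟩
  · rw [norm_prod]
    have : ∀ i, ‖chi (w i : k) * gs ψ‖ = Real.sqrt (Fintype.card k) := fun i => by
      rw [norm_mul, gs_norm h2 ψ hψ, chi_norm (Units.ne_zero (w i)), one_mul]
    rw [Finset.prod_congr rfl fun i _ => this i]; simp
  · intro s hs
    have e1 : ∑ x, ψ (s * Q x) = ∑ v : Fin (Module.finrank k (Fin d → k)) → k,
        ∏ i, ψ (s * w i * (v i) ^ 2) := by
      refine Fintype.sum_equiv e.toLinearEquiv.toEquiv _ _ fun x => ?_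
      have h := e.map_app x
      rw [QuadraticMap.weightedSumSquares_apply] at h
      rw [← h, ← addchar_sum, Finset.mul_sum]
      congr 1
      refine Finset.sum_congr rfl fun i _ => ?_
      rw [Units.smul_def, smul_eq_mul, sq, mul_assoc]
      rfl
    rw [e1, ← Fintype.piFinset_univ,
      ← Finset.prod_univ_sum (fun _ => univ) (fun i y => ψ (s * (w i : k) * y ^ 2))]
    have : ∀ i, ∑ y : k, ψ (s * (w i : k) * y ^ 2) = chi s * (chi (w i : k) * gs ψ) := by
      intro i
      rw [gauss_one h2 ψ hψ _ (mul_ne_zero hs (Units.ne_zero _)), chi_mul, mul_assoc]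
    simp only [this]
    rw [Finset.prod_mul_distrib, Finset.prod_const]
    simp

lemma sphere_hat (h2 : ringChar k ≠ 2) (ψ : AddChar k ℂ) (hψ : ψ ≠ 1) {d : ℕ}
    (Q : QuadraticForm k (Fin d → k)) (A : ℂ)
    (hA : ∀ s : k, s ≠ 0 → ∑ x, ψ (s * Q x) = chi s ^ d * A) (t : k) (c : Fin d → k) :
    (Fintype.card k : ℂ) * ∑ x, (if Q x = t then ψ (QuadraticMap.polar Q c x) else 0) =
      (∑ x, ψ (QuadraticMap.polar Q c x)) + A * tw ψ d t (Q c) := by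
  have hprim := AddChar.IsPrimitive.of_ne_one hψ
  have e1 : ∀ x, (Fintype.card k : ℂ) * (if Q x = t then ψ (QuadraticMap.polar Q c x) else 0) =
      ∑ s : k, ψ (s * (Q x - t)) * ψ (QuadraticMap.polar Q c x) := by
    intro x
    rw [← Finset.sum_mul, AddChar.sum_mulShift _ hprim]
    by_cases h : Q x = t
    · simp [h]
    · simp [h, sub_eq_zero]
  rw [Finset.mul_sum, Finset.sum_congr rfl fun x _ => e1 x, Finset.sum_comm]
  have e2 : ∀ s : k, ∑ x, ψ (s * (Q x - t)) * ψ (QuadraticMap.polar Q c x) =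
      (if s = 0 then ∑ x, ψ (QuadraticMap.polar Q c x) else 0) +
      A * (if s = 0 then 0 else chi s ^ d * ψ (-(s * t) - Q c / s)) := by
    intro s
    by_cases h0 : s = 0
    · simp [h0]
    rw [if_neg h0, if_neg h0, zero_add]
    have : A * (chi s ^ d * ψ (-(s * t) - Q c / s)) =
      (chi s ^ d * A) * ψ (-(s * t) - Q c / s) := by ring
    rw [this, ← hA s h0, Finset.sum_mul]
    refine Fintype.sum_equiv (Equiv.addRight (s⁻¹ • c)) _ _ fun x => ?_
    simp only [Equiv.coe_addRight]
    rw [← AddChar.map_add_eq_mul, ← AddChar.map_add_eq_mul]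
    congr 1
    rw [QuadraticMap.map_add Q, QuadraticMap.map_smul, QuadraticMap.polar_smul_right,
      QuadraticMap.polar_comm Q x c]
    simp only [smul_eq_mul]
    field_simp
    ring
  rw [Finset.sum_congr rfl fun s _ => e2 s, Finset.sum_add_distrib, ← Finset.mul_sum, tw]
  simp

/-- the characters attached to the polar form -/
noncomputable def pchar (ψ : AddChar k ℂ) {d : ℕ} (Q : QuadraticForm k (Fin d → k))
    (c : Fin d → k) : AddChar (Fin d → k) ℂ :=
  ψ.compAddMonoidHom (QuadraticMap.polarBilin Q c).toAddMonoidHom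

lemma pchar_apply (ψ : AddChar k ℂ) {d : ℕ} (Q : QuadraticForm k (Fin d → k))
    (c x : Fin d → k) : pchar ψ Q c x = ψ (QuadraticMap.polar Q c x) := rfl

lemma pchar_sum (ψ : AddChar k ℂ) (hψ : ψ ≠ 1) {d : ℕ} (Q : QuadraticForm k (Fin d → k))
    (hQ : ∀ x, (∀ y, QuadraticMap.polar (⇑Q) x y = 0) → x = 0) (c : Fin d → k) :
    ∑ x, pchar ψ Q c x = if c = 0 then (Fintype.card (Fin d → k) : ℂ) else 0 := by
  split_ifs with h
  · subst h
    simp [pchar_apply]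
  · apply AddChar.sum_eq_zero_of_ne_one
    intro h1
    obtain ⟨y, hy⟩ : ∃ y, QuadraticMap.polar Q c y ≠ 0 := by
      by_contra hcon
      push Not at hcon
      exact h (hQ c hcon)
    obtain ⟨a, ha⟩ := AddChar.ne_one_iff.mp hψ
    apply ha
    have := congrArg (fun φ : AddChar (Fin d → k) ℂ => φ ((a / QuadraticMap.polar Q c y) • y)) h1
    simp only [pchar_apply, QuadraticMap.polar_smul_right, smul_eq_mul, AddChar.one_apply] at this
    rwa [div_mul_cancel₀ _ hy] at this

lemma pchar_sum' (ψ : AddChar k ℂ) (hψ : ψ ≠ 1) {d : ℕ} (Q : QuadraticForm k (Fin d → k))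
    (hQ : ∀ x, (∀ y, QuadraticMap.polar (⇑Q) x y = 0) → x = 0) (x : Fin d → k) :
    ∑ c, pchar ψ Q c x = if x = 0 then (Fintype.card (Fin d → k) : ℂ) else 0 := by
  rw [← pchar_sum ψ hψ Q hQ x]
  simp only [pchar_apply]
  exact Finset.sum_congr rfl fun c _ => by rw [QuadraticMap.polar_comm]

end quad
end Kloos

set_option maxHeartbeats 2000000 in
theorem Kloos.main_aux (q d : ℕ) (hd : 3 ≤ d)
    (F : Type) [Field F] [Fintype F] [DecidableEq F]
    (hq : Fintype.card F = q) (hodd : Odd q)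
    (Q : QuadraticForm F (Fin d → F))
    (hQ : ∀ x, (∀ y, QuadraticMap.polar (⇑Q) x y = 0) → x = 0)
    (f g : (Fin d → F) × (Fin d → F) → ℝ)
    (hf : ∀ p, 0 ≤ f p) (hg : ∀ p, 0 ≤ g p)
    (t : F) (ht : t ≠ 0) :
    |(∑ x, ∑ y, ∑ z, ∑ w,
        if Q (x - z) = t ∧ Q (w - y) = t then f (x, y) * g (z, w) else 0) -
        (q : ℝ) ^ (-(2 : ℝ)) * (∑ x, ∑ y, f (x, y)) * (∑ z, ∑ w, g (z, w))| ≤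
      3 * (q : ℝ) ^ (-(((d : ℝ) + 2) / 2)) *
          (∑ x, ∑ y, f (x, y)) * (∑ z, ∑ w, g (z, w)) +
        4 * (q : ℝ) ^ (d - 1) *
          Real.sqrt (∑ x, ∑ y, f (x, y) ^ 2) * Real.sqrt (∑ z, ∑ w, g (z, w) ^ 2) +
        4 * (q : ℝ) ^ (((d : ℝ) - 3) / 2) *
          (Real.sqrt (∑ x, (∑ y, f (x, y)) ^ 2) *
              Real.sqrt (∑ z, (∑ w, g (z, w)) ^ 2) +
            Real.sqrt (∑ y, (∑ x, f (x, y)) ^ 2) *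
              Real.sqrt (∑ w, (∑ z, g (z, w)) ^ 2)) := by
  have h2 : ringChar F ≠ 2 := by
    intro h
    have := FiniteField.even_card_of_char_two h
    rw [hq] at this
    rw [Nat.odd_iff] at hodd
    omega
  obtain ⟨ψ, hψ⟩ : ∃ ψ : AddChar F ℂ, ψ ≠ 1 := by
    refine ⟨AddChar.FiniteField.primitiveChar_to_Complex F, ?_⟩
    intro h
    have h1 := AddChar.FiniteField.primitiveChar_to_Complex_isPrimitive F (one_ne_zero)
    apply h1
    rw [h]
    ext x
    simp [AddChar.mulShift_apply]
  obtain ⟨A, hA, hAs⟩ := Kloos.quad_gauss h2 ψ hψ Q hQ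
  set r : ℝ := Real.sqrt q with hr
  have hrq : r ^ 2 = q := Real.sq_sqrt (by positivity)
  have hr1 : 1 ≤ r := by
    have := Kloos.one_le_sqrt_card (k := F)
    rwa [hq] at this
  have hr0 : 0 < r := by linarith
  rw [hq] at hA
  have hcardV : (Fintype.card (Fin d → F) : ℝ) = r ^ (2 * d) := by
    rw [pow_mul, hrq]; simp [hq]
  have hcardV' : (Fintype.card (Fin d → F) : ℂ) = ((r ^ (2 * d) : ℝ) : ℂ) := by
    rw [← hcardV]; simp
  have hqC : (Fintype.card F : ℂ) = ((r ^ 2 : ℝ) : ℂ) := by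
    rw [hrq, hq]; simp
  set N0 : ℝ := ∑ x : Fin d → F, if Q x = t then (1 : ℝ) else 0 with hN0
  have hN0pos : 0 ≤ N0 := Finset.sum_nonneg fun x _ => by split_ifs <;> norm_num
  set μ : ℝ := N0 / r ^ (2 * d) with hμ
  have hμ0 : 0 ≤ μ := by positivity
  obtain ⟨n, rfl⟩ : ∃ n, d = n + 3 := ⟨d - 3, by omega⟩
  set b : (Fin (n + 3) → F) → ℝ := fun x => (if Q x = t then (1 : ℝ) else 0) - μ with hb
  have hat := fun c => Kloos.sphere_hat h2 ψ hψ Q A hAs t c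
  -- cardinality
  have hμd : |μ - (r⁻¹) ^ 2| ≤ r⁻¹ ^ (n + 4) := by
    have h0 := hat 0
    rw [hqC] at h0
    have z1 : ∀ x : Fin (n + 3) → F, ψ (QuadraticMap.polar Q 0 x) = 1 := by intro x; simp
    simp only [z1, QuadraticMap.map_zero] at h0
    have z2 : (∑ x : Fin (n + 3) → F, if Q x = t then (1 : ℂ) else 0) = ((N0 : ℝ) : ℂ) := by
      exact (Complex.ofReal_sum _ _).symm ▸ Finset.sum_congr rfl fun x _ => by split_ifs <;> simp
    have z3 : (∑ x : Fin (n + 3) → F, (1 : ℂ)) = ((r ^ (2 * (n + 3)) : ℝ) : ℂ) := by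
      rw [← hcardV']; simp
    rw [z2, z3] at h0
    have h1 : ‖((r ^ 2 * N0 - r ^ (2 * (n + 3)) : ℝ) : ℂ)‖ ≤ r ^ (n + 3) * r := by
      have : ((r ^ 2 * N0 - r ^ (2 * (n + 3)) : ℝ) : ℂ) = A * Kloos.tw ψ (n + 3) t 0 := by
        push_cast at h0 ⊢
        linear_combination h0
      rw [this, norm_mul, hA]
      have := Kloos.tw_bound_zero h2 ψ hψ (n + 3) t ht
      rw [hq] at this
      gcongr
    rw [Complex.norm_real, Real.norm_eq_abs] at h1
    have h3 : μ - r⁻¹ ^ 2 = (r ^ 2 * N0 - r ^ (2 * (n + 3))) * r⁻¹ ^ (2 * n + 8) := by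
      have a1 : (r * r⁻¹) ^ 2 = 1 := by rw [mul_inv_cancel₀ hr0.ne', one_pow]
      have a2 : r ^ (2 * (n + 3)) * r⁻¹ ^ (2 * (n + 3)) = 1 := by
        rw [← mul_pow, mul_inv_cancel₀ hr0.ne', one_pow]
      rw [hμ, div_eq_mul_inv, ← inv_pow]
      generalize r⁻¹ = u at *
      linear_combination (-N0 * u ^ (2 * (n + 3))) * a1 + u ^ 2 * a2
    rw [h3, abs_mul, abs_of_nonneg (by positivity : 0 ≤ r⁻¹ ^ (2 * n + 8))]
    calc _ ≤ (r ^ (n + 3) * r) * r⁻¹ ^ (2 * n + 8) := by gcongr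
      _ = r⁻¹ ^ (n + 4) := by
        have a2 : r ^ (n + 4) * r⁻¹ ^ (n + 4) = 1 := by
          rw [← mul_pow, mul_inv_cancel₀ hr0.ne', one_pow]
        generalize r⁻¹ = u at *
        linear_combination u ^ (n + 4) * a2
  have hu1 : r⁻¹ ≤ 1 := inv_le_one_of_one_le₀ hr1
  have hu0 : 0 < r⁻¹ := by positivity
  have hpw : r⁻¹ ^ (n + 4) ≤ r⁻¹ ^ 2 := pow_le_pow_of_le_one hu0.le hu1 (by omega)
  have hμ2 : μ ≤ 2 * r⁻¹ ^ 2 := by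
    have := (abs_le.mp hμd).2
    linarith
  have hμsq : |μ ^ 2 - r⁻¹ ^ 4| ≤ 3 * r⁻¹ ^ (n + 5) := by
    have : μ ^ 2 - r⁻¹ ^ 4 = (μ - r⁻¹ ^ 2) * (μ + r⁻¹ ^ 2) := by ring
    rw [this, abs_mul, abs_of_nonneg (by positivity : 0 ≤ μ + r⁻¹ ^ 2)]
    calc _ ≤ r⁻¹ ^ (n + 4) * (3 * r⁻¹ ^ 2) := by
          apply mul_le_mul hμd (by linarith) (by positivity) (by positivity)
      _ = 3 * r⁻¹ ^ (n + 6) := by ring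
      _ ≤ 3 * r⁻¹ ^ (n + 5) := by
          have := pow_le_pow_of_le_one hu0.le hu1 (by omega : n + 5 ≤ n + 6)
          linarith
  -- operator norm
  have hbhat : ∀ c, ‖∑ x, (b x : ℂ) * Kloos.pchar ψ Q c x‖ ≤ 2 * r ^ (n + 2) := by
    intro c
    have e1 : ∑ x, (b x : ℂ) * Kloos.pchar ψ Q c x =
        (∑ x, if Q x = t then ψ (QuadraticMap.polar Q c x) else 0) -
          (μ : ℂ) * ∑ x, Kloos.pchar ψ Q c x := by
      rw [Finset.mul_sum, ← Finset.sum_sub_distrib]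
      refine Finset.sum_congr rfl fun x _ => ?_
      simp only [hb, Kloos.pchar_apply]
      split_ifs <;> push_cast <;> ring
    rw [e1, Kloos.pchar_sum ψ hψ Q hQ]
    have h0 := hat c
    have z := Kloos.pchar_sum ψ hψ Q hQ c
    simp only [Kloos.pchar_apply] at z
    rw [z] at h0
    by_cases hc : c = 0
    · subst hc
      have z1 : ∀ x : Fin (n + 3) → F, ψ (QuadraticMap.polar Q 0 x) = 1 := by intro x; simp
      simp only [z1, if_true]
      have z2 : (∑ x : Fin (n + 3) → F, if Q x = t then (1 : ℂ) else 0) = ((N0 : ℝ) : ℂ) := by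
        exact (Complex.ofReal_sum _ _).symm ▸ Finset.sum_congr rfl fun x _ => by split_ifs <;> simp
      rw [z2, hcardV', ← Complex.ofReal_mul, ← Complex.ofReal_sub]
      have : N0 - μ * r ^ (2 * (n + 3)) = 0 := by rw [hμ]; field_simp; ring
      rw [this]; simp; positivity
    · rw [if_neg hc, zero_add, hqC] at h0
      rw [if_neg hc, mul_zero, sub_zero]
      have h1 := congrArg norm h0
      rw [norm_mul, norm_mul, hA, Complex.norm_real, Real.norm_eq_abs,
        abs_of_nonneg (by positivity : 0 ≤ r ^ 2)] at h1
      have h3 := Kloos.tw_bound h2 ψ hψ (n + 3) t (Q c) ht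
      rw [hq] at h3
      refine le_of_mul_le_mul_left ?_ (by positivity : 0 < r ^ 2)
      rw [h1]
      calc _ ≤ r ^ (n + 3) * (2 * r) := by gcongr
        _ = _ := by ring
  have hB := Kloos.conv_bound (Kloos.pchar ψ Q) (Kloos.pchar_sum' ψ hψ Q hQ) b _ hbhat
  have main := Kloos.assembly b (2 * r ^ (n + 2)) μ (by positivity) hμ0 hB f g
  have esum : (∑ x, ∑ y, ∑ z, ∑ w,
        if Q (x - z) = t ∧ Q (w - y) = t then f (x, y) * g (z, w) else 0) =
      ∑ x, ∑ y, ∑ z, ∑ w, (μ + b (x - z)) * (μ + b (w - y)) * (f (x, y) * g (z, w)) := by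
    refine Finset.sum_congr rfl fun x _ => Finset.sum_congr rfl fun y _ =>
      Finset.sum_congr rfl fun z _ => Finset.sum_congr rfl fun w _ => ?_
    simp only [hb]
    by_cases h1 : Q (x - z) = t <;> by_cases h3 : Q (w - y) = t <;> simp [h1, h3]
  rw [esum]
  have hqr : ∀ a : ℝ, (q : ℝ) ^ a = r ^ (2 * a) := by
    intro a
    rw [← hrq, ← Real.rpow_natCast r 2, ← Real.rpow_mul hr0.le]; norm_num
  have p1 : (q : ℝ) ^ (-(2 : ℝ)) = r⁻¹ ^ 4 := by
    rw [hqr, Real.rpow_mul hr0.le]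
    rw [show (-(2 : ℝ)) = -((2 : ℕ) : ℝ) by norm_num, Real.rpow_neg (by positivity), Real.rpow_natCast, ← Real.rpow_natCast,
      Real.rpow_two, inv_pow]
    norm_num
    ring
  have p2 : (q : ℝ) ^ (-((((n + 3 : ℕ) : ℝ) + 2) / 2)) = r⁻¹ ^ (n + 5) := by
    rw [hqr, show 2 * (-((((n + 3 : ℕ) : ℝ) + 2) / 2)) = -((n + 5 : ℕ) : ℝ) by push_cast; ring,
      Real.rpow_neg hr0.le, Real.rpow_natCast, inv_pow]
  have p3 : (q : ℝ) ^ ((((n + 3 : ℕ) : ℝ) - 3) / 2) = r ^ n := by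
    rw [hqr, show 2 * ((((n + 3 : ℕ) : ℝ) - 3) / 2) = (n : ℝ) by push_cast; ring, Real.rpow_natCast]
  have p4 : 4 * (q : ℝ) ^ (n + 3 - 1) = (2 * r ^ (n + 2)) ^ 2 := by
    rw [show n + 3 - 1 = n + 2 by omega, ← hrq]; ring
  rw [p1, p2, p3, p4]
  set S := ∑ x, ∑ y, ∑ z, ∑ w, (μ + b (x - z)) * (μ + b (w - y)) * (f (x, y) * g (z, w))
  set f1 := ∑ x, ∑ y, f (x, y) with hf1
  set g1 := ∑ z, ∑ w, g (z, w) with hg1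
  have hf1' : 0 ≤ f1 := Finset.sum_nonneg fun x _ => Finset.sum_nonneg fun y _ => hf _
  have hg1' : 0 ≤ g1 := Finset.sum_nonneg fun x _ => Finset.sum_nonneg fun y _ => hg _
  set R := (Real.sqrt (∑ x, (∑ y, f (x, y)) ^ 2) *
              Real.sqrt (∑ z, (∑ w, g (z, w)) ^ 2) +
            Real.sqrt (∑ y, (∑ x, f (x, y)) ^ 2) *
              Real.sqrt (∑ w, (∑ z, g (z, w)) ^ 2))
  have hR : 0 ≤ R := by positivity
  have k1 : |(μ ^ 2 - r⁻¹ ^ 4) * f1 * g1| ≤ 3 * r⁻¹ ^ (n + 5) * f1 * g1 := by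
    rw [abs_mul, abs_mul, abs_of_nonneg hf1', abs_of_nonneg hg1']
    gcongr
  have k2 : μ * (2 * r ^ (n + 2)) * R ≤ 4 * r ^ n * R := by
    refine mul_le_mul_of_nonneg_right ?_ hR
    calc μ * (2 * r ^ (n + 2)) ≤ (2 * r⁻¹ ^ 2) * (2 * r ^ (n + 2)) := by gcongr
      _ = 4 * r ^ n := by field_simp; ring
  have k3 : S - r⁻¹ ^ 4 * f1 * g1 = (S - μ ^ 2 * f1 * g1) + (μ ^ 2 - r⁻¹ ^ 4) * f1 * g1 := by ring
  rw [k3]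
  refine (abs_add_le _ _).trans ?_
  linarith

theorem stmt16 (q d : ℕ) (hd : 3 ≤ d)
    (F : Type) [Field F] [Fintype F] [DecidableEq F]
    (hq : Fintype.card F = q) (hodd : Odd q)
    (Q : QuadraticForm F (Fin d → F))
    (hQ : ∀ x, (∀ y, QuadraticMap.polar (⇑Q) x y = 0) → x = 0)
    (f g : (Fin d → F) × (Fin d → F) → ℝ)
    (hf : ∀ p, 0 ≤ f p) (hg : ∀ p, 0 ≤ g p)
    (t : F) (ht : t ≠ 0) :
    |(∑ x, ∑ y, ∑ z, ∑ w,
        if Q (x - z) = t ∧ Q (w - y) = t then f (x, y) * g (z, w) else 0) -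
        (q : ℝ) ^ (-(2 : ℝ)) * (∑ x, ∑ y, f (x, y)) * (∑ z, ∑ w, g (z, w))| ≤
      3 * (q : ℝ) ^ (-(((d : ℝ) + 2) / 2)) *
          (∑ x, ∑ y, f (x, y)) * (∑ z, ∑ w, g (z, w)) +
        4 * (q : ℝ) ^ (d - 1) *
          Real.sqrt (∑ x, ∑ y, f (x, y) ^ 2) * Real.sqrt (∑ z, ∑ w, g (z, w) ^ 2) +
        4 * (q : ℝ) ^ (((d : ℝ) - 3) / 2) *
          (Real.sqrt (∑ x, (∑ y, f (x, y)) ^ 2) *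
              Real.sqrt (∑ z, (∑ w, g (z, w)) ^ 2) +
            Real.sqrt (∑ y, (∑ x, f (x, y)) ^ 2) *
              Real.sqrt (∑ w, (∑ z, g (z, w)) ^ 2)) := by
  exact Kloos.main_aux q d hd F hq hodd Q hQ f g hf hg t ht
end

section
/- Let q be an odd prime power and work in F_q², with ‖x‖ = x_1² + x_2² for x = (x_1, x_2) ∈ F_q². Let f, g : F_q² × F_q² → ℝ be nonnegative functions and define F(x) = Σ_y f(x,y), G(z) = Σ_w g(z,w), F′(y) = Σ_x f(x,y), G′(w) = Σ_z g(z,w). Write ‖f‖₁ = Σ_{x,y} f(x,y), ‖f‖₂ = (Σ_{x,y} f(x,y)²)^{1/2}, and similarly for g, and ‖F‖₂ = (Σ_x F(x)²)^{1/2}, etc. Then for every t ∈ F_q \ {0}: | Σ_{(x,y,z,w): ‖x−z‖ = t and ‖w−y‖ = t} f(x,y) g(z,w) − q^{−2} ‖f‖₁ ‖g‖₁ | ≤ 3 q^{−3} ‖f‖₁ ‖g‖₁ + 4 q ‖f‖₂ ‖g‖₂ + 4 q^{−1/2} ( ‖F‖₂ ‖G‖₂ + ‖F′‖₂ ‖G′‖₂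 ). -/
open Finset
open Polynomial in
lemma step_base {K : Type*} [Field K] (p μ P : ℕ) [Fact p.Prime] [CharP K p] (hP : P = p ^ μ)
    (hodd : Odd P) (f : K[X]) (hf : Squarefree f) (hfd : 0 < f.natDegree) (r s : K[X])
    (hr : 2 * r.natDegree < P) (hs : 2 * s.natDegree + f.natDegree < P)
    (h : X ^ P ∣ r + s * f ^ ((P + 1) / 2)) : r = 0 ∧ s = 0 := by
  obtain ⟨n, hn⟩ : ∃ n, P = 2 * n + 1 := hodd
  have hn2 : (P + 1) / 2 = n + 1 := by omega
  rw [hn2] at h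
  have h0 : X ^ P ∣ f ^ P - C (f.coeff 0 ^ P) := by
    obtain ⟨k, hk⟩ := X_dvd_sub_C (p := f)
    have : f ^ P - C (f.coeff 0 ^ P) = (f - C (f.coeff 0)) ^ P := by
      rw [hP, sub_pow_char_pow, C_pow]
    rw [this, hk, mul_pow]
    exact dvd_mul_right _ _
  have h1 : X ^ P ∣ r ^ 2 - s ^ 2 * f * C (f.coeff 0 ^ P) := by
    have e : r ^ 2 - s ^ 2 * f * C (f.coeff 0 ^ P) = (r + s * f ^ (n + 1)) * (r - s * f ^ (n + 1))
        + s ^ 2 * f * (f ^ P - C (f.coeff 0 ^ P)) := by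
      rw [hn]; ring
    rw [e]
    exact dvd_add (h.mul_right _) (h0.mul_left _)
  have h2 : r ^ 2 - s ^ 2 * f * C (f.coeff 0 ^ P) = 0 := by
    apply Polynomial.eq_zero_of_dvd_of_natDegree_lt h1
    rw [natDegree_X_pow]
    refine lt_of_le_of_lt (natDegree_sub_le _ _) (max_lt ?_ ?_)
    · rwa [natDegree_pow]
    · refine lt_of_le_of_lt natDegree_mul_le ?_
      rw [natDegree_C, add_zero]
      refine lt_of_le_of_lt natDegree_mul_le ?_
      rwa [natDegree_pow]
  by_cases hk : f.coeff 0 = 0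
  · have hr0 : r = 0 := by
      rw [hk, zero_pow (by omega), C_0, mul_zero, sub_zero] at h2
      exact pow_eq_zero_iff (two_ne_zero) |>.1 h2
    refine ⟨hr0, ?_⟩
    rw [hr0, zero_add] at h
    obtain ⟨k, rfl⟩ := X_dvd_iff.2 hk
    have hXk : ¬ (X ∣ k) := by
      rintro ⟨k', rfl⟩
      have := hf X ⟨k', by ring⟩
      exact not_isUnit_X this
    have hcop : IsCoprime (X ^ n : K[X]) (k ^ (n+1)) :=
      IsCoprime.pow ((irreducible_X.coprime_iff_not_dvd).2 hXk)
    have h3 : (X ^ n : K[X]) ∣ s * k ^ (n+1) := by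
      have e1 : (X : K[X]) ^ P = X ^ (n+1) * X ^ n := by rw [hn]; ring
      have e2 : s * (X * k) ^ (n+1) = X ^ (n+1) * (s * k ^ (n+1)) := by rw [mul_pow]; ring
      rw [e1, e2] at h
      exact (mul_dvd_mul_iff_left (pow_ne_zero _ X_ne_zero)).1 h
    have h4 := hcop.dvd_of_dvd_mul_right h3
    apply Polynomial.eq_zero_of_dvd_of_natDegree_lt h4
    rw [natDegree_X_pow]; omega
  · have hu : IsUnit (C (f.coeff 0 ^ P) : K[X]) := by
      rw [isUnit_C]; exact (pow_ne_zero _ hk).isUnit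
    by_cases hs0 : s = 0
    · refine ⟨?_, hs0⟩
      rw [hs0] at h2
      simpa using h2
    · exfalso
      have h3 : s ^ 2 ∣ r ^ 2 := ⟨f * C (f.coeff 0 ^ P), by linear_combination h2⟩
      obtain ⟨u, rfl⟩ := (UniqueFactorizationMonoid.pow_dvd_pow_iff_dvd two_ne_zero).1 h3
      have h4 : u * u = f * C (f.coeff 0 ^ P) := by
        apply mul_left_cancel₀ (pow_ne_zero 2 hs0)
        linear_combination h2
      have h5 : u * u ∣ f := by
        rw [h4]; exact (IsUnit.mul_right_dvd hu).2 dvd_rfl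
      have h6 := hf u h5
      have h7 : IsUnit f := by
        have := h6.mul h6
        rw [h4] at this
        exact isUnit_of_mul_isUnit_left this
      have := natDegree_eq_zero_of_isUnit h7
      omega

open Polynomial in
lemma step_nonvan {K : Type*} [Field K] (p μ P : ℕ) [Fact p.Prime] [CharP K p] (hP : P = p ^ μ)
    (hodd : Odd P) (f : K[X]) (hf : Squarefree f) (hfd : 0 < f.natDegree) (J : ℕ) : ∀ (r s : ℕ → K[X])
    (hr : ∀ j, 2 * (r j).natDegree < P) (hs : ∀ j, 2 * (s j).natDegree + f.natDegree < P)
    (h : ∑ j ∈ range J, X ^ (j * P) * (r j + s j * f ^ ((P + 1) / 2)) = 0),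
    ∀ j < J, r j = 0 ∧ s j = 0 := by
  induction J with
  | zero => intros; omega
  | succ J ih =>
    intro r s hr hs h
    rw [sum_range_succ'] at h
    have e : ∑ k ∈ range J, X ^ ((k + 1) * P) * (r (k + 1) + s (k + 1) * f ^ ((P + 1) / 2))
      = X ^ P * ∑ k ∈ range J, X ^ (k * P) * (r (k + 1) + s (k + 1) * f ^ ((P + 1) / 2)) := by
      rw [mul_sum]; refine sum_congr rfl fun k _ => ?_
      rw [add_mul, one_mul, pow_add]; ring
    rw [e] at h
    have h0 : r 0 = 0 ∧ s 0 = 0 := by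
      apply step_base p μ P hP hodd f hf hfd _ _ (hr 0) (hs 0)
      refine ⟨- ∑ k ∈ range J, X ^ (k * P) * (r (k + 1) + s (k + 1) * f ^ ((P + 1) / 2)), ?_⟩
      rw [zero_mul, pow_zero, one_mul] at h
      linear_combination h
    rw [h0.1, h0.2, zero_mul (f ^ ((P + 1) / 2)), add_zero (0 : K[X]), mul_zero, add_zero] at h
    have h1 := (mul_eq_zero.1 h).resolve_left (pow_ne_zero _ X_ne_zero)
    have h2 := ih (fun k => r (k+1)) (fun k => s (k+1)) (fun k => hr _) (fun k => hs _) h1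
    intro j hj
    rcases j with _ | j
    · exact h0
    · exact h2 j (by omega)

open Polynomial in
lemma poly_dep {K ι : Type*} [Field K] [Fintype ι] (N : ℕ) (B : ι → K[X])
    (hB : ∀ i, (B i).degree < N) (hN : N < Fintype.card ι) :
    ∃ v : ι → K, v ≠ 0 ∧ ∑ i, C (v i) * B i = 0 := by
  let B' : ι → degreeLT K N := fun i => ⟨B i, mem_degreeLT.2 (hB i)⟩
  have hfr : Module.finrank K (degreeLT K N) = N := by
    rw [(degreeLTEquiv K N).finrank_eq]; simp
  have hfin : Module.Finite K (degreeLT K N) := Module.Finite.equiv (degreeLTEquiv K N).symm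
  have hd : ¬ LinearIndependent K B' := fun h => by
    have := h.fintype_card_le_finrank
    omega
  rw [Fintype.not_linearIndependent_iff] at hd
  obtain ⟨g, hg, i, hi⟩ := hd
  refine ⟨g, fun h => hi (by rw [h]; rfl), ?_⟩
  have := congrArg Subtype.val hg
  simpa [B', smul_eq_C_mul] using this

open Polynomial in
lemma stepanov {K : Type*} [Field K] [Fintype K] [DecidableEq K] (p μ P h : ℕ) [Fact p.Prime]
    [CharP K p] (hP : P = p ^ μ) (hcard : Fintype.card K = P ^ 2)
    (hodd : Odd P) (f : K[X]) (hf : Squarefree f) (hfd : f.natDegree = 2 * h) (hh : 0 < h)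
    (hbig : (2 * h + 2) ^ 2 < P) (a : K) :
    2 * (univ.filter fun x : K => (f.eval x) ^ ((P ^ 2 - 1) / 2) = a).card ≤ P ^ 2 + 4 * h * P := by
  obtain ⟨n, hn⟩ : ∃ n, P = 2 * n + 1 := hodd
  have hn2 : (P + 1) / 2 = n + 1 := by omega
  have hnh : h < n := by nlinarith
  obtain ⟨L, hL⟩ : ∃ L, n = h + L := ⟨n - h, by omega⟩
  have hL0 : 0 < L := by omega
  obtain ⟨L', hL'⟩ : ∃ L', L = L' + 1 := ⟨L - 1, by omega⟩
  set J := n + 1 + h with hJ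
  let B : Fin J × Fin L × Bool → K[X] := fun w =>
    X ^ (w.1 : ℕ) * (X ^ ((w.2.1 : ℕ) * P) * (if w.2.2 then C a * f ^ (n + 1) else 1))
  set N := J + L' * P + 2 * h * (n + 1) with hNdef
  have hB : ∀ i, (B i).degree < N := by
    rintro ⟨j, i, b⟩
    have hj := j.2
    have hi : (i : ℕ) ≤ L' := by have := i.2; omega
    have hiP : (i : ℕ) * P ≤ L' * P := Nat.mul_le_mul_right _ hi
    refine lt_of_le_of_lt degree_le_natDegree ?_
    rw [Nat.cast_lt]
    refine lt_of_le_of_lt natDegree_mul_le ?_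
    have h1 : (X ^ ((i : ℕ) * P) * (if b then C a * f ^ (n + 1) else 1)).natDegree
        ≤ (i : ℕ) * P + 2 * h * (n + 1) := by
      refine natDegree_mul_le.trans ?_
      rw [natDegree_X_pow]
      gcongr
      cases b
      · simp
      · simp only [if_true]
        refine natDegree_mul_le.trans ?_
        rw [natDegree_C, natDegree_pow, hfd, zero_add, mul_comm]
    simp only [natDegree_X_pow]
    omega
  have hN : N < Fintype.card (Fin J × Fin L × Bool) := by
    simp only [Fintype.card_prod, Fintype.card_fin, Fintype.card_bool]
    subst hn
    subst hL
    subst hL'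
    rw [hNdef, hJ]
    nlinarith
  obtain ⟨v, hv, hv0⟩ := poly_dep N B hB hN
  let r : ℕ → K[X] := fun j => if hj : j < J then ∑ i : Fin L, C (v (⟨j, hj⟩, i, false) ^ P) * X ^ (i : ℕ) else 0
  let s : ℕ → K[X] := fun j => if hj : j < J then ∑ i : Fin L, C (v (⟨j, hj⟩, i, true) ^ P) * X ^ (i : ℕ) else 0
  have hdeg : ∀ w : Fin L → K, (∑ i : Fin L, C (w i) * X ^ (i : ℕ)).natDegree ≤ L' := by
    intro w
    refine natDegree_sum_le_of_forall_le _ _ fun i _ => ?_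
    refine (natDegree_C_mul_X_pow_le _ _).trans ?_
    have := i.2; omega
  have hrd : ∀ j, (r j).natDegree ≤ L' := by
    intro j; simp only [r]; split_ifs
    · exact hdeg _
    · simp
  have hsd : ∀ j, (s j).natDegree ≤ L' := by
    intro j; simp only [s]; split_ifs
    · exact hdeg _
    · simp
  set G : K[X] := ∑ j ∈ range J, X ^ (j * P) * (r j + s j * f ^ ((P + 1) / 2)) with hG
  have hPpos : 0 < P := by omega
  have hG0 : G ≠ 0 := by
    intro h0
    have h1 := step_nonvan p μ P hP (by exact ⟨n, hn⟩) f hf (by omega) J r s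
      (fun j => by have := hrd j; omega) (fun j => by have := hsd j; omega) h0
    have h2 : ∀ w : Fin L → K, (∑ i : Fin L, C (w i ^ P) * X ^ (i : ℕ)) = 0 → ∀ i, w i = 0 := by
      intro w hw i
      have := congrArg (fun g => coeff g (i : ℕ)) hw
      simp only [finsetSum_coeff, coeff_C_mul, coeff_X_pow, coeff_zero] at this
      rw [Finset.sum_eq_single i] at this
      · simpa [hPpos.ne'] using this
      · intro b _ hb
        rw [if_neg, mul_zero]
        exact fun hh => hb (Fin.ext hh.symm)
      · simp
    apply hv
    funext ⟨j, i, b⟩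
    have h3 := h1 j j.2
    simp only [r, s, j.2, dif_pos] at h3
    cases b
    · exact h2 (fun i => v (j, i, false)) h3.1 i
    · exact h2 (fun i => v (j, i, true)) h3.2 i
  have hGd : G.natDegree ≤ (n + h) * P + L' + 2 * h * (n + 1) := by
    refine natDegree_sum_le_of_forall_le _ _ fun j hj => ?_
    rw [mem_range] at hj
    refine natDegree_mul_le.trans ?_
    rw [natDegree_X_pow, add_assoc]
    have hj2 : j ≤ n + h := by omega
    gcongr
    refine (natDegree_add_le _ _).trans (max_le ?_ ?_)
    · have := hrd j; omega
    · refine natDegree_mul_le.trans ?_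
      gcongr
      · exact hsd j
      · rw [natDegree_pow, hfd, hn2, mul_comm]
  have hQ : ∀ x : K, (x ^ P) ^ P = x := by
    intro x
    rw [← pow_mul, ← sq, ← hcard, FiniteField.pow_card]
  have hroot : ∀ x : K, (f.eval x) ^ ((P ^ 2 - 1) / 2) = a → G.eval x = 0 := by
    intro x hx
    have h1 : (G.eval x) ^ P = (∑ i, C (v i) * B i).eval x := by
      rw [hG, sum_range, eval_finsetSum, eval_finsetSum, hP, sum_pow_char_pow, ← hP,
        Fintype.sum_prod_type]
      refine sum_congr rfl fun j _ => ?_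
      simp only [r, s, j.2, dif_pos, eval_mul, eval_add, eval_pow, eval_X, eval_finsetSum, eval_C, B]
      have hF : (eval x f ^ (n + 1)) ^ P = a * eval x f ^ (n + 1) := by
        rw [← hx, ← pow_mul, ← pow_add]
        congr 1
        rw [hn]
        have : ((2 * n + 1) ^ 2 - 1) / 2 = 2 * n ^ 2 + 2 * n := by
          have : (2 * n + 1) ^ 2 - 1 = 2 * (2 * n ^ 2 + 2 * n) := by
            rw [Nat.sub_eq_iff_eq_add (Nat.one_le_pow _ _ (by omega))]; ring
          omega
        rw [this]; ring
      have hS : ∀ w : Fin L → K, (∑ i : Fin L, (w i ^ P) * x ^ (i : ℕ)) ^ P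
          = ∑ i, w i * x ^ ((i : ℕ) * P) := by
        intro w
        rw [hP, sum_pow_char_pow, ← hP]
        refine sum_congr rfl fun i _ => ?_
        rw [mul_pow, hQ, pow_mul]
      have hadd : ∀ u w : K, (u + w) ^ P = u ^ P + w ^ P := by
        intro u w; rw [hP, add_pow_char_pow]
      rw [mul_pow, hadd, mul_pow, hS (fun i => v (j, i, false)), hS (fun i => v (j, i, true)), hn2, hF]
      rw [pow_mul, hQ, Fintype.sum_prod_type]
      simp only [Fintype.sum_bool, if_true, eval_mul, eval_C, eval_pow]
      rw [sum_add_distrib, sum_mul, mul_add, mul_sum, mul_sum, add_comm]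
      congr 1
      · refine sum_congr rfl fun i _ => ?_
        ring
      · refine sum_congr rfl fun i _ => ?_
        simp
        ring
    rw [hv0, eval_zero] at h1
    exact pow_eq_zero_iff hPpos.ne' |>.1 h1
  have hc : (univ.filter fun x : K => (f.eval x) ^ ((P ^ 2 - 1) / 2) = a).card ≤ G.natDegree := by
    refine le_trans (Finset.card_le_card ?_) ((Multiset.toFinset_card_le _).trans (card_roots' G))
    intro x hx
    rw [Multiset.mem_toFinset, mem_roots hG0]
    exact hroot x (mem_filter.1 hx).2
  refine (Nat.mul_le_mul_left 2 (hc.trans hGd)).trans ?_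
  subst hn
  subst hL
  subst hL'
  nlinarith

open Polynomial in
lemma stepanov_sum {K : Type*} [Field K] [Fintype K] [DecidableEq K] (p μ P h : ℕ) [Fact p.Prime]
    [CharP K p] (hP : P = p ^ μ) (hcard : Fintype.card K = P ^ 2)
    (hodd : Odd P) (f : K[X]) (hf : Squarefree f) (hfd : f.natDegree = 2 * h) (hh : 0 < h)
    (hbig : (2 * h + 2) ^ 2 < P) :
    |∑ x : K, quadraticChar K (f.eval x)| ≤ 6 * h * P := by
  have hchar : ringChar K ≠ 2 := by
    intro h2
    have := FiniteField.even_card_of_char_two h2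
    rw [hcard] at this
    have h3 : Odd (P ^ 2) := hodd.pow
    rw [Nat.odd_iff] at h3; omega
  have hhalf : Fintype.card K / 2 = (P ^ 2 - 1) / 2 := by
    rw [hcard]
    have h3 : Odd (P ^ 2) := hodd.pow
    rw [Nat.odd_iff] at h3; omega
  have key : ∀ e : ℤ, 2 * (univ.filter fun x : K => quadraticChar K (f.eval x) = e).card ≤ P ^ 2 + 4 * h * P := by
    intro e
    refine le_trans (Nat.mul_le_mul_left 2 (Finset.card_le_card ?_)) (stepanov p μ P h hP hcard hodd f hf hfd hh hbig (e : K))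
    intro x hx
    rw [mem_filter] at hx ⊢
    refine ⟨mem_univ _, ?_⟩
    rw [← hhalf, ← quadraticChar_eq_pow_of_char_ne_two' hchar, hx.2]
  have k1 := key 1
  have k2 := key (-1)
  have hf0 : f ≠ 0 := by rintro rfl; simp at hfd; omega
  have k0 : (univ.filter fun x : K => quadraticChar K (f.eval x) = 0).card ≤ 2 * h := by
    rw [← hfd]
    refine le_trans (Finset.card_le_card ?_) ((Multiset.toFinset_card_le _).trans (card_roots' f))
    intro x hx
    rw [Multiset.mem_toFinset, mem_roots hf0]
    exact quadraticChar_eq_zero_iff.1 (mem_filter.1 hx).2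
  set A := univ.filter fun x : K => quadraticChar K (f.eval x) = 1
  set B := univ.filter fun x : K => quadraticChar K (f.eval x) = -1
  set Z := univ.filter fun x : K => quadraticChar K (f.eval x) = 0
  have tri : ∀ x : K, quadraticChar K (f.eval x) = 0 ∨ quadraticChar K (f.eval x) = 1 ∨
      quadraticChar K (f.eval x) = -1 := fun x => quadraticChar_isQuadratic K _
  have hsum : ∑ x : K, quadraticChar K (f.eval x) = (A.card : ℤ) - B.card := by
    have : ∀ x : K, quadraticChar K (f.eval x) = (if quadraticChar K (f.eval x) = 1 then (1:ℤ) else 0)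
        - (if quadraticChar K (f.eval x) = -1 then (1:ℤ) else 0) := by
      intro x
      rcases tri x with h | h | h <;> rw [h] <;> simp
    rw [sum_congr rfl fun x _ => this x, sum_sub_distrib, sum_boole, sum_boole]
  have htot : (P ^ 2 : ℤ) = A.card + B.card + Z.card := by
    have : ∀ x : K, (1 : ℤ) = (if quadraticChar K (f.eval x) = 1 then (1:ℤ) else 0)
        + (if quadraticChar K (f.eval x) = -1 then (1:ℤ) else 0) + (if quadraticChar K (f.eval x) = 0 then (1:ℤ) else 0) := by
      intro x
      rcases tri x with h | h | h <;> rw [h] <;> simp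
    have h2 : ∑ x : K, (1 : ℤ) = P ^ 2 := by simp [hcard]
    rw [← h2, sum_congr rfl fun x _ => this x, sum_add_distrib, sum_add_distrib, sum_boole, sum_boole, sum_boole]
  rw [hsum, abs_le]
  zify at k1 k2 k0
  have hP1 : (1 : ℤ) ≤ P := by have : 0 < P := by omega
                               exact_mod_cast this
  have hh1 : (1 : ℤ) ≤ h := by exact_mod_cast hh
  constructor <;> nlinarith

lemma quadChar_norm {F K : Type*} [Field F] [Fintype F] [DecidableEq F] [Field K] [Fintype K] [DecidableEq K]
    [Algebra F K] (hchar : ringChar F ≠ 2) (z : K) :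
    quadraticChar F (Algebra.norm F z) = quadraticChar K z := by
  have hr : ringChar K = ringChar F := (Algebra.ringChar_eq F K).symm
  apply Int.cast_injOn_of_ringChar_ne_two (R := K) (by rwa [hr])
  · exact quadraticChar_isQuadratic F _ |> fun h => by
      rcases h with h | h | h <;> rw [h] <;> simp
  · exact quadraticChar_isQuadratic K _ |> fun h => by
      rcases h with h | h | h <;> rw [h] <;> simp
  rw [quadraticChar_eq_pow_of_char_ne_two' (by rwa [hr])]
  have h1 := congrArg (algebraMap F K) (quadraticChar_eq_pow_of_char_ne_two' hchar (Algebra.norm F z))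
  rw [map_intCast, map_pow, FiniteField.algebraMap_norm_eq_pow, ← pow_mul] at h1
  rw [h1]
  congr 1
  rw [Nat.card_eq_fintype_card, Nat.card_eq_fintype_card]
  have hq := FiniteField.odd_card_of_char_ne_two hchar
  have hQ := FiniteField.odd_card_of_char_ne_two (F := K) (by rwa [hr])
  have hdvd : Fintype.card F - 1 ∣ Fintype.card K - 1 := by
    rw [Module.card_eq_pow_finrank (K := F) (V := K)]
    simpa using Nat.sub_dvd_pow_sub_pow (Fintype.card F) 1 (Module.finrank F K)
  obtain ⟨m, hm⟩ := hdvd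
  have hF1 : 1 < Fintype.card F := Fintype.one_lt_card
  rw [hm, Nat.mul_div_cancel_left _ (by omega)]
  obtain ⟨a, ha⟩ : ∃ a, Fintype.card F = 2 * a + 1 := ⟨Fintype.card F / 2, by omega⟩
  have : Fintype.card K = 2 * (a * m) + 1 := by
    have : Fintype.card K - 1 = 2 * (a * m) := by rw [hm, ha]; simp; ring
    have := Fintype.card_pos (α := K)
    omega
  rw [this, ha]
  have e1 : (2 * a + 1) / 2 = a := by omega
  have e2 : (2 * (a * m) + 1) / 2 = a * m := by omega
  rw [e1, e2, mul_comm]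

open Polynomial in
lemma charsum_ext {F K : Type*} [Field F] [Fintype F] [DecidableEq F] [Field K] [Fintype K]
    [Algebra F K] (hchar : ringChar F ≠ 2) (k : ℕ) (hk : Module.finrank F K = 2 * k)
    (hbig : (2 * Fintype.card F + 2) ^ 2 < Fintype.card F ^ k) (ψ : AddChar F ℂ) (c : F) (hc : c ≠ 0) :
    ‖∑ x : K, ψ (Algebra.trace F K x) * (quadraticChar F (Algebra.norm F (x ^ 2 - algebraMap F K c)) : ℂ)‖
      ≤ 6 * Fintype.card F * Fintype.card F ^ k := by
  classical
  set q := Fintype.card F with hq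
  obtain ⟨p, hp⟩ := CharP.exists F
  obtain ⟨m, hpp, hm⟩ := FiniteField.card F p
  have : Fact p.Prime := ⟨hpp⟩
  have : CharP K p := (Algebra.charP_iff F K p).1 hp
  have hqodd : Odd q := by
    have := FiniteField.odd_card_of_char_ne_two hchar
    rw [Nat.odd_iff]; exact this
  have hcardK : Fintype.card K = (q ^ k) ^ 2 := by
    rw [Module.card_eq_pow_finrank (K := F) (V := K), hk, ← pow_mul, mul_comm]
  have hP : q ^ k = p ^ (m * k : ℕ) := by rw [hq, hm, pow_mul]
  have hq1 : 1 < q := Fintype.one_lt_card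
  have h2K : (2 : K) ≠ 0 := by
    have : ringChar K ≠ 2 := by rwa [← Algebra.ringChar_eq F K]
    exact Ring.two_ne_zero this
  set c' := algebraMap F K c with hc'
  have hc0 : c' ≠ 0 := by simpa [hc'] using hc
  have hU : ∀ e : K, |∑ y : K, quadraticChar K ((y ^ q - y + e) ^ 2 - c')| ≤ 6 * q * (q ^ k : ℕ) := by
    intro e
    have hd0 : (X ^ q - X + C e : K[X]).natDegree = q := by
      compute_degree!
      · rw [if_neg (by omega), if_neg (by omega)]; simp
      · omega
    have hdeg : ((X ^ q - X + C e) ^ 2 - C c' : K[X]).natDegree = 2 * q := by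
      rw [natDegree_sub_C, natDegree_pow, hd0]
    have hder : derivative ((X ^ q - X + C e) ^ 2 - C c' : K[X]) = -2 * (X ^ q - X + C e) := by
      have hqK : (q : K) = 0 := by
        have : (q : F) = 0 := by rw [hq]; simp
        have := congrArg (algebraMap F K) this
        simpa using this
      have h2 : (C 2 : K[X]) = 2 := rfl
      simp [hqK, derivative_pow, h2]
    have hsep : ((X ^ q - X + C e) ^ 2 - C c' : K[X]).Separable := by
      rw [Polynomial.Separable, hder]
      refine ⟨C (-c'⁻¹), C (-(2⁻¹ * c'⁻¹)) * (X ^ q - X + C e), ?_⟩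
      have e1 : (C c' * C c'⁻¹ : K[X]) = 1 := by rw [← C_mul, mul_inv_cancel₀ hc0, C_1]
      have e2 : (2 * C (2⁻¹) : K[X]) = 1 := by
        have : (2 : K[X]) = C 2 := rfl
        rw [this, ← C_mul, mul_inv_cancel₀ h2K, C_1]
      rw [C_neg, C_neg, C_mul]
      linear_combination e1 + (C c'⁻¹ * (X ^ q - X + C e) ^ 2) * e2
    have := stepanov_sum p (m * k) (q ^ k) q hP hcardK (hqodd.pow) _ hsep.squarefree hdeg (by omega) hbig
    simpa using this
  have htr : ∀ y : K, Algebra.trace F K (y ^ q - y) = 0 := by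
    intro y
    have := Algebra.trace_eq_of_algEquiv (FiniteField.frobeniusAlgEquivOfAlgebraic F K) y
    rw [map_sub, sub_eq_zero, ← this]
    simp [hq]
  set S := ∑ x : K, ψ (Algebra.trace F K x) * (quadraticChar F (Algebra.norm F (x ^ 2 - c')) : ℂ) with hS
  have havg : (Fintype.card K : ℂ) * S =
      ∑ e : K, ψ (Algebra.trace F K e) * ((∑ y : K, quadraticChar K ((y ^ q - y + e) ^ 2 - c') : ℤ) : ℂ) := by
    simp_rw [Int.cast_sum, mul_sum]
    rw [sum_comm]
    have : ∀ y : K, ∑ e : K, ψ (Algebra.trace F K e) * (quadraticChar K ((y ^ q - y + e) ^ 2 - c') : ℂ) = S := by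
      intro y
      rw [hS]
      refine Fintype.sum_equiv (Equiv.addLeft (y ^ q - y)) _ _ fun e => ?_
      rw [Equiv.coe_addLeft, map_add, htr, zero_add, quadChar_norm hchar]
    rw [sum_congr rfl fun y _ => this y]
    simp
  have hn : (Fintype.card K : ℝ) * ‖S‖ ≤ Fintype.card K * (6 * q * q ^ k) := by
    have : (Fintype.card K : ℝ) * ‖S‖ = ‖(Fintype.card K : ℂ) * S‖ := by simp
    rw [this, havg]
    refine (norm_sum_le _ _).trans ?_
    rw [← nsmul_eq_mul]
    refine sum_le_card_nsmul _ _ _ fun e _ => ?_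
    rw [norm_mul, AddChar.norm_apply, one_mul, Complex.norm_intCast]
    have := hU e
    exact_mod_cast this
  exact le_of_mul_le_mul_left hn (by exact_mod_cast Fintype.card_pos)

open Polynomial Classical in
/-- The finite set of monic polynomials of degree `n`. -/
noncomputable def monics (F : Type) [Field F] [Fintype F] (n : ℕ) : Finset F[X] :=
  univ.image (fun a : Fin n → F => X ^ n + ∑ i : Fin n, C (a i) * X ^ (i : ℕ))

open Polynomial in
lemma monics_aux {F : Type} [Field F] (n : ℕ) (a : Fin n → F) :
    (∑ i : Fin n, C (a i) * X ^ (i : ℕ) : F[X]).degree < (n : WithBot ℕ) := by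
  exact degree_sum_fin_lt a

open Polynomial in
lemma mem_monics {F : Type} [Field F] [Fintype F] {n : ℕ} {P : F[X]} :
    P ∈ monics F n ↔ P.Monic ∧ P.natDegree = n := by
  classical
  rw [monics, mem_image]
  constructor
  · rintro ⟨a, -, rfl⟩
    have h := monics_aux n a
    refine ⟨monic_X_pow_add h, ?_⟩
    rw [natDegree_eq_of_degree_eq_some]
    rw [degree_add_eq_left_of_degree_lt (by rwa [degree_X_pow]), degree_X_pow]
  · rintro ⟨hm, rfl⟩
    refine ⟨fun i => P.coeff i, mem_univ _, ?_⟩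
    conv_rhs => rw [hm.as_sum]
    rw [Finset.sum_range]

open Polynomial in
lemma sum_monics {F : Type} [Field F] [Fintype F] (n : ℕ) (w : F[X] → ℂ) :
    ∑ P ∈ monics F n, w P = ∑ a : Fin n → F, w (X ^ n + ∑ i : Fin n, C (a i) * X ^ (i : ℕ)) := by
  classical
  rw [monics, sum_image]
  intro a _ b _ hab
  have h := add_left_cancel hab
  funext i
  have h2 := congrArg (fun g => coeff g (i : ℕ)) h
  have key : ∀ w : Fin n → F, (∑ i : Fin n, C (w i) * X ^ (i : ℕ)).coeff (i : ℕ) = w i := by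
    intro w
    simp only [finsetSum_coeff, coeff_C_mul, coeff_X_pow]
    rw [Finset.sum_eq_single i]
    · simp
    · intro b _ hb
      rw [if_neg, mul_zero]
      exact fun hh => hb (Fin.ext hh.symm)
    · simp
  simpa only [key] using h2

open Polynomial Classical in
/-- The finite set of monic irreducible polynomials of degree `n`. -/
noncomputable def irrs (F : Type) [Field F] [Fintype F] (n : ℕ) : Finset F[X] :=
  (monics F n).filter Irreducible

open Polynomial Classical in
lemma degree_count {F : Type} [Field F] [Fintype F] {n : ℕ} {P : F[X]} (hP : P ∈ monics F n) :
    (n : ℂ) = ∑ d ∈ Icc 1 n, ∑ Q ∈ irrs F d, ∑ j ∈ Icc 1 n, if Q ^ j ∣ P then (d : ℂ) else 0 := by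
  obtain ⟨hm, hn⟩ := mem_monics.1 hP
  have hP0 : P ≠ 0 := hm.ne_zero
  set s := UniqueFactorizationMonoid.normalizedFactors P with hs
  have hprod : s.prod = P := by
    rw [hs, UniqueFactorizationMonoid.prod_normalizedFactors_eq hP0, hm.normalize_eq_self]
  have hirr : ∀ Q ∈ s, Irreducible Q := fun Q hQ =>
    UniqueFactorizationMonoid.irreducible_of_normalized_factor Q hQ
  have hmon : ∀ Q ∈ s, Q.Monic := by
    intro Q hQ
    have h1 := UniqueFactorizationMonoid.normalize_normalized_factor Q hQ
    rw [← h1]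
    exact monic_normalize (hirr Q hQ).ne_zero
  have hdvd : ∀ Q ∈ s, Q ∣ P := fun Q hQ => UniqueFactorizationMonoid.dvd_of_mem_normalizedFactors hQ
  have hdeg : n = ∑ Q ∈ s.toFinset, s.count Q * Q.natDegree := by
    rw [← hn, ← hprod, natDegree_multiset_prod_of_monic _ hmon, sum_multiset_map_count]
    rfl
  have hcnt : ∀ Q : F[X], Q.Monic → Irreducible Q →
      ((Icc 1 n).filter fun j => Q ^ j ∣ P).card = s.count Q := by
    intro Q hQm hQ
    have hmul := UniqueFactorizationMonoid.emultiplicity_eq_count_normalizedFactors hQ hP0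
    rw [hQm.normalize_eq_self, ← hs] at hmul
    have hiff : ∀ j, Q ^ j ∣ P ↔ j ≤ s.count Q := by
      intro j
      rw [pow_dvd_iff_le_emultiplicity, hmul, Nat.cast_le]
    have hle : s.count Q ≤ n := by
      have h1 := (hiff _).2 le_rfl
      have h2 := natDegree_le_of_dvd h1 hP0
      rw [natDegree_pow, hn] at h2
      have := hQ.natDegree_pos
      nlinarith
    have : ((Icc 1 n).filter fun j => Q ^ j ∣ P) = Icc 1 (s.count Q) := by
      ext j
      simp only [mem_filter, mem_Icc, hiff]
      omega
    rw [this]; simp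
  have hT : ∀ Q ∈ s.toFinset, Q.natDegree ∈ Icc 1 n := by
    intro Q hQ
    rw [Multiset.mem_toFinset] at hQ
    rw [mem_Icc]
    refine ⟨(hirr Q hQ).natDegree_pos, ?_⟩
    rw [← hn]
    exact natDegree_le_of_dvd (hdvd Q hQ) hP0
  have hmid : (n : ℂ) = ∑ Q ∈ s.toFinset, (s.count Q : ℂ) * Q.natDegree := by
    conv_lhs => rw [hdeg]
    push_cast; rfl
  rw [hmid, ← sum_fiberwise_of_maps_to hT]
  refine sum_congr rfl fun d _ => ?_
  have hsub : s.toFinset.filter (fun Q => Q.natDegree = d) ⊆ irrs F d := by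
    intro Q hQ
    rw [mem_filter, Multiset.mem_toFinset] at hQ
    rw [irrs, mem_filter, mem_monics]
    exact ⟨⟨hmon Q hQ.1, hQ.2⟩, hirr Q hQ.1⟩
  have hstep : ∀ Q ∈ irrs F d, ∑ j ∈ Icc 1 n, (if Q ^ j ∣ P then (d : ℂ) else 0) =
      (s.count Q : ℂ) * Q.natDegree := by
    intro Q hQ
    rw [irrs, mem_filter, mem_monics] at hQ
    rw [← hcnt Q hQ.1.1 hQ.2, ← sum_filter, sum_const, nsmul_eq_mul, hQ.1.2]
  rw [sum_congr rfl hstep]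
  refine sum_subset hsub fun Q hQ hQ2 => ?_
  rw [irrs, mem_filter, mem_monics] at hQ
  have : Q ∉ s := by
    intro h
    apply hQ2
    rw [mem_filter, Multiset.mem_toFinset]
    exact ⟨h, hQ.1.2⟩
  rw [Multiset.count_eq_zero_of_notMem this]; simp

open Polynomial Classical in
lemma sum_dvd {F : Type} [Field F] [Fintype F] (w : F[X] → ℂ)
    (hw : ∀ P Q : F[X], P.Monic → Q.Monic → w (P * Q) = w P * w Q) (n : ℕ) (R : F[X]) (hR : R.Monic) :
    ∑ P ∈ monics F n, (if R ∣ P then w P else 0) =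
      if R.natDegree ≤ n then w R * ∑ P ∈ monics F (n - R.natDegree), w P else 0 := by
  split_ifs with h
  · rw [← sum_filter, mul_sum]
    symm
    refine sum_bij (fun P _ => R * P) ?_ ?_ ?_ ?_
    · intro P hP
      rw [mem_monics] at hP
      rw [mem_filter, mem_monics]
      refine ⟨⟨hR.mul hP.1, ?_⟩, dvd_mul_right _ _⟩
      rw [hR.natDegree_mul hP.1, hP.2]; omega
    · intro P _ Q _ h
      exact mul_left_cancel₀ hR.ne_zero h
    · intro P hP
      rw [mem_filter, mem_monics] at hP
      obtain ⟨⟨hm, hn⟩, Q, rfl⟩ := hP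
      have hQ : Q.Monic := hR.of_mul_monic_left hm
      refine ⟨Q, ?_, rfl⟩
      rw [mem_monics]
      refine ⟨hQ, ?_⟩
      rw [hR.natDegree_mul hQ] at hn; omega
    · intro P hP
      rw [mem_monics] at hP
      rw [hw _ _ hR hP.1]
  · refine sum_eq_zero fun P hP => ?_
    rw [mem_monics] at hP
    rw [if_neg]
    intro hd
    have := natDegree_le_of_dvd hd hP.1.ne_zero
    omega

/-- Weighted prime power sum. -/
noncomputable def Lam {F : Type} [Field F] [Fintype F] (w : Polynomial F → ℂ) (k : ℕ) : ℂ :=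
  ∑ p ∈ k.divisorsAntidiagonal, ∑ Q ∈ irrs F p.1, (p.1 : ℂ) * w Q ^ p.2

lemma sum_divAnti (g : ℕ → ℕ → ℂ) (n : ℕ) :
    ∑ d ∈ Icc 1 n, ∑ j ∈ Icc 1 n, (if d * j ≤ n then g d j else 0) =
    ∑ k ∈ Icc 1 n, ∑ p ∈ k.divisorsAntidiagonal, g p.1 p.2 := by
  have h : ∀ k ∈ Icc 1 n, k.divisorsAntidiagonal = (Icc 1 n ×ˢ Icc 1 n).filter (fun p => p.1 * p.2 = k) := by
    intro k hk
    rw [mem_Icc] at hk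
    ext ⟨a, b⟩
    simp only [Nat.mem_divisorsAntidiagonal, mem_filter, mem_product, mem_Icc]
    constructor
    · rintro ⟨rfl, h0⟩
      have ha : 0 < a := Nat.pos_of_ne_zero fun h => h0 (by simp [h])
      have hb : 0 < b := Nat.pos_of_ne_zero fun h => h0 (by simp [h])
      refine ⟨⟨⟨ha, ?_⟩, hb, ?_⟩, rfl⟩ <;> nlinarith
    · rintro ⟨-, rfl⟩
      exact ⟨rfl, by omega⟩
  have h2 : ∑ k ∈ Icc 1 n, ∑ p ∈ k.divisorsAntidiagonal, g p.1 p.2 =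
      ∑ k ∈ Icc 1 n, ∑ p ∈ (Icc 1 n ×ˢ Icc 1 n).filter (fun p => p.1 * p.2 = k), g p.1 p.2 :=
    sum_congr rfl (fun k hk => by rw [h k hk])
  rw [h2]
  simp_rw [sum_filter]
  rw [sum_comm (s := Icc 1 n) (t := Icc 1 n ×ˢ Icc 1 n), ← sum_product']
  refine sum_congr rfl fun p hp => ?_
  rw [mem_product, mem_Icc, mem_Icc] at hp
  rw [sum_ite_eq]
  have : 1 ≤ p.1 * p.2 := Nat.mul_pos hp.1.1 hp.2.1
  simp [mem_Icc, this]

open Polynomial Classical in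
lemma newton {F : Type} [Field F] [Fintype F] (w : F[X] → ℂ) (hw1 : w 1 = 1)
    (hw : ∀ P Q : F[X], P.Monic → Q.Monic → w (P * Q) = w P * w Q) (n : ℕ) :
    (n : ℂ) * ∑ P ∈ monics F n, w P =
      ∑ k ∈ Icc 1 n, Lam w k * ∑ P ∈ monics F (n - k), w P := by
  have hpow : ∀ (Q : F[X]) (j : ℕ), Q.Monic → w (Q ^ j) = w Q ^ j := by
    intro Q j hQ
    induction j with
    | zero => simp [hw1]
    | succ j ih => rw [pow_succ, hw _ _ (hQ.pow j) hQ, ih, pow_succ]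
  have h1 : (n : ℂ) * ∑ P ∈ monics F n, w P =
      ∑ d ∈ Icc 1 n, ∑ j ∈ Icc 1 n, ∑ Q ∈ irrs F d, (d : ℂ) *
        ∑ P ∈ monics F n, (if Q ^ j ∣ P then w P else 0) := by
    rw [mul_sum, sum_congr rfl fun P hP => by rw [degree_count hP, sum_mul]]
    rw [sum_comm]
    refine sum_congr rfl fun d _ => ?_
    simp_rw [sum_mul]
    rw [sum_comm, sum_comm (s := Icc 1 n)]
    refine sum_congr rfl fun Q _ => ?_
    rw [sum_comm]
    refine sum_congr rfl fun j _ => ?_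
    rw [mul_sum]
    refine sum_congr rfl fun P _ => ?_
    split_ifs <;> simp
  have h2 : ∀ d ∈ Icc 1 n, ∀ j ∈ Icc 1 n, ∑ Q ∈ irrs F d, (d : ℂ) *
        ∑ P ∈ monics F n, (if Q ^ j ∣ P then w P else 0) =
      if d * j ≤ n then (∑ Q ∈ irrs F d, (d : ℂ) * w Q ^ j) * ∑ P ∈ monics F (n - d * j), w P else 0 := by
    intro d _ j _
    have : ∀ Q ∈ irrs F d, (d : ℂ) * ∑ P ∈ monics F n, (if Q ^ j ∣ P then w P else 0) =
        if d * j ≤ n then ((d : ℂ) * w Q ^ j) * ∑ P ∈ monics F (n - d * j), w P else 0 := by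
      intro Q hQ
      rw [irrs, mem_filter, mem_monics] at hQ
      rw [sum_dvd w hw n _ (hQ.1.1.pow j), natDegree_pow, hQ.1.2, hpow _ _ hQ.1.1, mul_comm j d]
      split_ifs
      · ring
      · simp
    rw [sum_congr rfl this]
    split_ifs
    · rw [sum_mul]
    · simp
  rw [h1, sum_congr rfl fun d hd => sum_congr rfl fun j hj => h2 d hd j hj]
  rw [sum_divAnti (fun d j => (∑ Q ∈ irrs F d, (d : ℂ) * w Q ^ j) * ∑ P ∈ monics F (n - d * j), w P)]
  refine sum_congr rfl fun k _ => ?_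
  rw [Lam, sum_mul]
  refine sum_congr rfl fun p hp => ?_
  rw [(Nat.mem_divisorsAntidiagonal.1 hp).1]

/-- Companion matrix of `X ^ 2 - c`. -/
def cM {F : Type} [Field F] (c : F) : Matrix (Fin 2) (Fin 2) F := !![0, c; 1, 0]

open Polynomial in
/-- The resultant of `P` with `X ^ 2 - c`, as a determinant. -/
noncomputable def cN {F : Type} [Field F] (c : F) (P : F[X]) : F := (aeval (cM c) P).det

open Polynomial in
lemma cN_mul {F : Type} [Field F] (c : F) (P Q : F[X]) : cN c (P * Q) = cN c P * cN c Q := by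
  simp [cN]

open Polynomial in
lemma cN_lin {F : Type} [Field F] (c a b : F) : cN c (C a * X + C b) = b ^ 2 - c * a ^ 2 := by
  simp [cN, cM, Matrix.det_fin_two, Matrix.mul_apply, Matrix.algebraMap_matrix_apply]
  ring

open Polynomial in
lemma cM_zero {F : Type} [Field F] (c : F) : aeval (cM c) (X ^ 2 - C c) = 0 := by
  ext i j
  fin_cases i <;> fin_cases j <;> simp [cM, pow_two, Matrix.algebraMap_matrix_apply]

open Polynomial in
lemma cN_add {F : Type} [Field F] (c : F) (P Q : F[X]) :
    cN c (P + Q * (X ^ 2 - C c)) = cN c P := by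
  rw [cN, map_add, map_mul, cM_zero, mul_zero, add_zero, cN]

open Polynomial in
lemma lin_decomp {F : Type} [Field F] (c : F) (P : F[X]) :
    ∃ (a b : F) (Q : F[X]), P = (C a * X + C b) + Q * (X ^ 2 - C c) := by
  have hm : (X ^ 2 - C c).Monic := monic_X_pow_sub_C c two_ne_zero
  refine ⟨(P %ₘ (X ^ 2 - C c)).coeff 1, (P %ₘ (X ^ 2 - C c)).coeff 0, P /ₘ (X ^ 2 - C c), ?_⟩
  have hd : (P %ₘ (X ^ 2 - C c)).natDegree ≤ 1 := by
    have := natDegree_modByMonic_lt P hm (by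
      intro h
      have := congrArg natDegree h
      simp at this)
    rw [natDegree_X_pow_sub_C] at this
    omega
  conv_lhs => rw [← modByMonic_add_div P (X ^ 2 - C c)]
  rw [mul_comm]
  congr 1
  exact eq_X_add_C_of_natDegree_le_one hd

open Polynomial in
lemma cN_root {F Ω : Type} [Field F] [Field Ω] [Algebra F Ω] (c : F) (s : Ω)
    (hs : s ^ 2 = algebraMap F Ω c) (P : F[X]) :
    algebraMap F Ω (cN c P) = aeval s P * aeval (-s) P := by
  obtain ⟨a, b, Q, rfl⟩ := lin_decomp c P
  rw [cN_add, cN_lin]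
  simp [hs]
  rw [← hs]; ring

open Polynomial in
lemma det_sq_sub {F : Type} [Field F] {n : Type} [Fintype n] [DecidableEq n] (B : Matrix n n F) (c : F) :
    (B ^ 2 - algebraMap F _ c).det = cN c B.charpoly := by
  obtain ⟨s, hs⟩ := IsAlgClosed.exists_pow_nat_eq (algebraMap F (AlgebraicClosure F) c) (n := 2) two_pos
  apply (algebraMap F (AlgebraicClosure F)).injective
  rw [cN_root c s hs]
  set B' := B.map (algebraMap F (AlgebraicClosure F)) with hB'
  have h1 : ∀ z : AlgebraicClosure F, aeval z B.charpoly = (Matrix.scalar n z - B').det := by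
    intro z
    rw [← Matrix.eval_charpoly, hB', Matrix.charpoly_map, eval_map_algebraMap]
  rw [h1, h1, ← Matrix.det_mul, RingHom.map_det]
  congr 1
  have h2 : (Matrix.scalar n s - B') * (Matrix.scalar n (-s) - B') = B' ^ 2 - Matrix.scalar n (s ^ 2) := by
    have hc : Matrix.scalar n s * B' = B' * Matrix.scalar n s := 
      (Matrix.scalar_commute s (fun r => mul_comm _ _) B').eq
    rw [map_neg, map_pow, sub_mul, mul_sub, mul_sub, mul_neg, mul_neg, hc]
    noncomm_ring
  rw [h2, hs, map_sub, map_pow]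
  congr 1
  ext i j
  simp [Matrix.algebraMap_matrix_apply, Matrix.diagonal_apply]
  split_ifs <;> simp

open Polynomial IntermediateField in
lemma norm_sq_sub {F K : Type} [Field F] [Field K] [Algebra F K] [FiniteDimensional F K] (c : F) (x : K) :
    Algebra.norm F (x ^ 2 - algebraMap F K c) =
      cN c (minpoly F x) ^ Module.finrank F⟮x⟯ K := by
  have hx : IsIntegral F x := Algebra.IsIntegral.isIntegral x
  have h1 : x ^ 2 - algebraMap F K c = algebraMap F⟮x⟯ K ((AdjoinSimple.gen F x) ^ 2 - algebraMap F _ c) := by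
    simp
  rw [← Algebra.norm_norm (S := F⟮x⟯), h1, Algebra.norm_algebraMap, map_pow]
  congr 1
  let pb := adjoin.powerBasis hx
  rw [Algebra.norm_eq_matrix_det pb.basis, map_sub, map_pow, AlgHom.commutes, det_sq_sub]
  have hg : AdjoinSimple.gen F x = pb.gen := (adjoin.powerBasis_gen hx).symm
  rw [hg, charpoly_leftMulMatrix, ← hg, minpoly_gen]

/-- The character on monic polynomials. -/
noncomputable def wt {F : Type} [Field F] [Fintype F] [DecidableEq F] (ψ : AddChar F ℂ) (c : F)
    (P : Polynomial F) : ℂ := ψ (-P.nextCoeff) * (quadraticChar F (cN c P) : ℂ)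

open Polynomial in
lemma wt_mul {F : Type} [Field F] [Fintype F] [DecidableEq F] (ψ : AddChar F ℂ) (c : F)
    (P Q : F[X]) (hP : P.Monic) (hQ : Q.Monic) : wt ψ c (P * Q) = wt ψ c P * wt ψ c Q := by
  rw [wt, wt, wt, hP.nextCoeff_mul hQ, cN_mul, neg_add, AddChar.map_add_eq_mul, map_mul]
  push_cast; ring

lemma wt_one {F : Type} [Field F] [Fintype F] [DecidableEq F] (ψ : AddChar F ℂ) (c : F) :
    wt ψ c 1 = 1 := by
  simp [wt, cN, Polynomial.nextCoeff]

open Polynomial IntermediateField in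
lemma wt_minpoly {F K : Type} [Field F] [Fintype F] [DecidableEq F] [Field K] [Algebra F K]
    [FiniteDimensional F K] (ψ : AddChar F ℂ) (c : F) (x : K) (d j : ℕ)
    (hd : (minpoly F x).natDegree = d) (hk : d * j = Module.finrank F K) :
    ψ (Algebra.trace F K x) * (quadraticChar F (Algebra.norm F (x ^ 2 - algebraMap F K c)) : ℂ) =
      wt ψ c (minpoly F x) ^ j := by
  have hx : IsIntegral F x := Algebra.IsIntegral.isIntegral x
  have hj : Module.finrank F⟮x⟯ K = j := by
    have h1 := Module.finrank_mul_finrank F F⟮x⟯ K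
    rw [adjoin.finrank hx, hd, ← hk] at h1
    have : 0 < d := by rw [← hd]; exact minpoly.natDegree_pos hx
    exact Nat.eq_of_mul_eq_mul_left this h1
  rw [norm_sq_sub, trace_eq_finrank_mul_minpoly_nextCoeff, hj, wt, mul_pow, map_pow, ← nsmul_eq_mul,
    AddChar.map_nsmul_eq_pow]
  push_cast; rfl

open Polynomial Classical in
lemma irr_fibre {F K : Type} [Field F] [Fintype F] [Field K] [Fintype K] [Algebra F K]
    (d : ℕ) (hd : d ∣ Module.finrank F K) (Q : F[X]) (hQ : Q ∈ irrs F d) :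
    ((univ : Finset K).filter (fun x => minpoly F x = Q)).card = d := by
  rw [irrs, mem_filter, mem_monics] at hQ
  obtain ⟨⟨hm, hdeg⟩, hirr⟩ := hQ
  have h1 : Q ∣ X ^ (Nat.card F) ^ (Module.finrank F K) - X := by
    rw [← hirr.natDegree_dvd_iff_dvd_X_pow_card_pow_sub_X, hdeg]; exact hd
  have hcard : (Nat.card F) ^ (Module.finrank F K) = Fintype.card K := by
    rw [Nat.card_eq_fintype_card]; exact (Module.card_eq_pow_finrank).symm
  rw [hcard] at h1
  have hsplit : (Q.map (algebraMap F K)).Splits := by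
    refine Splits.of_dvd (FiniteField.isSplittingField_sub K F).splits ?_ (Polynomial.map_dvd _ h1)
    rw [Polynomial.map_ne_zero_iff (algebraMap F K).injective]
    exact FiniteField.X_pow_card_sub_X_ne_zero F (Fintype.one_lt_card (α := K))
  have hsep : Q.Separable := PerfectField.separable_of_irreducible hirr
  have h2 := card_rootSet_eq_natDegree hsep hsplit
  rw [hdeg] at h2
  rw [← h2, ← Set.toFinset_card]
  congr 1
  ext x
  simp only [mem_filter, mem_univ, true_and, Set.mem_toFinset, mem_rootSet]
  constructor
  · rintro rfl
    exact ⟨hm.ne_zero, minpoly.aeval F x⟩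
  · rintro ⟨-, h⟩
    exact (minpoly.eq_of_irreducible_of_monic hirr h hm).symm

open Polynomial in
lemma Lam_eq {F K : Type} [Field F] [Fintype F] [DecidableEq F] [Field K] [Fintype K] [Algebra F K]
    (ψ : AddChar F ℂ) (c : F) :
    Lam (wt ψ c) (Module.finrank F K) = ∑ x : K,
      ψ (Algebra.trace F K x) * (quadraticChar F (Algebra.norm F (x ^ 2 - algebraMap F K c)) : ℂ) := by
  classical
  have hk : Module.finrank F K ≠ 0 := Module.finrank_pos.ne'
  rw [Lam]
  have hmap : ∀ x ∈ (univ : Finset K),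
      ((minpoly F x).natDegree, Module.finrank F K / (minpoly F x).natDegree) ∈ 
        (Module.finrank F K).divisorsAntidiagonal := by
    intro x _
    rw [Nat.mem_divisorsAntidiagonal]
    exact ⟨Nat.mul_div_cancel' (minpoly.degree_dvd (Algebra.IsIntegral.isIntegral x)), hk⟩
  rw [← sum_fiberwise_of_maps_to hmap]
  refine sum_congr rfl fun p hp => ?_
  obtain ⟨hp1, hp2⟩ := Nat.mem_divisorsAntidiagonal.1 hp
  have hmap2 : ∀ x ∈ (univ : Finset K).filter (fun x => 
      ((minpoly F x).natDegree, Module.finrank F K / (minpoly F x).natDegree) = p), 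
      minpoly F x ∈ irrs F p.1 := by
    intro x hx
    rw [mem_filter] at hx
    have hi : IsIntegral F x := Algebra.IsIntegral.isIntegral x
    rw [irrs, mem_filter, mem_monics]
    exact ⟨⟨minpoly.monic hi, congrArg Prod.fst hx.2⟩, minpoly.irreducible hi⟩
  rw [← sum_fiberwise_of_maps_to hmap2]
  refine sum_congr rfl fun Q hQ => ?_
  have hQ' := hQ
  rw [irrs, mem_filter, mem_monics] at hQ'
  have hp0 : 0 < p.1 := Nat.pos_of_ne_zero fun h => hp2 (by rw [← hp1, h, zero_mul])
  have hfil : ((univ : Finset K).filter (fun x => 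
      ((minpoly F x).natDegree, Module.finrank F K / (minpoly F x).natDegree) = p)).filter
        (fun x => minpoly F x = Q) = (univ : Finset K).filter (fun x => minpoly F x = Q) := by
    ext x
    simp only [mem_filter, mem_univ, true_and, and_iff_right_iff_imp]
    rintro rfl
    rw [hQ'.1.2, ← hp1, Nat.mul_div_cancel_left _ hp0]
  rw [hfil]
  have hc : ((univ : Finset K).filter (fun x => minpoly F x = Q)).card = p.1 := by
    convert irr_fibre (K := K) p.1 ⟨p.2, hp1.symm⟩ Q hQ
  have : ∀ x ∈ (univ : Finset K).filter (fun x => minpoly F x = Q), 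
      ψ (Algebra.trace F K x) * (quadraticChar F (Algebra.norm F (x ^ 2 - algebraMap F K c)) : ℂ) =
      wt ψ c Q ^ p.2 := by
    intro x hx
    rw [mem_filter] at hx
    rw [wt_minpoly ψ c x p.1 p.2 (by rw [hx.2, hQ'.1.2]) hp1, hx.2]
  rw [sum_congr rfl this, sum_const, hc, nsmul_eq_mul]

lemma two_ne_of_ringChar {F : Type} [Field F] (h : ringChar F ≠ 2) : (2 : F) ≠ 0 :=
  Ring.two_ne_zero h

lemma sq_ind {F : Type} [Field F] [Fintype F] [DecidableEq F] (h : ringChar F ≠ 2) (a : F) :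
    (∑ v : F, if v ^ 2 = a then (1 : ℤ) else 0) = quadraticChar F a + 1 := by
  rw [← quadraticChar_card_sqrts h a, ← sum_filter, sum_const, nsmul_eq_mul, mul_one]
  congr 2
  ext x
  simp

/-- Hyperbola change of variables. -/
def hypEquiv {F : Type} [Field F] (h : (2 : F) ≠ 0) : F × F ≃ F × F where
  toFun p := (p.1 - p.2, p.1 + p.2)
  invFun p := ((p.1 + p.2) / 2, (p.2 - p.1) / 2)
  left_inv p := by ext <;> simp <;> field_simp <;> ring
  right_inv p := by ext <;> simp <;> field_simp <;> ring

lemma hyp_sum {F : Type} [Field F] [Fintype F] [DecidableEq F] (a e : F) (he : e ≠ 0) :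
    (∑ b : F, if a * b = e then (1 : ℤ) else 0) = if a = 0 then 0 else 1 := by
  by_cases ha : a = 0
  · simp [ha, he.symm]
  · rw [if_neg ha, Finset.sum_eq_single (e / a)]
    · rw [if_pos (by field_simp)]
    · intro b _ hb
      rw [if_neg]
      rintro rfl
      exact hb (by field_simp)
    · simp

lemma J_sum {F : Type} [Field F] [Fintype F] [DecidableEq F] (h : ringChar F ≠ 2) (e : F) :
    (∑ y : F, quadraticChar F (y ^ 2 - e)) = if e = 0 then (Fintype.card F : ℤ) - 1 else -1 := by
  split_ifs with he
  · subst he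
    have : ∀ y : F, quadraticChar F (y ^ 2 - 0) = 1 - (if y = 0 then 1 else 0) := by
      intro y
      rw [sub_zero]
      split_ifs with hy
      · simp [hy]
      · rw [quadraticChar_sq_one' hy]; simp
    simp only [this, sum_sub_distrib]
    simp
  · have h1 : ∑ y : F, (quadraticChar F (y ^ 2 - e) + 1) = (Fintype.card F : ℤ) - 1 := by
      simp_rw [← sq_ind h]
      rw [← Fintype.sum_prod_type']
      have h2 : ∀ p : F × F, (if p.2 ^ 2 = p.1 ^ 2 - e then (1 : ℤ) else 0) =
          (fun p : F × F => if p.1 * p.2 = e then (1 : ℤ) else 0) (hypEquiv (two_ne_of_ringChar h) p) := by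
        intro p
        simp only [hypEquiv, Equiv.coe_fn_mk]
        congr 1
        apply propext
        constructor <;> intro hh <;> linear_combination -hh
      rw [sum_congr rfl fun p _ => h2 p]
      rw [Equiv.sum_comp (hypEquiv (two_ne_of_ringChar h)) 
        (fun p : F × F => if p.1 * p.2 = e then (1 : ℤ) else 0), Fintype.sum_prod_type]
      simp only [hyp_sum _ e he]
      have : ∀ a : F, (if a = 0 then (0 : ℤ) else 1) = 1 - if a = 0 then 1 else 0 := by
        intro a; split_ifs <;> simp
      simp only [this, sum_sub_distrib]
      simp
    rw [sum_add_distrib] at h1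
    simp only [sum_const, card_univ, nsmul_eq_mul, mul_one] at h1
    linarith

section Lvals
open Polynomial

lemma L_zero {F : Type} [Field F] [Fintype F] [DecidableEq F] (ψ : AddChar F ℂ) (c : F) :
    ∑ P ∈ monics F 0, wt ψ c P = 1 := by
  rw [sum_monics]
  simp [wt_one]

lemma form_mem {F : Type} [Field F] [Fintype F] (n : ℕ) (a : Fin n → F) :
    (X ^ n + ∑ i : Fin n, C (a i) * X ^ (i : ℕ) : F[X]) ∈ monics F n := by
  classical
  rw [monics, mem_image]
  exact ⟨_, mem_univ _, rfl⟩

lemma nextCoeff_monics {F : Type} [Field F] [Fintype F] {n : ℕ} {P : F[X]} (hP : P ∈ monics F (n + 1)) :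
    P.nextCoeff = P.coeff n := by
  rw [mem_monics] at hP
  rw [nextCoeff_of_natDegree_pos (by omega), hP.2]
  simp

lemma L_one {F : Type} [Field F] [Fintype F] [DecidableEq F] (ψ : AddChar F ℂ) (c : F) :
    ∑ P ∈ monics F 1, wt ψ c P = ∑ u : F, ψ u * (quadraticChar F (u ^ 2 - c) : ℂ) := by
  rw [sum_monics, ← Equiv.sum_comp (Equiv.neg F), ← Equiv.sum_comp (Equiv.funUnique (Fin 1) F)]
  refine sum_congr rfl fun a _ => ?_
  have h : (X ^ 1 + ∑ i : Fin 1, C (a i) * X ^ (i : ℕ) : F[X]) = C 1 * X + C (a 0) := by simp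
  rw [h, wt, cN_lin]
  simp only [map_one, one_mul, nextCoeff_X_add_C]
  simp

lemma L_two {F : Type} [Field F] [Fintype F] [DecidableEq F] (hchar : ringChar F ≠ 2)
    (ψ : AddChar F ℂ) (hψ : ψ ≠ 1) (c : F) (hc : c ≠ 0) :
    ∑ P ∈ monics F 2, wt ψ c P = Fintype.card F := by
  rw [sum_monics, ← Equiv.sum_comp (finTwoArrowEquiv F).symm, Fintype.sum_prod_type_right]
  have h : ∀ b a : F, wt ψ c (X ^ 2 + ∑ i : Fin 2, C ((finTwoArrowEquiv F).symm (a, b) i) * X ^ (i : ℕ)) =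
      ψ (-b) * (quadraticChar F ((a + c) ^ 2 - c * b ^ 2) : ℂ) := by
    intro b a
    have hP : (X ^ 2 + ∑ i : Fin 2, C ((finTwoArrowEquiv F).symm (a, b) i) * X ^ (i : ℕ) : F[X]) ∈ monics F 2 :=
      form_mem 2 _
    rw [wt, nextCoeff_monics hP]
    have h1 : (X ^ 2 + ∑ i : Fin 2, C ((finTwoArrowEquiv F).symm (a, b) i) * X ^ (i : ℕ) : F[X]) =
      (C b * X + C (a + c)) + 1 * (X ^ 2 - C c) := by
      simp [Fin.sum_univ_two]
      ring
    rw [h1, cN_add, cN_lin]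
    congr 2
    simp [coeff_C, coeff_X_pow]
  simp_rw [h, ← mul_sum]
  have h2 : ∀ b : F, (∑ a : F, (quadraticChar F ((a + c) ^ 2 - c * b ^ 2) : ℂ)) =
      (if b = 0 then (Fintype.card F : ℂ) else 0) - 1 := by
    intro b
    have := J_sum hchar (c * b ^ 2)
    rw [← Equiv.sum_comp (Equiv.addRight c)] at this
    simp only [Equiv.coe_addRight] at this
    rw [← Int.cast_sum, this]
    by_cases hb : b = 0
    · simp [hb]
    · simp [hb, hc]
  simp_rw [h2, mul_sub, sum_sub_distrib]
  have h3 : ∑ b : F, ψ (-b) * 1 = 0 := by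
    simp only [mul_one]
    refine (Equiv.sum_comp (Equiv.neg F) (fun b => ψ b)).trans ?_
    exact AddChar.sum_eq_zero_of_ne_one hψ
  rw [h3]
  simp

lemma L_big {F : Type} [Field F] [Fintype F] [DecidableEq F]
    (ψ : AddChar F ℂ) (hψ : ψ ≠ 1) (c : F) (n : ℕ) :
    ∑ P ∈ monics F (n + 3), wt ψ c P = 0 := by
  obtain ⟨a, ha⟩ : ∃ a, ψ (-a) ≠ 1 := by
    obtain ⟨a, ha⟩ := AddChar.ne_one_iff.1 hψ
    exact ⟨-a, by simpa using ha⟩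
  set R : F[X] := C a * X ^ n * (X ^ 2 - C c) with hR
  have hRd : R.natDegree < n + 3 := by
    have : R.natDegree ≤ n + 2 := by
      rw [hR]; compute_degree
    omega
  have hRc : R.coeff (n + 2) = a := by
    have : R = C a * X ^ (n + 2) - C (a * c) * X ^ n := by
      rw [hR, C_mul]; ring
    rw [this, coeff_sub, coeff_C_mul, coeff_C_mul, coeff_X_pow, coeff_X_pow]
    simp
  have hmem : ∀ P ∈ monics F (n + 3), ∀ T : F[X], T.natDegree < n + 3 → P + T ∈ monics F (n + 3) := by
    intro P hP T hT
    rw [mem_monics] at hP ⊢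
    have : T.degree < P.degree := by
      rw [degree_eq_natDegree hP.1.ne_zero, hP.2]
      exact lt_of_le_of_lt degree_le_natDegree (by exact_mod_cast hT)
    exact ⟨hP.1.add_of_left this, by rw [natDegree_add_eq_left_of_degree_lt this, hP.2]⟩
  have key : ∑ P ∈ monics F (n + 3), wt ψ c P = ψ (-a) * ∑ P ∈ monics F (n + 3), wt ψ c P := by
    rw [mul_sum]
    symm
    refine sum_bij (fun P _ => P + R) (fun P hP => hmem P hP R hRd) ?_ ?_ ?_
    · intro P _ Q _ h
      exact add_right_cancel h
    · intro P hP
      refine ⟨P - R, ?_, by ring⟩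
      rw [sub_eq_add_neg]
      exact hmem P hP _ (by rwa [natDegree_neg])
    · intro P hP
      rw [wt, wt, nextCoeff_monics (hmem P hP R hRd), nextCoeff_monics hP, coeff_add, hRc, hR, cN_add,
        neg_add, AddChar.map_add_eq_mul]
      ring
  by_contra hne
  apply ha
  have := mul_right_cancel₀ hne ((one_mul _).trans key)
  exact this.symm

end Lvals

lemma newton_three {F : Type} [Field F] [Fintype F] [DecidableEq F] (hchar : ringChar F ≠ 2)
    (ψ : AddChar F ℂ) (hψ : ψ ≠ 1) (c : F) (hc : c ≠ 0) (α β : ℂ)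
    (h1 : α + β = -∑ u : F, ψ u * (quadraticChar F (u ^ 2 - c) : ℂ))
    (h2 : α * β = Fintype.card F) (n : ℕ) :
    Lam (wt ψ c) (n + 1) = -(α ^ (n + 1) + β ^ (n + 1)) := by
  have hN := newton (wt ψ c) (wt_one ψ c) (wt_mul ψ c)
  induction n using Nat.strong_induction_on with
  | _ n ih =>
    match n, ih with
    | 0, _ =>
      have := hN 1
      simp [L_zero, L_one, -quadraticChar_apply] at this
      simp [h1, ← this, -quadraticChar_apply]
    | 1, ih =>
      have := hN 2
      rw [L_two hchar ψ hψ c hc, sum_Icc_succ_top (by norm_num), sum_Icc_succ_top (by norm_num)] at this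
      simp [L_zero, L_one, -quadraticChar_apply] at this
      have h0 := ih 0 (by norm_num)
      simp only [zero_add] at h0
      rw [h0] at this
      rw [← neg_eq_iff_eq_neg] at h1
      rw [← h1, ← h2] at this
      norm_num
      linear_combination -this
    | m + 2, ih =>
      have := hN (m + 3)
      rw [L_big ψ hψ, sum_Icc_succ_top (by omega), sum_Icc_succ_top (by omega),
        sum_Icc_succ_top (by omega)] at this
      have hz : ∑ k ∈ Icc 1 m, Lam (wt ψ c) k * ∑ P ∈ monics F (m + 3 - k), wt ψ c P = 0 := by
        refine sum_eq_zero fun k hk => ?_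
        rw [mem_Icc] at hk
        obtain ⟨j, rfl⟩ : ∃ j, m = k + j := ⟨m - k, by omega⟩
        rw [show k + j + 3 - k = j + 3 by omega, L_big ψ hψ, mul_zero]
      rw [hz, show m + 3 - (m + 1) = 2 by omega, show m + 3 - (m + 1 + 1) = 1 by omega,
        show m + 3 - (m + 2 + 1) = 0 by omega, L_zero, L_one, L_two hchar ψ hψ c hc,
        ih m (by omega), ih (m + 1) (by omega)] at this
      rw [← neg_eq_iff_eq_neg] at h1
      rw [← h1, ← h2] at this
      rw [show m + 2 + 1 = m + 3 from rfl] at *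
      linear_combination -this

lemma root_bound (q : ℝ) (hq : 0 < q) (α β : ℂ) (h2 : α * β = q) (C : ℝ) (k0 : ℕ)
    (h : ∀ k ≥ k0, ‖α ^ (2 * k) + β ^ (2 * k)‖ ≤ C * q ^ k) : ‖α‖ ^ 2 ≤ q := by
  by_contra hlt
  push Not at hlt
  have hn : ‖α‖ ^ 2 * ‖β‖ ^ 2 = q ^ 2 := by
    rw [← mul_pow, ← norm_mul, h2]; simp
  have hβ : ‖β‖ ^ 2 ≤ q := by
    by_contra hb
    push Not at hb
    nlinarith
  have hr : 1 < ‖α‖ ^ 2 / q := by rwa [one_lt_div hq]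
  obtain ⟨k, hk1, hk2⟩ := ((Filter.tendsto_atTop.1 (tendsto_pow_atTop_atTop_of_one_lt hr) (C + 2)).and
    (Filter.eventually_ge_atTop k0)).exists
  have h3 := h k hk2
  have h4 : ‖α ^ (2 * k)‖ ≤ ‖α ^ (2 * k) + β ^ (2 * k)‖ + ‖β ^ (2 * k)‖ := by
    have := norm_sub_le (α ^ (2 * k) + β ^ (2 * k)) (β ^ (2 * k))
    simpa using this
  rw [norm_pow α, norm_pow β, pow_mul ‖α‖, pow_mul ‖β‖] at h4
  have h5 : (‖β‖ ^ 2) ^ k ≤ q ^ k := pow_le_pow_left₀ (by positivity) hβ k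
  rw [div_pow, le_div_iff₀ (by positivity)] at hk1
  have : 0 < q ^ k := by positivity
  nlinarith

lemma weil {F : Type} [Field F] [Fintype F] [DecidableEq F] (hchar : ringChar F ≠ 2)
    (ψ : AddChar F ℂ) (hψ : ψ ≠ 1) (c : F) (hc : c ≠ 0) :
    ‖∑ u : F, ψ u * (quadraticChar F (u ^ 2 - c) : ℂ)‖ ≤ 2 * Real.sqrt (Fintype.card F) := by
  set S := ∑ u : F, ψ u * (quadraticChar F (u ^ 2 - c) : ℂ) with hS
  obtain ⟨α, hα⟩ : ∃ α : ℂ, α * (-S - α) = Fintype.card F := by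
    obtain ⟨s, hs⟩ := IsAlgClosed.exists_pow_nat_eq (S ^ 2 - 4 * (Fintype.card F : ℂ)) (n := 2) two_pos
    exact ⟨(-S + s) / 2, by linear_combination -hs / 4⟩
  set β := -S - α with hβ
  have h1 : α + β = -S := by rw [hβ]; ring
  have hq3 : 3 ≤ Fintype.card F := by
    have := Fintype.one_lt_card (α := F)
    rcases Nat.lt_or_ge 2 (Fintype.card F) with h | h
    · exact h
    · exfalso
      have h2 : Fintype.card F = 2 := by omega
      have hodd := FiniteField.odd_card_of_char_ne_two hchar
      omega
  have hb : ∀ k ≥ 4, ‖α ^ (2 * k) + β ^ (2 * k)‖ ≤ (6 * (Fintype.card F : ℝ)) * (Fintype.card F : ℝ) ^ k := by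
    intro k hk
    have hp : Fact (ringChar F).Prime := ⟨CharP.char_is_prime F _⟩
    have : NeZero (2 * k) := ⟨by omega⟩
    let K := FiniteField.Extension F (ringChar F) (2 * k)
    have hfin : Finite K := inferInstance
    let _ : Fintype K := Fintype.ofFinite K
    have hrank : Module.finrank F K = 2 * k := FiniteField.finrank_extension F (ringChar F) (2 * k)
    have hbig : (2 * Fintype.card F + 2) ^ 2 < Fintype.card F ^ k := by
      calc (2 * Fintype.card F + 2) ^ 2 < (3 * Fintype.card F) ^ 2 :=
            Nat.pow_lt_pow_left (by omega) (by norm_num)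
        _ ≤ (Fintype.card F * Fintype.card F) ^ 2 := Nat.pow_le_pow_left (Nat.mul_le_mul_right _ hq3) 2
        _ = Fintype.card F ^ 4 := by ring
        _ ≤ _ := Nat.pow_le_pow_right (by omega) hk
    have h := charsum_ext (K := K) hchar k hrank hbig ψ c hc
    rw [← Lam_eq, hrank] at h
    have h3 := newton_three hchar ψ hψ c hc α β h1 hα (2 * k - 1)
    rw [show 2 * k - 1 + 1 = 2 * k by omega] at h3
    rw [h3, norm_neg] at h
    exact h
  have hq0 : (0 : ℝ) < Fintype.card F := by exact_mod_cast (by omega : 0 < Fintype.card F)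
  have ha := root_bound (Fintype.card F) hq0 α β (by rw [hα]; simp) _ 4 hb
  have hb2 := root_bound (Fintype.card F) hq0 β α (by rw [mul_comm, hα]; simp) _ 4
    (fun k hk => by rw [add_comm]; exact hb k hk)
  have h5 : ‖S‖ ≤ ‖α‖ + ‖β‖ := by
    rw [← norm_neg, ← h1]; exact norm_add_le _ _
  have h6 := Real.le_sqrt_of_sq_le ha
  have h7 := Real.le_sqrt_of_sq_le hb2
  linarith

lemma sum_V {F M : Type} [Fintype F] [AddCommMonoid M] (h : F → F → M) :
    ∑ x : Fin 2 → F, h (x 0) (x 1) = ∑ a, ∑ b, h a b := by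
  rw [← Fintype.sum_prod_type', ← Equiv.sum_comp (finTwoArrowEquiv F)]
  rfl

lemma orth {F : Type} [Field F] [Fintype F] [DecidableEq F] (ψ : AddChar F ℂ) (hψ : ψ.IsPrimitive)
    (z : Fin 2 → F) :
    ∑ m : Fin 2 → F, ψ (m 0 * z 0 + m 1 * z 1) = if z = 0 then (Fintype.card F : ℂ) ^ 2 else 0 := by
  rw [sum_V (fun a b => ψ (a * z 0 + b * z 1))]
  simp_rw [AddChar.map_add_eq_mul, ← mul_sum, ← sum_mul, AddChar.sum_mulShift _ hψ]
  by_cases h0 : z 0 = 0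
  · by_cases h1 : z 1 = 0
    · have : z = 0 := by ext i; fin_cases i <;> simp [h0, h1]
      simp [h0, h1, this]; ring
    · have : z ≠ 0 := fun h => h1 (by simp [h])
      simp [h1, this]
  · have : z ≠ 0 := fun h => h0 (by simp [h])
    simp [h0, this]

/-- Fourier transform on the plane. -/
noncomputable def fh {F : Type} [Field F] [Fintype F] (ψ : AddChar F ℂ) (u : (Fin 2 → F) → ℝ)
    (m : Fin 2 → F) : ℂ := ∑ x, (u x : ℂ) * ψ (m 0 * x 0 + m 1 * x 1)

lemma plancherel {F : Type} [Field F] [Fintype F] [DecidableEq F] (ψ : AddChar F ℂ) (hψ : ψ.IsPrimitive)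
    (u : (Fin 2 → F) → ℝ) :
    ∑ m, ‖fh ψ u m‖ ^ 2 = (Fintype.card F : ℝ) ^ 2 * ∑ x, u x ^ 2 := by
  have h : ∀ m, ((‖fh ψ u m‖ ^ 2 : ℝ) : ℂ) = ∑ x, ∑ y, (u x : ℂ) * (u y : ℂ) *
      ψ (m 0 * (x - y) 0 + m 1 * (x - y) 1) := by
    intro m
    push_cast
    rw [← Complex.mul_conj', fh, map_sum, sum_mul_sum]
    refine sum_congr rfl fun x _ => sum_congr rfl fun y _ => ?_
    rw [map_mul, ← AddChar.map_neg_eq_conj, Complex.conj_ofReal]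
    have : m 0 * (x - y) 0 + m 1 * (x - y) 1 = (m 0 * x 0 + m 1 * x 1) + -(m 0 * y 0 + m 1 * y 1) := by
      simp only [Pi.sub_apply]; ring
    rw [this, AddChar.map_add_eq_mul _ (m 0 * x 0 + m 1 * x 1)]
    ring
  have h2 : ((∑ m, ‖fh ψ u m‖ ^ 2 : ℝ) : ℂ) = (((Fintype.card F : ℝ) ^ 2 * ∑ x, u x ^ 2 : ℝ) : ℂ) := by
    rw [Complex.ofReal_sum, sum_congr rfl fun m _ => h m, sum_comm]
    push_cast
    rw [mul_sum]
    refine sum_congr rfl fun x _ => ?_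
    rw [sum_comm]
    simp_rw [← mul_sum, orth ψ hψ]
    rw [Finset.sum_eq_single x]
    · simp; ring
    · intro y _ hy
      rw [if_neg (sub_ne_zero.2 hy.symm), mul_zero]
    · simp
  exact_mod_cast h2

lemma fh_conv {F : Type} [Field F] [Fintype F] (ψ : AddChar F ℂ)
    (e v : (Fin 2 → F) → ℝ) (m : Fin 2 → F) :
    fh ψ (fun x => ∑ z, e (x - z) * v z) m = fh ψ e m * fh ψ v m := by
  rw [fh, fh, fh, mul_sum]
  push_cast
  simp_rw [sum_mul]
  rw [sum_comm]
  refine sum_congr rfl fun z _ => ?_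
  rw [← Equiv.sum_comp (Equiv.addRight z)]
  refine sum_congr rfl fun x _ => ?_
  have : m 0 * (x + z) 0 + m 1 * (x + z) 1 = (m 0 * x 0 + m 1 * x 1) + (m 0 * z 0 + m 1 * z 1) := by
    simp only [Pi.add_apply]; ring
  simp only [Equiv.coe_addRight, add_sub_cancel_right]
  rw [this, AddChar.map_add_eq_mul]
  ring

lemma op_bound {F : Type} [Field F] [Fintype F] [DecidableEq F] (ψ : AddChar F ℂ) (hψ : ψ.IsPrimitive)
    (e : (Fin 2 → F) → ℝ) (B : ℝ) (hB : ∀ m, ‖fh ψ e m‖ ≤ B) (v : (Fin 2 → F) → ℝ) :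
    ∑ x, (∑ z, e (x - z) * v z) ^ 2 ≤ B ^ 2 * ∑ z, v z ^ 2 := by
  have hq : (0 : ℝ) < (Fintype.card F : ℝ) ^ 2 := by
    have := Fintype.card_pos (α := F)
    positivity
  have h1 := plancherel ψ hψ (fun x => ∑ z, e (x - z) * v z)
  have h2 := plancherel ψ hψ v
  have h3 : ∑ m, ‖fh ψ (fun x => ∑ z, e (x - z) * v z) m‖ ^ 2 ≤ B ^ 2 * ∑ m, ‖fh ψ v m‖ ^ 2 := by
    rw [mul_sum]
    refine sum_le_sum fun m _ => ?_
    rw [fh_conv, norm_mul, mul_pow]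
    gcongr
    exact hB m
  rw [h1, h2] at h3
  refine le_of_mul_le_mul_left ?_ hq
  linarith

/-- rotation change of variables -/
def rotEquiv {F : Type} [Field F] (a b : F) (h : a ^ 2 + b ^ 2 ≠ 0) : F × F ≃ F × F where
  toFun p := (a * p.1 + b * p.2, -b * p.1 + a * p.2)
  invFun p := ((a * p.1 - b * p.2) / (a ^ 2 + b ^ 2), (b * p.1 + a * p.2) / (a ^ 2 + b ^ 2))
  left_inv p := by ext <;> simp <;> field_simp <;> ring
  right_inv p := by ext <;> simp <;> field_simp <;> ring

/-- isotropic change of variables -/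
def isoEquiv {F : Type} [Field F] (i : F) (h2 : (2 : F) ≠ 0) (hi : i ≠ 0) : F × F ≃ F × F where
  toFun p := (p.1 + i * p.2, p.1 - i * p.2)
  invFun p := ((p.1 + p.2) / 2, (p.1 - p.2) / (2 * i))
  left_inv p := by ext <;> simp <;> field_simp <;> ring
  right_inv p := by ext <;> simp <;> field_simp <;> ring

lemma sq_ind_C {F : Type} [Field F] [Fintype F] [DecidableEq F] (h : ringChar F ≠ 2) (a : F) :
    (∑ v : F, if v ^ 2 = a then (1 : ℂ) else 0) = (quadraticChar F a : ℂ) + 1 := by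
  have := congrArg (Int.cast : ℤ → ℂ) (sq_ind h a)
  push_cast at this
  exact this

lemma eta_flip {F : Type} [Field F] [Fintype F] [DecidableEq F] (a b : F) :
    quadraticChar F (a - b) = quadraticChar F (-1) * quadraticChar F (b - a) := by
  rw [← map_mul]; congr 1; ring

lemma circle_nonzero {F : Type} [Field F] [Fintype F] [DecidableEq F] (hchar : ringChar F ≠ 2)
    (ψ : AddChar F ℂ) (hψ : ψ ≠ 1) (t : F) (ht : t ≠ 0) (a b : F) (hn : a ^ 2 + b ^ 2 ≠ 0) :
    ‖∑ x : F, ∑ y : F, (if x ^ 2 + y ^ 2 = t then (1 : ℂ) else 0) * ψ (a * x + b * y)‖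
      ≤ 2 * Real.sqrt (Fintype.card F) := by
  have h1 : ∑ x : F, ∑ y : F, (if x ^ 2 + y ^ 2 = t then (1 : ℂ) else 0) * ψ (a * x + b * y) =
      ∑ u : F, ∑ v : F, (if v ^ 2 = (a ^ 2 + b ^ 2) * t - u ^ 2 then (1 : ℂ) else 0) * ψ u := by
    rw [← Fintype.sum_prod_type', ← Fintype.sum_prod_type']
    symm
    rw [← Equiv.sum_comp (rotEquiv a b hn)]
    symm
    refine sum_congr rfl fun p _ => ?_
    simp only [rotEquiv, Equiv.coe_fn_mk]
    congr 2
    apply propext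
    constructor
    · intro h; rw [← h]; ring
    · intro h
      apply mul_left_cancel₀ hn
      linear_combination h
  rw [h1]
  simp_rw [← sum_mul, sq_ind_C hchar]
  rw [sum_congr rfl fun u _ => add_mul _ _ (ψ u)]
  simp_rw [one_mul, sum_add_distrib]
  rw [AddChar.sum_eq_zero_of_ne_one hψ, add_zero]
  have h2 : ∑ u : F, (quadraticChar F ((a ^ 2 + b ^ 2) * t - u ^ 2) : ℂ) * ψ u =
      (quadraticChar F (-1) : ℂ) * ∑ u : F, ψ u * (quadraticChar F (u ^ 2 - (a ^ 2 + b ^ 2) * t) : ℂ) := by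
    rw [mul_sum]
    refine sum_congr rfl fun u _ => ?_
    rw [eta_flip]; push_cast; ring
  rw [h2, norm_mul]
  have h3 : ‖(quadraticChar F (-1) : ℂ)‖ = 1 := by
    rcases quadraticChar_dichotomy (F := F) (a := -1) (by simp) with h | h <;> rw [h] <;> simp
  rw [h3, one_mul]
  exact weil hchar ψ hψ _ (mul_ne_zero hn ht)

lemma circle_iso {F : Type} [Field F] [Fintype F] [DecidableEq F] (hchar : ringChar F ≠ 2)
    (ψ : AddChar F ℂ) (hψ : ψ.IsPrimitive) (t : F) (ht : t ≠ 0) (a b : F) (hn : a ^ 2 + b ^ 2 = 0)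
    (ha : a ≠ 0) :
    ∑ x : F, ∑ y : F, (if x ^ 2 + y ^ 2 = t then (1 : ℂ) else 0) * ψ (a * x + b * y) = -1 := by
  have hb : b ≠ 0 := by
    rintro rfl
    simp at hn
    exact ha hn
  have hi : b / a ≠ 0 := div_ne_zero hb ha
  have hi2 : (b / a) ^ 2 = -1 := by
    rw [div_pow, div_eq_iff (pow_ne_zero 2 ha)]; linear_combination hn
  have h1 : ∑ x : F, ∑ y : F, (if x ^ 2 + y ^ 2 = t then (1 : ℂ) else 0) * ψ (a * x + b * y) =
      ∑ u : F, ∑ v : F, (if u * v = t then (1 : ℂ) else 0) * ψ (u * a) := by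
    rw [← Fintype.sum_prod_type', ← Fintype.sum_prod_type']
    symm
    rw [← Equiv.sum_comp (isoEquiv (b / a) (two_ne_of_ringChar hchar) hi)]
    refine sum_congr rfl fun p _ => ?_
    simp only [isoEquiv, Equiv.coe_fn_mk]
    have e1 : (p.1 + b / a * p.2) * (p.1 - b / a * p.2) = p.1 ^ 2 + p.2 ^ 2 := by
      linear_combination -p.2 ^ 2 * hi2
    have e2 : (p.1 + b / a * p.2) * a = a * p.1 + b * p.2 := by field_simp
    simp only [e1, e2]
  rw [h1]
  have h2 : ∀ u : F, (∑ v : F, if u * v = t then (1 : ℂ) else 0) = 1 - if u = 0 then 1 else 0 := by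
    intro u
    have := congrArg (Int.cast : ℤ → ℂ) (hyp_sum u t ht)
    push_cast at this
    rw [this]
    split_ifs <;> simp
  simp_rw [← sum_mul, h2, sub_mul, one_mul, sum_sub_distrib]
  rw [AddChar.sum_mulShift _ hψ, if_neg ha]
  simp

lemma circle_count {F : Type} [Field F] [Fintype F] [DecidableEq F] (hchar : ringChar F ≠ 2)
    (t : F) (ht : t ≠ 0) :
    |(∑ x : F, ∑ y : F, (if x ^ 2 + y ^ 2 = t then (1 : ℝ) else 0)) - Fintype.card F| ≤ 1 := by
  have h : (∑ x : F, ∑ y : F, (if x ^ 2 + y ^ 2 = t then (1 : ℤ) else 0)) =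
      Fintype.card F - quadraticChar F (-1) := by
    have h1 : ∀ x : F, (∑ y : F, (if x ^ 2 + y ^ 2 = t then (1 : ℤ) else 0)) =
        quadraticChar F (-1) * quadraticChar F (x ^ 2 - t) + 1 := by
      intro x
      rw [← eta_flip, ← sq_ind hchar]
      refine sum_congr rfl fun y _ => ?_
      congr 1
      apply propext
      constructor <;> intro hh <;> linear_combination hh
    simp_rw [h1, sum_add_distrib, ← mul_sum, J_sum hchar t, if_neg ht]
    simp only [sum_const, card_univ, nsmul_eq_mul]
    ring
  have h2 := congrArg (Int.cast : ℤ → ℝ) h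
  push_cast at h2
  rw [h2]
  rcases quadraticChar_dichotomy (F := F) (a := -1) (by simp) with h | h <;> rw [h] <;> simp

lemma circ_fh {F : Type} [Field F] [Fintype F] [DecidableEq F] (hchar : ringChar F ≠ 2)
    (ψ : AddChar F ℂ) (hψ : ψ.IsPrimitive) (t : F) (ht : t ≠ 0) (d : ℝ)
    (hd : d = ∑ x : F, ∑ y : F, (if x ^ 2 + y ^ 2 = t then (1 : ℝ) else 0)) (m : Fin 2 → F) :
    ‖fh ψ (fun x => (if x 0 ^ 2 + x 1 ^ 2 = t then (1 : ℝ) else 0) - d / (Fintype.card F : ℝ) ^ 2) m‖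
      ≤ 2 * Real.sqrt (Fintype.card F) := by
  have hq : (1 : ℝ) ≤ Fintype.card F := by exact_mod_cast Fintype.card_pos (α := F)
  have hqC : (Fintype.card F : ℂ) ≠ 0 := by exact_mod_cast Fintype.card_ne_zero (α := F)
  have h1 : fh ψ (fun x => (if x 0 ^ 2 + x 1 ^ 2 = t then (1 : ℝ) else 0) - d / (Fintype.card F : ℝ) ^ 2) m =
      (∑ x : F, ∑ y : F, (if x ^ 2 + y ^ 2 = t then (1 : ℂ) else 0) * ψ (m 0 * x + m 1 * y)) -
        (d : ℂ) / (Fintype.card F : ℂ) ^ 2 * if m = 0 then (Fintype.card F : ℂ) ^ 2 else 0 := by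
    rw [← sum_V (fun x y => (if x ^ 2 + y ^ 2 = t then (1 : ℂ) else 0) * ψ (m 0 * x + m 1 * y)),
      ← orth ψ hψ m, fh, mul_sum, ← sum_sub_distrib]
    refine sum_congr rfl fun x _ => ?_
    rw [mul_comm (x 0), mul_comm (x 1)]
    split_ifs <;> push_cast <;> ring
  rw [h1]
  have hψ1 : ψ ≠ 1 := by
    have := hψ (one_ne_zero (α := F))
    rwa [AddChar.mulShift_one] at this
  by_cases hm : m = 0
  · subst hm
    have : (d : ℂ) = ∑ x : F, ∑ y : F, (if x ^ 2 + y ^ 2 = t then (1 : ℂ) else 0) := by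
      rw [hd]
      push_cast
      refine sum_congr rfl fun x _ => sum_congr rfl fun y _ => ?_
      split_ifs <;> simp
    rw [if_pos rfl, div_mul_cancel₀ _ (pow_ne_zero 2 hqC), this]
    simp
  · rw [if_neg hm, mul_zero, sub_zero]
    by_cases hn : m 0 ^ 2 + m 1 ^ 2 = 0
    · have ha : m 0 ≠ 0 := by
        intro h0
        apply hm
        rw [h0] at hn
        have h1 : m 1 = 0 := by simpa using hn
        ext i; fin_cases i <;> simp [h0, h1]
      rw [circle_iso hchar ψ hψ t ht _ _ hn ha, norm_neg, norm_one]
      have := Real.one_le_sqrt.2 hq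
      linarith
    · exact circle_nonzero hchar ψ hψ1 t ht _ _ hn

lemma cs_bound {ι : Type} [Fintype ι] (u v : ι → ℝ) (B V : ℝ) (hB : 0 ≤ B)
    (h : ∑ i, v i ^ 2 ≤ B ^ 2 * V) :
    |∑ i, u i * v i| ≤ B * Real.sqrt (∑ i, u i ^ 2) * Real.sqrt V := by
  have h1 : |∑ i, u i * v i| ≤ Real.sqrt ((∑ i, u i ^ 2) * ∑ i, v i ^ 2) :=
    Real.abs_le_sqrt (sum_mul_sq_le_sq_mul_sq univ u v)
  rw [Real.sqrt_mul (sum_nonneg fun i _ => sq_nonneg _)] at h1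
  have h2 : Real.sqrt (∑ i, v i ^ 2) ≤ B * Real.sqrt V := by
    calc Real.sqrt (∑ i, v i ^ 2) ≤ Real.sqrt (B ^ 2 * V) := Real.sqrt_le_sqrt h
      _ = B * Real.sqrt V := by rw [Real.sqrt_mul (sq_nonneg B), Real.sqrt_sq hB]
  calc _ ≤ _ := h1
    _ ≤ Real.sqrt (∑ i, u i ^ 2) * (B * Real.sqrt V) := by gcongr
    _ = _ := by ring

lemma assemble {V : Type} [Fintype V] (e : V → V → ℝ) (he : ∀ x z, e x z = e z x) (B δ : ℝ) (hB : 0 ≤ B)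
    (hδ : 0 ≤ δ)
    (hop : ∀ v : V → ℝ, ∑ x, (∑ z, e x z * v z) ^ 2 ≤ B ^ 2 * ∑ z, v z ^ 2)
    (f g : V × V → ℝ) :
    |(∑ x, ∑ y, ∑ z, ∑ w, (e x z + δ) * (e w y + δ) * (f (x, y) * g (z, w))) -
      δ ^ 2 * (∑ x, ∑ y, f (x, y)) * (∑ z, ∑ w, g (z, w))| ≤
      B ^ 2 * Real.sqrt (∑ x, ∑ y, f (x, y) ^ 2) * Real.sqrt (∑ z, ∑ w, g (z, w) ^ 2) +
        δ * B * (Real.sqrt (∑ x, (∑ y, f (x, y)) ^ 2) * Real.sqrt (∑ z, (∑ w, g (z, w)) ^ 2) +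
            Real.sqrt (∑ y, (∑ x, f (x, y)) ^ 2) * Real.sqrt (∑ w, (∑ z, g (z, w)) ^ 2)) := by
  have hsplit : (∑ x, ∑ y, ∑ z, ∑ w, (e x z + δ) * (e w y + δ) * (f (x, y) * g (z, w))) -
      δ ^ 2 * (∑ x, ∑ y, f (x, y)) * (∑ z, ∑ w, g (z, w)) =
      (∑ p : V × V, f p * ∑ z, e p.1 z * ∑ w, e p.2 w * g (z, w)) +
      δ * (∑ x, (∑ y, f (x, y)) * ∑ z, e x z * ∑ w, g (z, w)) +
      δ * (∑ y, (∑ x, f (x, y)) * ∑ w, e y w * ∑ z, g (z, w)) := by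
    have e1 : ∑ p : V × V, f p * ∑ z, e p.1 z * ∑ w, e p.2 w * g (z, w) =
        ∑ x, ∑ y, ∑ z, ∑ w, e x z * e w y * (f (x, y) * g (z, w)) := by
      rw [Fintype.sum_prod_type]
      simp_rw [mul_sum]
      refine sum_congr rfl fun x _ => sum_congr rfl fun y _ => sum_congr rfl fun z _ =>
        sum_congr rfl fun w _ => ?_
      rw [he w y]; ring
    have e2 : δ * (∑ x, (∑ y, f (x, y)) * ∑ z, e x z * ∑ w, g (z, w)) =
        ∑ x, ∑ y, ∑ z, ∑ w, δ * e x z * (f (x, y) * g (z, w)) := by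
      simp_rw [sum_mul, mul_sum]
      refine sum_congr rfl fun x _ => sum_congr rfl fun y _ => sum_congr rfl fun z _ =>
        sum_congr rfl fun w _ => ?_
      ring
    have e3 : δ * (∑ y, (∑ x, f (x, y)) * ∑ w, e y w * ∑ z, g (z, w)) =
        ∑ x, ∑ y, ∑ z, ∑ w, δ * e w y * (f (x, y) * g (z, w)) := by
      simp_rw [sum_mul, mul_sum]
      rw [sum_comm]
      refine sum_congr rfl fun x _ => sum_congr rfl fun y _ => ?_
      rw [sum_comm]
      refine sum_congr rfl fun z _ => sum_congr rfl fun w _ => ?_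
      rw [he w y]; ring
    have e4 : δ ^ 2 * (∑ x, ∑ y, f (x, y)) * (∑ z, ∑ w, g (z, w)) =
        ∑ x, ∑ y, ∑ z, ∑ w, δ ^ 2 * (f (x, y) * g (z, w)) := by
      rw [mul_assoc]
      simp_rw [sum_mul, mul_sum]
    rw [e1, e2, e3, e4, sub_eq_iff_eq_add]
    simp_rw [← sum_add_distrib]
    refine sum_congr rfl fun x _ => sum_congr rfl fun y _ => sum_congr rfl fun z _ =>
      sum_congr rfl fun w _ => ?_
    ring
  rw [hsplit]
  have b1 : |∑ p : V × V, f p * ∑ z, e p.1 z * ∑ w, e p.2 w * g (z, w)| ≤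
      B ^ 2 * Real.sqrt (∑ x, ∑ y, f (x, y) ^ 2) * Real.sqrt (∑ z, ∑ w, g (z, w) ^ 2) := by
    rw [← Fintype.sum_prod_type' (fun x y => f (x, y) ^ 2)]
    refine cs_bound f _ (B ^ 2) _ (by positivity) ?_
    rw [Fintype.sum_prod_type, sum_comm]
    calc ∑ y, ∑ x, (∑ z, e x z * ∑ w, e y w * g (z, w)) ^ 2
        ≤ ∑ y, B ^ 2 * ∑ z, (∑ w, e y w * g (z, w)) ^ 2 := sum_le_sum fun y _ => hop _
      _ = B ^ 2 * ∑ z, ∑ y, (∑ w, e y w * g (z, w)) ^ 2 := by rw [← mul_sum, sum_comm]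
      _ ≤ B ^ 2 * ∑ z, B ^ 2 * ∑ w, g (z, w) ^ 2 := by
          gcongr with z
          exact hop _
      _ = _ := by rw [← mul_sum]; ring
  have b2 := cs_bound (fun x => ∑ y, f (x, y)) (fun x => ∑ z, e x z * ∑ w, g (z, w)) B _ hB (hop _)
  have b3 := cs_bound (fun y => ∑ x, f (x, y)) (fun y => ∑ w, e y w * ∑ z, g (z, w)) B _ hB (hop _)
  have c2 := mul_le_mul_of_nonneg_left b2 hδ
  have c3 := mul_le_mul_of_nonneg_left b3 hδ
  refine (abs_add_three _ _ _).trans ?_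
  rw [abs_mul, abs_mul, abs_of_nonneg hδ]
  linarith

lemma ind_mul_ind (P Q : Prop) [Decidable P] [Decidable Q] (v : ℝ) :
    (if P then (1 : ℝ) else 0) * (if Q then (1 : ℝ) else 0) * v = if P ∧ Q then v else 0 := by
  by_cases hP : P <;> by_cases hQ : Q <;> simp [hP, hQ]

/-- Two-edge functional distance theorem in dimension `d = 2`,
for the standard distance `‖x‖ = x₁² + x₂²` on `F_q²`. -/
theorem stmt17 (q : ℕ)
    (F : Type) [Field F] [Fintype F] [DecidableEq F]
    (hq : Fintype.card F = q) (hodd : Odd q)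
    (f g : (Fin 2 → F) × (Fin 2 → F) → ℝ)
    (hf : ∀ p, 0 ≤ f p) (hg : ∀ p, 0 ≤ g p)
    (t : F) (ht : t ≠ 0) :
    |(∑ x, ∑ y, ∑ z, ∑ w,
        if (x 0 - z 0) ^ 2 + (x 1 - z 1) ^ 2 = t ∧
            (w 0 - y 0) ^ 2 + (w 1 - y 1) ^ 2 = t then f (x, y) * g (z, w) else 0) -
        (q : ℝ) ^ (-(2 : ℝ)) * (∑ x, ∑ y, f (x, y)) * (∑ z, ∑ w, g (z, w))| ≤
      3 * (q : ℝ) ^ (-(3 : ℝ)) *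
          (∑ x, ∑ y, f (x, y)) * (∑ z, ∑ w, g (z, w)) +
        4 * (q : ℝ) *
          Real.sqrt (∑ x, ∑ y, f (x, y) ^ 2) * Real.sqrt (∑ z, ∑ w, g (z, w) ^ 2) +
        4 * (q : ℝ) ^ (-(1 / 2 : ℝ)) *
          (Real.sqrt (∑ x, (∑ y, f (x, y)) ^ 2) *
              Real.sqrt (∑ z, (∑ w, g (z, w)) ^ 2) +
            Real.sqrt (∑ y, (∑ x, f (x, y)) ^ 2) *
              Real.sqrt (∑ w, (∑ z, g (z, w)) ^ 2)) := by
  have hchar : ringChar F ≠ 2 := by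
    intro h
    have := FiniteField.even_card_of_char_two h
    rw [hq] at this
    rw [Nat.odd_iff] at hodd
    omega
  set ψ := AddChar.FiniteField.primitiveChar_to_Complex F
  have hψ : ψ.IsPrimitive := AddChar.FiniteField.primitiveChar_to_Complex_isPrimitive F
  obtain ⟨d, hd⟩ : ∃ d : ℝ, d = ∑ x : F, ∑ y : F, (if x ^ 2 + y ^ 2 = t then (1 : ℝ) else 0) := ⟨_, rfl⟩
  have hdq := circle_count hchar t ht
  rw [← hd, hq] at hdq
  have hd0 : 0 ≤ d := by
    rw [hd]
    exact sum_nonneg fun x _ => sum_nonneg fun y _ => by split_ifs <;> norm_num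
  have hq1 : (1 : ℝ) ≤ q := by
    rw [← hq]; exact_mod_cast Fintype.card_pos (α := F)
  have hq0 : (0 : ℝ) < q := by linarith
  have hfh := circ_fh hchar ψ hψ t ht d hd
  rw [hq] at hfh
  set δ : ℝ := d / (q : ℝ) ^ 2 with hδ
  have hδ0 : 0 ≤ δ := by positivity
  set e : (Fin 2 → F) → ℝ := fun x => (if x 0 ^ 2 + x 1 ^ 2 = t then (1 : ℝ) else 0) - δ with he
  have hsym : ∀ x z, e (x - z) = e (z - x) := by
    intro x z
    have h1 : (x - z) 0 ^ 2 + (x - z) 1 ^ 2 = (z - x) 0 ^ 2 + (z - x) 1 ^ 2 := by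
      simp only [Pi.sub_apply]; ring
    simp only [he]
    rw [h1]
  have main := assemble (fun x z => e (x - z)) hsym (2 * Real.sqrt q) δ (by positivity) hδ0
    (fun v => op_bound ψ hψ e _ hfh v) f g
  have hsum : (∑ x, ∑ y, ∑ z, ∑ w, (e (x - z) + δ) * (e (w - y) + δ) * (f (x, y) * g (z, w))) =
      ∑ x, ∑ y, ∑ z, ∑ w, if (x 0 - z 0) ^ 2 + (x 1 - z 1) ^ 2 = t ∧
            (w 0 - y 0) ^ 2 + (w 1 - y 1) ^ 2 = t then f (x, y) * g (z, w) else 0 := by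
    refine sum_congr rfl fun x _ => sum_congr rfl fun y _ => sum_congr rfl fun z _ =>
      sum_congr rfl fun w _ => ?_
    simp only [he, sub_add_cancel, Pi.sub_apply]
    exact ind_mul_ind _ _ _
  rw [hsum] at main
  clear hsum
  set A := (∑ x, ∑ y, ∑ z, ∑ w, if (x 0 - z 0) ^ 2 + (x 1 - z 1) ^ 2 = t ∧
            (w 0 - y 0) ^ 2 + (w 1 - y 1) ^ 2 = t then f (x, y) * g (z, w) else 0)
  have hf1 : 0 ≤ ∑ x, ∑ y, f (x, y) := sum_nonneg fun x _ => sum_nonneg fun y _ => hf _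
  have hg1 : 0 ≤ ∑ x, ∑ y, g (x, y) := sum_nonneg fun x _ => sum_nonneg fun y _ => hg _
  set f1 := ∑ x, ∑ y, f (x, y)
  set g1 := ∑ x, ∑ y, g (x, y)
  have hsq : Real.sqrt q * Real.sqrt q = q := Real.mul_self_sqrt hq0.le
  have hsq0 : 0 < Real.sqrt q := Real.sqrt_pos.2 hq0
  have r2 : (q : ℝ) ^ (-(2 : ℝ)) = 1 / (q : ℝ) ^ 2 := by
    rw [Real.rpow_neg hq0.le, Real.rpow_ofNat, one_div]
  have r3 : (q : ℝ) ^ (-(3 : ℝ)) = 1 / (q : ℝ) ^ 3 := by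
    rw [Real.rpow_neg hq0.le, Real.rpow_ofNat, one_div]
  have rh : (q : ℝ) ^ (-(1 / 2 : ℝ)) = 1 / Real.sqrt q := by
    rw [Real.rpow_neg hq0.le, ← Real.sqrt_eq_rpow, one_div]
  rw [r2, r3, rh]
  rw [abs_le] at hdq
  have k1 : |δ ^ 2 - 1 / (q : ℝ) ^ 2| ≤ 3 * (1 / (q : ℝ) ^ 3) := by
    have : δ ^ 2 - 1 / (q : ℝ) ^ 2 = (d ^ 2 - (q : ℝ) ^ 2) / (q : ℝ) ^ 4 := by
      rw [hδ]; field_simp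
    rw [this, abs_div, abs_of_pos (by positivity : (0 : ℝ) < (q : ℝ) ^ 4),
      div_le_iff₀ (by positivity)]
    have h3 : 3 * (1 / (q : ℝ) ^ 3) * (q : ℝ) ^ 4 = 3 * q := by field_simp
    rw [h3, abs_le]
    constructor <;> nlinarith
  have k2 : δ * (2 * Real.sqrt q) ≤ 4 * (1 / Real.sqrt q) := by
    rw [hδ, mul_one_div, le_div_iff₀ hsq0]
    have : d / (q : ℝ) ^ 2 * (2 * Real.sqrt q) * Real.sqrt q = 2 * (d / q) := by
      rw [show d / (q : ℝ) ^ 2 * (2 * Real.sqrt q) * Real.sqrt q =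
        2 * (d / (q : ℝ) ^ 2) * (Real.sqrt q * Real.sqrt q) by ring, hsq]
      field_simp
    rw [this]
    have : d / q ≤ 2 := by rw [div_le_iff₀ hq0]; linarith
    linarith
  have k3 : (2 * Real.sqrt q) ^ 2 = 4 * (q : ℝ) := by
    rw [mul_pow, Real.sq_sqrt hq0.le]; norm_num
  rw [k3] at main
  have k4 : |(δ ^ 2 - 1 / (q : ℝ) ^ 2) * (f1 * g1)| ≤ 3 * (1 / (q : ℝ) ^ 3) * (f1 * g1) := by
    rw [abs_mul, abs_of_nonneg (mul_nonneg hf1 hg1)]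
    exact mul_le_mul_of_nonneg_right k1 (mul_nonneg hf1 hg1)
  have k5 := mul_le_mul_of_nonneg_right k2 (by positivity : 0 ≤
    (Real.sqrt (∑ x, (∑ y, f (x, y)) ^ 2) * Real.sqrt (∑ z, (∑ w, g (z, w)) ^ 2) +
            Real.sqrt (∑ y, (∑ x, f (x, y)) ^ 2) * Real.sqrt (∑ w, (∑ z, g (z, w)) ^ 2)))
  have k6 : A - 1 / (q : ℝ) ^ 2 * f1 * g1 =
      (A - δ ^ 2 * f1 * g1) + (δ ^ 2 - 1 / (q : ℝ) ^ 2) * (f1 * g1) := by ring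
  rw [k6]
  refine (abs_add_le _ _).trans ?_
  linarith
end
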